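/- Let X be a uniformly convex complex Banach space, let T₁ be a holomorphic C₀-semigroup on X (uniformly bounded, generator A₁), and let A₂,…,Aₙ be bounded pairwise commuting operators (commuting with A₁) generating uniformly bounded semigroups. Then for every ψ ∈ T_n the operator ψ(A), A = (A₁,…,Aₙ), is the generator of a holomorphic semigroup. -/

import Mathlib

open MeasureTheory Filter Topology

noncomputable section

/-- A (one-parameter) `C₀`-semigroup of bounded operators on `X`. -/
def IsC0Semigroup {X : Type*} [NormedAddCommGroup X] [NormedSpace ℂ X]
    (T : ℝ → X →L[ℂ] X) : Prop :=
  T 0 = 1 ∧ (∀ s t : ℝ, 0 ≤ s → 0 ≤ t → T (s + t) = T s ∘L T t) ∧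
    ∀ x : X, Tendsto (fun t => T t x) (𝓝[≥] (0 : ℝ)) (𝓝 x)

/-- `InGenDomain T x y` means `x` belongs to the domain of the infinitesimal generator `A`
of the semigroup `T` and `A x = y`. -/
def InGenDomain {X : Type*} [NormedAddCommGroup X] [NormedSpace ℂ X]
    (T : ℝ → X →L[ℂ] X) (x y : X) : Prop :=
  Tendsto (fun t : ℝ => t⁻¹ • (T t x - x)) (𝓝[>] (0 : ℝ)) (𝓝 y)

/-- The `n`-parameter semigroup `T(u) = T₁(u₁) ⋯ Tₙ(uₙ)`. -/
def Tprod {X : Type*} [NormedAddCommGroup X] [NormedSpace ℂ X] {n : ℕ}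
    (T : Fin n → ℝ → X →L[ℂ] X) (u : Fin n → ℝ) : X →L[ℂ] X :=
  (List.ofFn fun j => T j (u j)).prod

/-- The open negative orthant `(-∞,0)ⁿ`. -/
def negOrthant (n : ℕ) : Set (Fin n → ℝ) := {s | ∀ j, s j < 0}

/-- The closed nonpositive orthant `(-∞,0]ⁿ`. -/
def nonposOrthant (n : ℕ) : Set (Fin n → ℝ) := {s | ∀ j, s j ≤ 0}

/-- A function of `n` variables is absolutely monotone on `(-∞,0)ⁿ` if it is nonnegative
together with all its iterated partial derivatives there. -/
def AbsMonotoneOn (n : ℕ) (f : (Fin n → ℝ) → ℝ) : Prop :=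
  ∀ (k : ℕ) (v : Fin k → Fin n) (s : Fin n → ℝ), s ∈ negOrthant n →
    0 ≤ iteratedFDerivWithin ℝ k f (negOrthant n) s (fun i => Pi.single (v i) 1)

/-- Membership in the class `𝒯ₙ` of (negative) Bernstein functions of `n` variables:
`ψ` is a nonpositive `C^∞`-function on `(-∞,0)ⁿ` all of whose first-order partial
derivatives are absolutely monotone. -/
def MemTn (n : ℕ) (ψ : (Fin n → ℝ) → ℝ) : Prop :=
  ContDiffOn ℝ (⊤ : ℕ∞) ψ (negOrthant n) ∧ (∀ s ∈ negOrthant n, ψ s ≤ 0) ∧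
    ∀ j : Fin n, AbsMonotoneOn n
      (fun s => fderivWithin ℝ ψ (negOrthant n) s (Pi.single j 1))

/-- The Lévy–Khintchine type representation
`ψ(s) = c₀ + c₁·s + ∫ (e^{s·u} - 1) dμ(u)` of a Bernstein function of `n` variables,
where `c₀ ≤ 0`, `c₁ ∈ ℝ₊ⁿ` and `μ` is a positive measure on `ℝ₊ⁿ \ {0}`. -/
def HasLevyRep (n : ℕ) (ψ : (Fin n → ℝ) → ℝ) (c₀ : ℝ) (c₁ : Fin n → ℝ)
    (μ : Measure (Fin n → ℝ)) : Prop :=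
  c₀ ≤ 0 ∧ (∀ j, 0 ≤ c₁ j) ∧ μ {u | ¬ ((∀ j, 0 ≤ u j) ∧ u ≠ 0)} = 0 ∧
    (∀ s ∈ negOrthant n, Integrable (fun u => Real.exp (∑ j, s j * u j) - 1) μ) ∧
    ∀ s ∈ negOrthant n, ψ s = c₀ + ∑ j, c₁ j * s j +
      ∫ u, (Real.exp (∑ j, s j * u j) - 1) ∂μ

/-- The family of bounded positive measures `ν_t` on `ℝ₊ⁿ` with
`∫ e^{s·u} dν_t(u) = e^{t ψ(s)}` (multidimensional Bernstein–Widder). -/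
def IsSubordinator (n : ℕ) (ψ : (Fin n → ℝ) → ℝ) (ν : ℝ → Measure (Fin n → ℝ)) : Prop :=
  ∀ t : ℝ, 0 ≤ t → IsFiniteMeasure (ν t) ∧ (ν t) {u | ¬ ∀ j, 0 ≤ u j} = 0 ∧
    ∀ s ∈ negOrthant n, ∫ u, Real.exp (∑ j, s j * u j) ∂(ν t) = Real.exp (t * ψ s)

/-- The holomorphic (complex) extension `ψ(λ) = c₀ + c₁·λ + ∫ (e^{λ·u} - 1) dμ(u)`
of a Bernstein function with representation `(c₀, c₁, μ)` to `{Re λ ≤ 0} ⊆ ℂⁿ`. -/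
def psiC (n : ℕ) (c₀ : ℝ) (c₁ : Fin n → ℝ) (μ : Measure (Fin n → ℝ))
    (l : Fin n → ℂ) : ℂ :=
  (c₀ : ℂ) + ∑ j, (c₁ j : ℂ) * l j +
    ∫ u, (Complex.exp (∑ j, l j * (u j : ℂ)) - 1) ∂μ

/-- The joint point spectrum of the tuple of generators of the semigroups `T j`. -/
def JointPointSpectrum {X : Type*} [NormedAddCommGroup X] [NormedSpace ℂ X] {n : ℕ}
    (T : Fin n → ℝ → X →L[ℂ] X) : Set (Fin n → ℂ) :=
  {l | ∃ x : X, x ≠ 0 ∧ ∀ j, InGenDomain (T j) x (l j • x)}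

/-- The joint approximate point spectrum of the tuple of generators of the `T j`. -/
def JointApproxSpectrum {X : Type*} [NormedAddCommGroup X] [NormedSpace ℂ X] {n : ℕ}
    (T : Fin n → ℝ → X →L[ℂ] X) : Set (Fin n → ℂ) :=
  {l | ∃ (x : ℕ → X) (y : Fin n → ℕ → X), (∀ m, ‖x m‖ = 1) ∧
    (∀ j m, InGenDomain (T j) (x m) (y j m)) ∧
    ∀ j, Tendsto (fun m => ‖y j m - l j • x m‖) atTop (𝓝 0)}

/-- The joint residual spectrum of the tuple of generators of the `T j`:
those `λ ∈ ℂⁿ` for which `Σⱼ Im (λⱼ - Aⱼ)` is not dense in `X`. -/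
def JointResidualSpectrum {X : Type*} [NormedAddCommGroup X] [NormedSpace ℂ X] {n : ℕ}
    (T : Fin n → ℝ → X →L[ℂ] X) : Set (Fin n → ℂ) :=
  {l | ¬ Dense (↑(Submodule.span ℂ
      (⋃ j, {z : X | ∃ x y, InGenDomain (T j) x y ∧ z = l j • x - y})) : Set X)}

/-- The point spectrum of a (possibly unbounded) operator given by its graph
relation `R x y ↔ (x ∈ D(B) ∧ B x = y)`. -/
def PointSpec {X : Type*} [NormedAddCommGroup X] [NormedSpace ℂ X]
    (R : X → X → Prop) : Set ℂ :=
  {α | ∃ x : X, x ≠ 0 ∧ R x (α • x)}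

/-- The approximate point spectrum of an operator given by its graph relation. -/
def ApproxSpec {X : Type*} [NormedAddCommGroup X] [NormedSpace ℂ X]
    (R : X → X → Prop) : Set ℂ :=
  {α | ∃ x y : ℕ → X, (∀ m, ‖x m‖ = 1) ∧ (∀ m, R (x m) (y m)) ∧
    Tendsto (fun m => ‖y m - α • x m‖) atTop (𝓝 0)}

/-- The residual spectrum of an operator given by its graph relation:
those `α` for which `Im (α - B)` is not dense. -/
def ResidualSpec {X : Type*} [NormedAddCommGroup X] [NormedSpace ℂ X]
    (R : X → X → Prop) : Set ℂ :=
  {α | ¬ Dense (↑(Submodule.span ℂ {z : X | ∃ x y, R x y ∧ z = α • x - y}) : Set X)}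

/-- The resolvent set of a closed operator given by its graph relation: `α` such that
`α - B : D(B) → X` has a bounded everywhere-defined inverse. -/
def ResolventSet {X : Type*} [NormedAddCommGroup X] [NormedSpace ℂ X]
    (R : X → X → Prop) : Set ℂ :=
  {α | ∃ Rv : X →L[ℂ] X, (∀ z : X, R (Rv z) (α • Rv z - z)) ∧
    ∀ x y : X, R x y → Rv (α • x - y) = x}

/-- The constant `K_M = (M+1)/(1 - e^{-(M+1)/M})` from the moment inequality. -/
def KM (M : ℝ) : ℝ := (M + 1) / (1 - Real.exp (-(M + 1) / M))

/-- The open sector `{z ≠ 0 : |arg z| < θ}` in `ℂ`. -/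
def Sector (θ : ℝ) : Set ℂ := {z | z ≠ 0 ∧ |Complex.arg z| < θ}

/-- A `C₀`-semigroup is holomorphic if it extends to a holomorphic semigroup on some
open sector around the positive half axis, strongly continuous at `0` in the sector. -/
def IsHolomorphicSemigroup {X : Type*} [NormedAddCommGroup X] [NormedSpace ℂ X]
    (T : ℝ → X →L[ℂ] X) : Prop :=
  ∃ (θ : ℝ) (S : ℂ → X →L[ℂ] X), 0 < θ ∧ (∀ t : ℝ, 0 < t → S t = T t) ∧
    (∀ z w : ℂ, z ∈ Sector θ → w ∈ Sector θ → S (z + w) = S z ∘L S w) ∧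
    DifferentiableOn ℂ S (Sector θ) ∧
    ∀ x : X, Tendsto (fun z => S z x) (𝓝[Sector θ] 0) (𝓝 x)

end

theorem hs_normSq_sinh (x y : ℝ) :
    ‖Complex.sinh (x + y * Complex.I)‖ ^ 2 = Real.sinh x ^ 2 + Real.sin y ^ 2 := by
  rw [Complex.sinh_add, Complex.sinh_mul_I, Complex.cosh_mul_I, ← Complex.normSq_eq_norm_sq,
    Complex.normSq_apply]
  simp only [← Complex.ofReal_sinh, ← Complex.ofReal_cosh, ← Complex.ofReal_sin,
    ← Complex.ofReal_cos]
  simp only [Complex.add_re, Complex.mul_re, Complex.add_im, Complex.mul_im, Complex.ofReal_re,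
    Complex.ofReal_im, Complex.I_re, Complex.I_im]
  ring_nf
  nlinarith [Real.cosh_sq x, Real.sin_sq_add_cos_sq y]

theorem hs_norm_sinh_ge (x y : ℝ) : |Real.sinh x| ≤ ‖Complex.sinh (x + y * Complex.I)‖ := by
  refine abs_le_of_sq_le_sq ?_ (norm_nonneg _)
  rw [hs_normSq_sinh]; nlinarith [sq_nonneg (Real.sin y)]

theorem hs_norm_sinh_ge' (x y : ℝ) :
    |Real.sin y| * Real.cosh x ≤ ‖Complex.sinh (x + y * Complex.I)‖ := by
  apply le_of_sq_le_sq _ (norm_nonneg _)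
  rw [hs_normSq_sinh, mul_pow, sq_abs, Real.cosh_sq]
  nlinarith [mul_nonneg (sq_nonneg (Real.sinh x)) (sub_nonneg.2 (Real.sin_sq_le_one y))]

theorem hs_sinh_ne {ζ : ℂ} (h : |ζ.im| < Real.pi) (h0 : ζ ≠ 0) : Complex.sinh ζ ≠ 0 := by
  intro hs
  have h1 := hs_normSq_sinh ζ.re ζ.im
  rw [Complex.re_add_im, hs] at h1
  simp at h1
  have h2 : Real.sinh ζ.re = 0 := by nlinarith [sq_nonneg (Real.sinh ζ.re), sq_nonneg (Real.sin ζ.im)]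
  have h3 : Real.sin ζ.im = 0 := by nlinarith [sq_nonneg (Real.sinh ζ.re), sq_nonneg (Real.sin ζ.im)]
  rw [Real.sinh_eq_zero] at h2
  have h4 := (Real.sin_eq_zero_iff_of_lt_of_lt (abs_lt.1 h).1 (abs_lt.1 h).2).1 h3
  exact h0 (Complex.ext h2 h4)

theorem hs_integrable_exp_neg_abs (c : ℝ) : Integrable (fun x : ℝ => Real.exp (-|x - c|)) := by
  have : Integrable (fun x : ℝ => Real.exp (-|x|)) := by
    rw [← integrableOn_univ, ← Set.Iic_union_Ioi (a := (0:ℝ))]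
    refine IntegrableOn.union ?_ ?_
    · refine (integrableOn_exp_Iic 0).congr_fun (fun x hx => ?_) measurableSet_Iic
      simp [abs_of_nonpos (Set.mem_Iic.1 hx)]
    · refine (integrableOn_exp_neg_Ioi 0).congr_fun (fun x hx => ?_) measurableSet_Ioi
      simp [abs_of_pos (Set.mem_Ioi.1 hx)]
  exact this.comp_sub_right c

theorem hs_inv_cosh_le (x : ℝ) : (Real.cosh x)⁻¹ ≤ 2 * Real.exp (-|x|) := by
  rw [← Real.cosh_abs, Real.exp_neg, ← div_eq_mul_inv, inv_le_comm₀ (Real.cosh_pos _) (by positivity),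
    Real.cosh_eq, inv_div]
  gcongr
  linarith [Real.exp_pos (-|x|)]

theorem hs_norm_inv_sinh_le (x y : ℝ) (hy : 0 < |Real.sin y|) :
    ‖(Complex.sinh (x + y * Complex.I))⁻¹‖ ≤ 2 / |Real.sin y| * Real.exp (-|x|) := by
  rw [norm_inv]
  calc _ ≤ (|Real.sin y| * Real.cosh x)⁻¹ := by
        apply inv_anti₀ (mul_pos hy (Real.cosh_pos _)) (hs_norm_sinh_ge' x y)
    _ = |Real.sin y|⁻¹ * (Real.cosh x)⁻¹ := by rw [mul_inv]
    _ ≤ |Real.sin y|⁻¹ * (2 * Real.exp (-|x|)) := by gcongr; exact hs_inv_cosh_le x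
    _ = _ := by ring

theorem hs_cont_inv_sinh {y : ℝ} (hy : Real.sin y ≠ 0) :
    Continuous (fun x : ℝ => (Complex.sinh (x + y * Complex.I))⁻¹) := by
  refine Continuous.inv₀ (by fun_prop) (fun x h => ?_)
  have := hs_norm_sinh_ge' x y
  rw [h, norm_zero] at this
  have := mul_pos (abs_pos.2 hy) (Real.cosh_pos x)
  linarith

theorem hs_integrable_line {E : Type*} [NormedAddCommGroup E] [NormedSpace ℂ E]
    {y M : ℝ} (hy : Real.sin y ≠ 0) {f : ℝ → E} (hf : Continuous f) (hM : ∀ x, ‖f x‖ ≤ M) :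
    Integrable (fun x : ℝ => (Complex.sinh (x + y * Complex.I))⁻¹ • f x) := by
  have h1 := ((hs_integrable_exp_neg_abs 0).const_mul (2 / |Real.sin y|)).mul_const M
  refine h1.mono' ((hs_cont_inv_sinh hy).smul hf).aestronglyMeasurable (ae_of_all _ fun x => ?_)
  rw [norm_smul]
  have := hs_norm_inv_sinh_le x y (abs_pos.2 hy)
  rw [sub_zero]
  have h0 : 0 ≤ M := (norm_nonneg _).trans (hM x)
  gcongr
  exact hM x

theorem hs_scalar_residue {β : ℝ} (hs : 0 < Real.sin β) :
    ∫ x : ℝ, ((Complex.sinh (x + (-β : ℝ) * Complex.I))⁻¹ - (Complex.sinh (x + β * Complex.I))⁻¹)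
      = 2 * Real.pi * Complex.I := by
  have hs' : Real.sin (-β) ≠ 0 := by rw [Real.sin_neg]; linarith
  have hi1 := hs_integrable_line (E := ℂ) (M := 1) hs' (f := fun _ => 1) continuous_const (by simp)
  have hi2 := hs_integrable_line (E := ℂ) (M := 1) hs.ne' (f := fun _ => 1) continuous_const (by simp)
  simp only [smul_eq_mul, mul_one] at hi1 hi2
  have hd : ∀ x : ℝ, HasDerivAt (fun x : ℝ => ((2 * Real.arctan (Real.sinh x / Real.sin β) : ℝ) : ℂ) * Complex.I)
      ((Complex.sinh (x + (-β : ℝ) * Complex.I))⁻¹ - (Complex.sinh (x + β * Complex.I))⁻¹) x := by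
    intro x
    have h1 : HasDerivAt (fun x : ℝ => 2 * Real.arctan (Real.sinh x / Real.sin β))
        (2 * (1 / (1 + (Real.sinh x / Real.sin β) ^ 2) * (Real.cosh x / Real.sin β))) x :=
      (((Real.hasDerivAt_sinh x).div_const _).arctan).const_mul 2
    have h2 := (h1.ofReal_comp).mul_const Complex.I
    refine h2.congr_deriv ?_; symm
    have e1 : Complex.sinh (x + (-β : ℝ) * Complex.I)
        = (Real.sinh x * Real.cos β : ℝ) - (Real.cosh x * Real.sin β : ℝ) * Complex.I := by
      rw [Complex.sinh_add, Complex.sinh_mul_I, Complex.cosh_mul_I]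
      push_cast
      rw [Complex.sin_neg, Complex.cos_neg]; ring
    have e2 : Complex.sinh (x + β * Complex.I)
        = (Real.sinh x * Real.cos β : ℝ) + (Real.cosh x * Real.sin β : ℝ) * Complex.I := by
      rw [Complex.sinh_add, Complex.sinh_mul_I, Complex.cosh_mul_I]
      push_cast; ring
    have n1 : Complex.sinh (x + (-β : ℝ) * Complex.I) ≠ 0 := by
      intro h
      have := hs_normSq_sinh x (-β)
      rw [h] at this
      simp at this
      nlinarith [sq_nonneg (Real.sinh x)]
    have n2 : Complex.sinh (x + β * Complex.I) ≠ 0 := by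
      intro h
      have := hs_normSq_sinh x β
      rw [h] at this
      simp at this
      nlinarith [sq_nonneg (Real.sinh x)]
    have e3 : Complex.sinh (x + (-β : ℝ) * Complex.I) * Complex.sinh (x + β * Complex.I)
        = ((Real.sinh x ^ 2 + Real.sin β ^ 2 : ℝ) : ℂ) := by
      rw [e1, e2]
      have hc := Real.cosh_sq x
      have hsc := Real.sin_sq_add_cos_sq β
      have : Real.sinh x ^ 2 + Real.sin β ^ 2 = (Real.sinh x * Real.cos β) ^ 2
          + (Real.cosh x * Real.sin β) ^ 2 := by
        rw [mul_pow, mul_pow, hc]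
        linear_combination (- Real.sinh x ^ 2) * hsc
      rw [this]; push_cast
      ring_nf; rw [Complex.I_sq]; ring
    rw [inv_sub_inv n1 n2, e3, e1, e2]
    have hpos : Real.sinh x ^ 2 + Real.sin β ^ 2 ≠ 0 := by positivity
    have : 2 * (1 / (1 + (Real.sinh x / Real.sin β) ^ 2) * (Real.cosh x / Real.sin β))
        = 2 * (Real.cosh x * Real.sin β) / (Real.sinh x ^ 2 + Real.sin β ^ 2) := by
      have : 1 + (Real.sinh x / Real.sin β) ^ 2 = (Real.sinh x ^ 2 + Real.sin β ^ 2) / Real.sin β ^ 2 := by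
        field_simp; ring
      rw [this]; field_simp
    rw [this]; push_cast; ring
  have t1 : Tendsto (fun x : ℝ => ((2 * Real.arctan (Real.sinh x / Real.sin β) : ℝ) : ℂ) * Complex.I)
      atTop (𝓝 (((2 * (Real.pi / 2) : ℝ) : ℂ) * Complex.I)) := by
    refine Tendsto.mul_const _ ((Complex.continuous_ofReal.tendsto _).comp ?_)
    refine Tendsto.const_mul _ ?_
    refine (tendsto_nhds_of_tendsto_nhdsWithin Real.tendsto_arctan_atTop).comp ?_
    exact (Real.sinhOrderIso.tendsto_atTop).atTop_div_const hs
  have t2 : Tendsto (fun x : ℝ => ((2 * Real.arctan (Real.sinh x / Real.sin β) : ℝ) : ℂ) * Complex.I)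
      atBot (𝓝 (((2 * (-(Real.pi / 2)) : ℝ) : ℂ) * Complex.I)) := by
    refine Tendsto.mul_const _ ((Complex.continuous_ofReal.tendsto _).comp ?_)
    refine Tendsto.const_mul _ ?_
    refine (tendsto_nhds_of_tendsto_nhdsWithin Real.tendsto_arctan_atBot).comp ?_
    exact (Real.sinhOrderIso.tendsto_atBot).atBot_div_const hs
  rw [integral_of_hasDerivAt_of_tendsto hd (hi1.sub hi2) t2 t1]
  push_cast; ring

theorem hs_strip {E : Type*} [NormedAddCommGroup E] [NormedSpace ℂ E] [CompleteSpace E]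
    {θ β M : ℝ} (hβ : 0 < β) (hβθ : β < θ) (hθ : θ ≤ Real.pi) (F : ℂ → E)
    (hF : DifferentiableOn ℂ F {ζ | |ζ.im| < θ}) (hM : ∀ ζ : ℂ, |ζ.im| < θ → ‖F ζ‖ ≤ M) :
    (∫ x : ℝ, (Complex.sinh (x + (-β : ℝ) * Complex.I))⁻¹ • F (x + (-β : ℝ) * Complex.I))
     - (∫ x : ℝ, (Complex.sinh (x + β * Complex.I))⁻¹ • F (x + β * Complex.I))
      = (2 * Real.pi * Complex.I) • F 0 := by
  have hs : 0 < Real.sin β := Real.sin_pos_of_pos_of_lt_pi hβ (hβθ.trans_le hθ)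
  have hs' : Real.sin (-β) ≠ 0 := by rw [Real.sin_neg]; linarith
  have hopen : IsOpen {ζ : ℂ | |ζ.im| < θ} :=
    isOpen_lt (by fun_prop) continuous_const
  have h0mem : {ζ : ℂ | |ζ.im| < θ} ∈ 𝓝 (0:ℂ) := hopen.mem_nhds (by simp; linarith)
  have hM0 : ‖F 0‖ ≤ M := hM 0 (by simp; linarith)
  set Q : ℂ → E := fun ζ => (dslope Complex.sinh 0 ζ)⁻¹ • dslope F 0 ζ with hQ
  have hQd : DifferentiableOn ℂ Q {ζ | |ζ.im| < θ} := by
    refine DifferentiableOn.smul (DifferentiableOn.inv ?_ ?_) ?_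
    · exact (Complex.differentiableOn_dslope h0mem).2 Complex.differentiable_sinh.differentiableOn
    · intro ζ hζ
      by_cases h : ζ = 0
      · subst h; rw [dslope_same, Complex.deriv_sinh]; simp
      · rw [dslope_of_ne _ h, slope_def_field]
        simp [hs_sinh_ne (hζ.out.trans_le hθ) h, h]
    · exact (Complex.differentiableOn_dslope h0mem).2 hF
  have hQe : ∀ ζ : ℂ, ζ ≠ 0 → Q ζ = (Complex.sinh ζ)⁻¹ • (F ζ - F 0) := by
    intro ζ h
    simp only [hQ]
    rw [dslope_of_ne _ h, dslope_of_ne _ h, slope_def_field, slope_def_module, smul_smul]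
    congr 1
    simp [Complex.sinh_zero]
    field_simp
  have hcl : ∀ y : ℝ, |y| < θ → Continuous (fun x : ℝ => F (x + y * Complex.I)) := by
    intro y hy
    exact hF.continuousOn.comp_continuous (by fun_prop) (fun x => by simpa using hy)
  have habs : |β| < θ := by rwa [abs_of_pos hβ]
  have habs' : |(-β)| < θ := by rwa [abs_neg]
  have i1 : ∀ y : ℝ, |y| < θ → Real.sin y ≠ 0 → Integrable (fun x : ℝ => (Complex.sinh (x + y * Complex.I))⁻¹ • F (x + y * Complex.I)) :=
    fun y hy hy' => hs_integrable_line hy' (hcl y hy) (fun x => hM _ (by simpa using hy))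
  have i2 : ∀ y : ℝ, Real.sin y ≠ 0 → Integrable (fun x : ℝ => (Complex.sinh (x + y * Complex.I))⁻¹ • F 0) :=
    fun y hy' => hs_integrable_line hy' continuous_const (fun x => hM0)
  have hQl : ∀ y : ℝ, Real.sin y ≠ 0 → (fun x : ℝ => Q (x + y * Complex.I)) =
      fun x : ℝ => (Complex.sinh (x + y * Complex.I))⁻¹ • F (x + y * Complex.I)
        - (Complex.sinh (x + y * Complex.I))⁻¹ • F 0 := by
    intro y hy; funext x
    rw [hQe, smul_sub]
    intro h
    have := congrArg Complex.im h
    simp at this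
    rw [this] at hy; simp at hy
  have iQ : ∀ y : ℝ, |y| < θ → Real.sin y ≠ 0 → Integrable (fun x : ℝ => Q (x + y * Complex.I)) := by
    intro y hy hy'
    rw [hQl y hy']
    exact (i1 y hy hy').sub (i2 y hy')
  -- vertical sides
  have hv : ∀ R : ℝ, R ≠ 0 → ‖∫ y in (-β)..β, Q (R + y * Complex.I)‖ ≤ 2 * M * |Real.sinh R|⁻¹ * |β - -β| := by
    intro R hR
    refine intervalIntegral.norm_integral_le_of_norm_le_const (fun y hy => ?_)
    have hy' : |y| < θ := by
      rw [Set.uIoc_of_le (by linarith)] at hy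
      rw [abs_lt]; constructor <;> linarith [hy.1, hy.2]
    rw [hQe _ (by intro h; have := congrArg Complex.re h; simp at this; exact hR this), norm_smul, norm_inv, mul_comm]
    have : 0 < |Real.sinh R| := abs_pos.2 (by simpa using hR)
    have h2 := hs_norm_sinh_ge R y
    have h3 : ‖F (R + y * Complex.I) - F 0‖ ≤ 2 * M := by
      have := hM (R + y * Complex.I) (by simpa using hy')
      linarith [norm_sub_le (F (R + y * Complex.I)) (F 0)]
    gcongr
    linarith [norm_nonneg (F 0)]
  have hsinh : Tendsto (fun R : ℝ => 2 * M * |Real.sinh R|⁻¹ * |β - -β|) atTop (𝓝 0) := by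
    have : Tendsto (fun R : ℝ => |Real.sinh R|⁻¹) atTop (𝓝 0) :=
      (tendsto_abs_atTop_atTop.comp Real.sinhOrderIso.tendsto_atTop).inv_tendsto_atTop
    simpa using (this.const_mul (2 * M)).mul_const |β - -β|
  have hv1 : Tendsto (fun R : ℝ => ∫ y in (-β)..β, Q (R + y * Complex.I)) atTop (𝓝 0) :=
    squeeze_zero_norm' ((eventually_gt_atTop 0).mono fun R hR => hv R hR.ne') hsinh
  have hv2 : Tendsto (fun R : ℝ => ∫ y in (-β)..β, Q ((-R : ℝ) + y * Complex.I)) atTop (𝓝 0) := by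
    refine squeeze_zero_norm' ((eventually_gt_atTop 0).mono fun R hR => ?_) hsinh
    have := hv (-R) (by linarith)
    rwa [Real.sinh_neg, abs_neg] at this
  have hrect : ∀ R : ℝ, (((∫ x in (-R)..R, Q (x + (-β : ℝ) * Complex.I)) - ∫ x in (-R)..R, Q (x + β * Complex.I))
      + Complex.I • ∫ y in (-β)..β, Q (R + y * Complex.I)) - Complex.I • ∫ y in (-β)..β, Q ((-R : ℝ) + y * Complex.I) = 0 := by
    intro R
    have := Complex.integral_boundary_rect_eq_zero_of_differentiableOn Q (⟨-R, -β⟩) (⟨R, β⟩)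
      (hQd.mono ?_)
    · simpa using this
    · intro ζ hζ
      have h2 := hζ.2
      simp only [Set.mem_preimage] at h2
      rw [Set.uIcc_of_le (by linarith)] at h2
      simp only [Set.mem_ofPred_eq, abs_lt]; constructor <;> linarith [h2.1, h2.2]
  have hlim := (((intervalIntegral_tendsto_integral (iQ (-β) habs' hs') tendsto_neg_atTop_atBot tendsto_id).sub
    (intervalIntegral_tendsto_integral (iQ β habs hs.ne') tendsto_neg_atTop_atBot tendsto_id)).add
      (hv1.const_smul Complex.I)).sub (hv2.const_smul Complex.I)
  have h0 : (∫ x : ℝ, Q (x + (-β : ℝ) * Complex.I)) - (∫ x : ℝ, Q (x + β * Complex.I)) = 0 := by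
    have := tendsto_nhds_unique hlim (tendsto_const_nhds.congr (fun R => (hrect R).symm))
    simpa using this
  rw [hQl _ hs', hQl _ hs.ne', integral_sub (i1 _ habs' hs') (i2 _ hs'), integral_sub (i1 _ habs hs.ne') (i2 _ hs.ne')] at h0
  have hr := hs_scalar_residue hs
  rw [integral_sub] at hr
  · rw [← hr, sub_smul, ← integral_smul_const, ← integral_smul_const]
    rw [← sub_eq_zero]
    rw [← h0]; abel
  · simpa using hs_integrable_line (E := ℂ) (M := 1) hs' (f := fun _ => 1) continuous_const (by simp)
  · simpa using hs_integrable_line (E := ℂ) (M := 1) hs.ne' (f := fun _ => 1) continuous_const (by simp)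


theorem hs_exp_sub_le {a b : ℂ} {m : ℝ} (ha : a.re ≤ m) (hb : b.re ≤ m) :
    ‖Complex.exp a - Complex.exp b‖ ≤ Real.exp m * ‖a - b‖ := by
  have hc : Convex ℝ {z : ℂ | z.re ≤ m} := convex_halfSpace_re_le m
  refine hc.norm_image_sub_le_of_norm_hasDerivWithin_le (f := Complex.exp) (f' := Complex.exp)
    (fun x _ => (Complex.hasDerivAt_exp x).hasDerivWithinAt) (fun x hx => ?_) hb ha
  rw [Complex.norm_exp]; exact Real.exp_le_exp.2 hx

theorem hs_ye (c r x : ℝ) (hc : 0 < c) (hr : 0 < r) :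
    c * r * Real.exp x * Real.exp (-(c * r * Real.exp x)) ≤ Real.exp (-|x - (- Real.log (c * r))|) := by
  have hcr : 0 < c * r := by positivity
  obtain ⟨y, hy⟩ : ∃ y, y = x - (- Real.log (c * r)) := ⟨_, rfl⟩
  have e : c * r * Real.exp x = Real.exp y := by
    rw [hy, sub_neg_eq_add, Real.exp_add, Real.exp_log hcr]; ring
  rw [e, ← hy, ← Real.exp_add]
  apply Real.exp_le_exp.2
  have h1 : y + 1 ≤ Real.exp y := Real.add_one_le_exp y
  have h2 : 0 < Real.exp y := Real.exp_pos y
  rcases abs_cases y with ⟨h, _⟩ | ⟨h, _⟩ <;> rw [h]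
  · have := Real.quadratic_le_exp_of_nonneg (x := y) (by assumption)
    nlinarith [sq_nonneg (y-1)]
  · linarith

noncomputable def hsJ : ℝ := ∫ x : ℝ, Real.exp (-|x|)

theorem hsJ_shift (c : ℝ) : ∫ x : ℝ, Real.exp (-|x - c|) = hsJ :=
  integral_sub_right_eq_self (fun x : ℝ => Real.exp (-|x|)) c

theorem hsJ_nonneg : 0 ≤ hsJ := integral_nonneg fun _ => (Real.exp_pos _).le

theorem hs_a_formula {w η : ℂ} {u : ℝ} (hu : 0 < u) (hη : 0 < η.re) (hw : 0 < w.re)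
    (hηw : (η * w).re < 0) (hwu : w ≠ u) :
    IntegrableOn (fun r : ℝ => (Complex.exp (-(r * η * u)) - Complex.exp (-(r * u : ℝ))) * (w * η * Complex.exp (r * η * w))
      + (u * Real.exp (-(r * u)) : ℝ) * (Complex.exp (r * η * w) - Complex.exp (-(r * w)))) (Set.Ioi (0:ℝ)) ∧
    ∫ r in Set.Ioi (0:ℝ), ((Complex.exp (-(r * η * u)) - Complex.exp (-(r * u : ℝ))) * (w * η * Complex.exp (r * η * w))
      + (u * Real.exp (-(r * u)) : ℝ) * (Complex.exp (r * η * w) - Complex.exp (-(r * w))))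
    = - (w / (w - u) - w / (w + u)) := by
  have r1 : (-(η * u) + η * w).re < 0 := by
    simp only [Complex.add_re, Complex.neg_re, Complex.mul_re, Complex.ofReal_re, Complex.ofReal_im] at *
    nlinarith [mul_pos hη hu]
  have r2 : (-(u:ℂ) + η * w).re < 0 := by
    simp only [Complex.add_re, Complex.neg_re, Complex.mul_re, Complex.ofReal_re, Complex.ofReal_im] at *
    nlinarith [mul_pos hη hu]
  have r3 : (-(u:ℂ) - w).re < 0 := by
    simp only [Complex.sub_re, Complex.neg_re, Complex.mul_re, Complex.ofReal_re] at *
    linarith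
  have i1 := integrableOn_exp_mul_complex_Ioi r1 0
  have i2 := integrableOn_exp_mul_complex_Ioi r2 0
  have i3 := integrableOn_exp_mul_complex_Ioi r3 0
  have j1 := integral_exp_mul_complex_Ioi r1 0
  have j2 := integral_exp_mul_complex_Ioi r2 0
  have j3 := integral_exp_mul_complex_Ioi r3 0
  have key : (fun r : ℝ => (Complex.exp (-(r * η * u)) - Complex.exp (-(r * u : ℝ))) * (w * η * Complex.exp (r * η * w))
      + (u * Real.exp (-(r * u)) : ℝ) * (Complex.exp (r * η * w) - Complex.exp (-(r * w))))
     = fun r : ℝ => (w * η) * Complex.exp ((-(η * u) + η * w) * r) + (u - w * η) * Complex.exp ((-(u:ℂ) + η * w) * r) - u * Complex.exp ((-(u:ℂ) - w) * r) := by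
    funext r
    have e1 : (-(η * u) + η * w) * r = -(r * η * u) + r * η * w := by ring
    have e2 : (-(u:ℂ) + η * w) * r = -(r * u) + r * η * w := by ring
    have e3 : (-(u:ℂ) - w) * r = -(r * u) + -(r * w) := by ring
    rw [e1, e2, e3, Complex.exp_add, Complex.exp_add, Complex.exp_add]
    push_cast
    ring
  rw [key]
  refine ⟨((i1.const_mul _).add (i2.const_mul _)).sub (i3.const_mul _), ?_⟩
  have i12 : IntegrableOn (fun r : ℝ => (w * η) * Complex.exp ((-(η * u) + η * w) * r) + (u - w * η) * Complex.exp ((-(u:ℂ) + η * w) * r)) (Set.Ioi 0) := (i1.const_mul _).add (i2.const_mul _)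
  rw [integral_sub i12 (i3.const_mul _),
    integral_add (i1.const_mul _) (i2.const_mul _), integral_const_mul, integral_const_mul, integral_const_mul, j1, j2, j3]
  have n1 : w - u ≠ 0 := sub_ne_zero.2 hwu
  have n0 : η ≠ 0 := by rintro rfl; simp at hη
  have n2 : (-(u:ℂ) + η * w) ≠ 0 := by intro h; rw [h] at r2; simp at r2
  have n3 : (-(u:ℂ) - w) ≠ 0 := by intro h; rw [h] at r3; simp at r3
  have n4 : w + u ≠ 0 := by intro h; apply n3; linear_combination -h
  have e4 : (-(η * u) + η * w) = η * (w - u) := by ring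
  have e5 : (-(u:ℂ) - w) = -(w + u) := by ring
  have n5 : w * η - u ≠ 0 := by intro h; apply n2; linear_combination h
  have e6 : (-(u:ℂ) + η * w) = w * η - u := by ring
  rw [e4, e5, e6]
  simp only [Complex.ofReal_zero, mul_zero, Complex.exp_zero]
  field_simp
  ring

theorem hs_inv_sinh_eq {w : ℂ} {u : ℝ} (hu : 0 < u) (ζ : ℂ) (hw : w = Complex.exp (ζ + (Real.log u : ℝ)))
    (h1 : w ≠ u) (h2 : w + u ≠ 0) : (Complex.sinh ζ)⁻¹ = w / (w - u) - w / (w + u) := by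
  have hu0 : (u:ℂ) ≠ 0 := by exact_mod_cast hu.ne'
  have e : Complex.exp ζ = w / u := by
    rw [hw, Complex.exp_add, ← Complex.ofReal_exp, Real.exp_log hu]; field_simp
  have hw0 : w ≠ 0 := by rw [hw]; exact Complex.exp_ne_zero _
  have n1 : w - u ≠ 0 := sub_ne_zero.2 h1
  rw [Complex.sinh, Complex.exp_neg, e]
  have : (w / u - (w / u)⁻¹) / 2 = (w - u) * (w + u) / (2 * u * w) := by
    field_simp; ring
  rw [this, inv_div]
  field_simp
  ring


noncomputable def hsφ (η : ℂ) (r u : ℝ) : ℂ := Complex.exp (-(r * η * u)) - Complex.exp (-(r * u : ℝ))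

theorem hsφ_le {η : ℂ} {c r u : ℝ} (hη : ‖η‖ ≤ 1) (hc : c ≤ η.re) (hr : 0 ≤ r) (hu : 0 ≤ u) :
    ‖hsφ η r u‖ ≤ 2 * (r * u) * Real.exp (-(c * r * u)) := by
  have hc1 : c ≤ 1 := hc.trans ((Complex.re_le_norm η).trans hη)
  have hru : 0 ≤ r * u := by positivity
  refine (hs_exp_sub_le (m := -(c * r * u)) ?_ ?_).trans ?_
  · simp; nlinarith
  · simp only [← Complex.ofReal_neg, Complex.ofReal_re]; nlinarith
  · have : -(r * η * u) - ((-(r * u : ℝ) : ℝ):ℂ) = ((r * u : ℝ):ℂ) * (1 - η) := by push_cast; ring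
    rw [← Complex.ofReal_neg, this, norm_mul, Complex.norm_real, Real.norm_of_nonneg hru]
    have : ‖1 - η‖ ≤ 2 := (norm_sub_le _ _).trans (by simp; linarith)
    calc _ ≤ Real.exp (-(c * r * u)) * (r * u * 2) := by gcongr
      _ = _ := by ring

theorem hs_side {E : Type*} [NormedAddCommGroup E] [NormedSpace ℂ E] [CompleteSpace E]
    {b gm c M : ℝ} (hc : 0 < c) (hb : c ≤ Real.cos b)
    (hg : c ≤ Real.cos gm) (hbg : c ≤ - Real.cos (b + gm)) (hsb : Real.sin b ≠ 0) (v : ℝ → E)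
    (hv : Continuous v) (hM : ∀ x, ‖v x‖ ≤ M) :
    ∃ (K K' : ℝ → E) (C : ℝ), StronglyMeasurable K ∧ StronglyMeasurable K' ∧
      (∀ r, 0 < r → ‖K r‖ ≤ C / r) ∧ (∀ r, 0 < r → ‖K' r‖ ≤ C) ∧ ∀ u : ℝ, 0 < u →
      ∫ x : ℝ, (Complex.sinh ((x - Real.log u : ℝ) + b * Complex.I))⁻¹ • v x =
        ∫ r in Set.Ioi (0:ℝ), (hsφ (Complex.exp (gm * Complex.I)) r u • K r
          + ((u * Real.exp (-(r * u)) : ℝ) : ℂ) • K' r) := by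
  have hM0 : 0 ≤ M := (norm_nonneg _).trans (hM 0)
  set η := Complex.exp (gm * Complex.I) with hη
  have hηn : ‖η‖ = 1 := Complex.norm_exp_ofReal_mul_I gm
  have hηre : η.re = Real.cos gm := Complex.exp_ofReal_mul_I_re gm
  set w : ℝ → ℂ := fun x => Complex.exp (x + b * Complex.I) with hw
  have hwc : Continuous w := by fun_prop
  have hwn : ∀ x, ‖w x‖ = Real.exp x := fun x => by simp [hw, Complex.norm_exp]
  have hwre : ∀ x, (w x).re = Real.exp x * Real.cos b := fun x => by simp [hw, Complex.exp_re]
  have hwim : ∀ x, (w x).im = Real.exp x * Real.sin b := fun x => by simp [hw, Complex.exp_im]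
  have hηw : ∀ x, (η * w x).re = Real.exp x * Real.cos (b + gm) := fun x => by
    rw [hη, hw]; simp only; rw [← Complex.exp_add, Complex.exp_re]; simp [add_comm]
  have p1 : ∀ x r : ℝ, 0 < r → ‖w x * η * Complex.exp (r * η * w x)‖ ≤
      (1 / (c * r)) * Real.exp (-|x - (- Real.log (c * r))|) := by
    intro x r hr
    rw [norm_mul, norm_mul, hwn, hηn, Complex.norm_exp, mul_assoc (r:ℂ), Complex.re_ofReal_mul, hηw]
    have := hs_ye c r x hc hr
    rw [div_mul_eq_mul_div, one_mul, le_div_iff₀ (by positivity)]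
    refine le_trans ?_ this
    have : Real.exp (r * (Real.exp x * Real.cos (b + gm))) ≤ Real.exp (-(c * r * Real.exp x)) := by
      apply Real.exp_le_exp.2
      have : 0 < r * Real.exp x := by positivity
      nlinarith
    calc _ = c * r * Real.exp x * Real.exp (r * (Real.exp x * Real.cos (b + gm))) := by ring
      _ ≤ _ := by gcongr
  have p2 : ∀ x r : ℝ, 0 < r → ‖Complex.exp (r * η * w x) - Complex.exp (-(r * w x))‖ ≤
      (2 / c) * Real.exp (-|x - (- Real.log (c * r))|) := by
    intro x r hr
    have hrx : 0 < r * Real.exp x := by positivity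
    have h1 := hs_exp_sub_le (a := r * η * w x) (b := -(r * w x)) (m := -(c * r * Real.exp x))
      (by rw [mul_assoc (r:ℂ), Complex.re_ofReal_mul, hηw]; nlinarith)
      (by rw [Complex.neg_re, Complex.re_ofReal_mul, hwre]; nlinarith)
    have h2 : ‖r * η * w x - -(r * w x)‖ ≤ 2 * (r * Real.exp x) := by
      refine (norm_sub_le _ _).trans ?_
      rw [norm_neg, norm_mul, norm_mul, norm_mul, hηn, hwn, Complex.norm_real, Real.norm_of_nonneg hr.le]
      linarith
    have := hs_ye c r x hc hr
    rw [div_mul_eq_mul_div, le_div_iff₀ hc]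
    calc _ ≤ (Real.exp (-(c * r * Real.exp x)) * (2 * (r * Real.exp x))) * c := by
          gcongr; exact h1.trans (by gcongr)
      _ = 2 * (c * r * Real.exp x * Real.exp (-(c * r * Real.exp x))) := by ring
      _ ≤ _ := by gcongr
  set k1 : ℝ → ℝ → ℂ := fun x r => w x * η * Complex.exp (r * η * w x) with hk1
  set k2 : ℝ → ℝ → ℂ := fun x r => Complex.exp (r * η * w x) - Complex.exp (-(r * w x)) with hk2
  have k1c : Continuous (Function.uncurry k1) := by
    simp only [hk1, Function.uncurry_def]; fun_prop
  have k2c : Continuous (Function.uncurry k2) := by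
    simp only [hk2, Function.uncurry_def]; fun_prop
  have q1c : Continuous (fun p : ℝ × ℝ => k1 p.1 p.2 • v p.1) := by
    exact (k1c).smul (hv.comp continuous_fst)
  have q2c : Continuous (fun p : ℝ × ℝ => k2 p.1 p.2 • v p.1) := by
    exact (k2c).smul (hv.comp continuous_fst)
  have b1 : ∀ x r, 0 < r → ‖k1 x r • v x‖ ≤ (1 / (c * r)) * M * Real.exp (-|x - (- Real.log (c * r))|) := by
    intro x r hr
    rw [norm_smul]
    calc _ ≤ ((1 / (c * r)) * Real.exp (-|x - (- Real.log (c * r))|)) * M := by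
          gcongr; exact p1 x r hr; exact hM x
      _ = _ := by ring
  have b2 : ∀ x r, 0 < r → ‖k2 x r • v x‖ ≤ (2 / c) * M * Real.exp (-|x - (- Real.log (c * r))|) := by
    intro x r hr
    rw [norm_smul]
    calc _ ≤ ((2 / c) * Real.exp (-|x - (- Real.log (c * r))|)) * M := by
          gcongr; exact p2 x r hr; exact hM x
      _ = _ := by ring
  have i1 : ∀ r, 0 < r → Integrable (fun x => k1 x r • v x) := fun r hr =>
    ((hs_integrable_exp_neg_abs _).const_mul _).mono'
      (q1c.comp (by fun_prop : Continuous fun x : ℝ => (x, r))).aestronglyMeasurable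
      (.of_forall fun x => b1 x r hr)
  have i2 : ∀ r, 0 < r → Integrable (fun x => k2 x r • v x) := fun r hr =>
    ((hs_integrable_exp_neg_abs _).const_mul _).mono'
      (q2c.comp (by fun_prop : Continuous fun x : ℝ => (x, r))).aestronglyMeasurable
      (.of_forall fun x => b2 x r hr)
  have n1 : ∀ r, 0 < r → ∫ x, ‖k1 x r • v x‖ ≤ (1 / (c * r)) * M * hsJ := by
    intro r hr
    rw [← hsJ_shift (- Real.log (c * r)), ← integral_const_mul]
    exact integral_mono (i1 r hr).norm ((hs_integrable_exp_neg_abs _).const_mul _) (fun x => b1 x r hr)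
  have n2 : ∀ r, 0 < r → ∫ x, ‖k2 x r • v x‖ ≤ (2 / c) * M * hsJ := by
    intro r hr
    rw [← hsJ_shift (- Real.log (c * r)), ← integral_const_mul]
    exact integral_mono (i2 r hr).norm ((hs_integrable_exp_neg_abs _).const_mul _) (fun x => b2 x r hr)
  have hJ := hsJ_nonneg
  refine ⟨fun r => - ∫ x, k1 x r • v x, fun r => - ∫ x, k2 x r • v x, (2 / c) * M * hsJ, ?_, ?_, ?_, ?_, ?_⟩
  · exact (StronglyMeasurable.integral_prod_left (f := fun x r => k1 x r • v x) q1c.stronglyMeasurable).neg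
  · exact (StronglyMeasurable.integral_prod_left (f := fun x r => k2 x r • v x) q2c.stronglyMeasurable).neg
  · intro r hr
    rw [norm_neg]
    refine (norm_integral_le_integral_norm _).trans ((n1 r hr).trans ?_)
    have : (1 / (c * r)) * M * hsJ = (1 / c) * M * hsJ / r := by field_simp
    rw [this]; gcongr; norm_num
  · intro r hr
    rw [norm_neg]
    exact (norm_integral_le_integral_norm _).trans (n2 r hr)
  intro u hu
  have hηle : c ≤ η.re := by rw [hηre]; exact hg
  have e1 : ∀ x : ℝ, (Complex.sinh ((x - Real.log u : ℝ) + b * Complex.I))⁻¹ =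
      - ∫ r in Set.Ioi (0:ℝ), (hsφ η r u * k1 x r + ((u * Real.exp (-(r * u)) : ℝ) : ℂ) * k2 x r) := by
    intro x
    have hne : w x ≠ u := by
      intro h; have := hwim x; rw [h] at this; simp at this; exact hsb this
    have hp : 0 < (w x).re := by rw [hwre]; have := Real.exp_pos x; nlinarith
    have := (hs_a_formula (w := w x) (η := η) hu (by linarith) hp
      (by rw [hηw]; have := Real.exp_pos x; nlinarith) hne).2
    rw [hs_inv_sinh_eq (w := w x) hu _ (by simp only [hw]; congr 1; push_cast; ring) hne
      (by intro h; have := congrArg Complex.re h; simp at this; linarith)]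
    simp only [hk1, hk2, hsφ]
    rw [this, neg_neg]
  set f : ℝ → ℝ → E := fun x r => (hsφ η r u * k1 x r + ((u * Real.exp (-(r * u)) : ℝ) : ℂ) * k2 x r) • v x with hf
  have fc : Continuous (Function.uncurry f) := by
    simp only [hf, Function.uncurry_def, hsφ]
    refine Continuous.smul ?_ (by fun_prop)
    refine Continuous.add (Continuous.mul (by fun_prop) k1c) (Continuous.mul (by fun_prop) k2c)
  have fe : ∀ x r, f x r = hsφ η r u • (k1 x r • v x) + ((u * Real.exp (-(r * u)) : ℝ) : ℂ) • (k2 x r • v x) := by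
    intro x r; simp only [hf, add_smul, mul_smul]
  have fi : ∀ r, 0 < r → Integrable (fun x => f x r) := by
    intro r hr
    simp only [fe]
    exact ((i1 r hr).smul _).add ((i2 r hr).smul _)
  have fn : ∀ r, 0 < r → ∫ x, ‖f x r‖ ≤ (4 / c * M * hsJ * u) * Real.exp (-(c * u) * r) := by
    intro r hr
    have hc1 : c ≤ 1 := hb.trans (Real.cos_le_one b)
    calc ∫ x, ‖f x r‖ ≤ ∫ x, (‖hsφ η r u‖ * ‖k1 x r • v x‖ + (u * Real.exp (-(r * u))) * ‖k2 x r • v x‖) := by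
          refine integral_mono (fi r hr).norm (((i1 r hr).norm.const_mul _).add ((i2 r hr).norm.const_mul _)) ?_
          intro x
          simp only [fe]
          refine (norm_add_le _ _).trans ?_
          rw [norm_smul (hsφ η r u), norm_smul (((u * Real.exp (-(r * u)) : ℝ) : ℂ)), Complex.norm_real, Real.norm_of_nonneg (by positivity)]
      _ = ‖hsφ η r u‖ * (∫ x, ‖k1 x r • v x‖) + (u * Real.exp (-(r * u))) * ∫ x, ‖k2 x r • v x‖ := by
          rw [integral_add ((i1 r hr).norm.const_mul _) ((i2 r hr).norm.const_mul _), integral_const_mul, integral_const_mul]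
      _ ≤ (2 * (r * u) * Real.exp (-(c * r * u))) * ((1 / (c * r)) * M * hsJ) +
          (u * Real.exp (-(c * r * u))) * ((2 / c) * M * hsJ) := by
          have : -(r * u) ≤ -(c * r * u) := by have : 0 < r * u := by positivity
                                               nlinarith
          gcongr
          · exact hsφ_le hηn.le hηle hr.le hu.le
          · exact n1 r hr
          · exact n2 r hr
      _ = _ := by
          have : -(c * u) * r = -(c * r * u) := by ring
          rw [this]; field_simp; ring
  have fint : Integrable (Function.uncurry f) (volume.prod (volume.restrict (Set.Ioi (0:ℝ)))) := by
    rw [integrable_prod_iff' fc.aestronglyMeasurable]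
    refine ⟨?_, ?_⟩
    · filter_upwards [ae_restrict_mem measurableSet_Ioi] with r hr
      exact fi r hr
    · refine Integrable.mono' (g := fun r => (4 / c * M * hsJ * u) * Real.exp (-(c * u) * r)) ?_ ?_ ?_
      · exact (integrableOn_exp_mul_Ioi (by have : 0 < c * u := by positivity
                                            linarith) 0).const_mul _
      · exact (StronglyMeasurable.integral_prod_left (f := fun x r => ‖f x r‖) fc.norm.stronglyMeasurable).aestronglyMeasurable
      · filter_upwards [ae_restrict_mem measurableSet_Ioi] with r hr
        rw [Real.norm_of_nonneg (integral_nonneg fun _ => norm_nonneg _)]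
        exact fn r hr
  calc _ = ∫ x : ℝ, - ∫ r in Set.Ioi (0:ℝ), f x r := by
        congr 1; funext x
        rw [e1, neg_smul, ← integral_smul_const]
    _ = - ∫ r in Set.Ioi (0:ℝ), ∫ x : ℝ, f x r := by
        rw [integral_neg, integral_integral_swap fint]
    _ = _ := by
        rw [← integral_neg]
        refine setIntegral_congr_fun measurableSet_Ioi ?_
        intro r hr
        simp only [fe]
        rw [integral_add ((i1 r hr).fun_smul _) ((i2 r hr).fun_smul _), integral_smul, integral_smul]
        simp only [smul_neg, neg_add]


theorem hs_mem_sector {θ : ℝ} (hθ : θ ≤ Real.pi) {u : ℝ} (hu : 0 < u) {ζ : ℂ} (h : |ζ.im| < θ) :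
    (u : ℂ) * Complex.exp ζ ∈ Sector θ := by
  refine ⟨mul_ne_zero (by exact_mod_cast hu.ne') (Complex.exp_ne_zero _), ?_⟩
  rw [Complex.arg_real_mul _ hu, ← Complex.log_im, Complex.log_exp]
  · exact h
  · have := (abs_lt.1 h).1; linarith
  · have := (abs_lt.1 h).2; linarith

theorem hs_repr {E : Type*} [NormedAddCommGroup E] [NormedSpace ℂ E] [CompleteSpace E]
    {θ M : ℝ} (hθ0 : 0 < θ) (hθ : θ ≤ Real.pi / 2) (W : ℂ → E) (hW : DifferentiableOn ℂ W (Sector θ))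
    (hM : ∀ z ∈ Sector θ, ‖W z‖ ≤ M) :
    ∃ (η₁ η₂ : ℂ) (c C : ℝ) (K K' L L' : ℝ → E), 0 < c ∧ ‖η₁‖ ≤ 1 ∧ ‖η₂‖ ≤ 1 ∧ c ≤ η₁.re ∧ c ≤ η₂.re ∧
      StronglyMeasurable K ∧ StronglyMeasurable K' ∧ StronglyMeasurable L ∧ StronglyMeasurable L' ∧
      (∀ r, 0 < r → ‖K r‖ ≤ C / r) ∧ (∀ r, 0 < r → ‖K' r‖ ≤ C) ∧
      (∀ r, 0 < r → ‖L r‖ ≤ C / r) ∧ (∀ r, 0 < r → ‖L' r‖ ≤ C) ∧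
      ∀ u : ℝ, 0 < u → W u =
        (∫ r in Set.Ioi (0:ℝ), (hsφ η₁ r u • K r + ((u * Real.exp (-(r * u)) : ℝ) : ℂ) • K' r)) +
        ∫ r in Set.Ioi (0:ℝ), (hsφ η₂ r u • L r + ((u * Real.exp (-(r * u)) : ℝ) : ℂ) • L' r) := by
  have hpi := Real.pi_pos
  set β := θ / 2 with hβ
  set gm := Real.pi / 2 - β / 2 with hgm
  have hS : 0 < Real.sin (β / 2) := Real.sin_pos_of_pos_of_lt_pi (by linarith) (by linarith)
  have hCb : 0 < Real.cos β := Real.cos_pos_of_mem_Ioo ⟨by linarith, by linarith⟩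
  have hSb : 0 < Real.sin β := Real.sin_pos_of_pos_of_lt_pi (by linarith) (by linarith)
  have hcg : Real.cos gm = Real.sin (β / 2) := Real.cos_pi_div_two_sub _
  have hcbg : - Real.cos (β + gm) = Real.sin (β / 2) := by
    rw [show β + gm = β / 2 + Real.pi / 2 by rw [hgm]; ring, Real.cos_add_pi_div_two]; ring
  set c := min (Real.cos β) (Real.sin (β / 2)) with hc
  have hc0 : 0 < c := lt_min hCb hS
  have hc1 : c ≤ Real.cos β := min_le_left _ _
  have hc2 : c ≤ Real.sin (β / 2) := min_le_right _ _
  have hmem : ∀ b : ℝ, |b| = β → ∀ x : ℝ, Complex.exp (x + b * Complex.I) ∈ Sector θ := by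
    intro b hb x
    have := hs_mem_sector (θ := θ) (by linarith) one_pos (ζ := x + b * Complex.I) (by simp [hb]; linarith)
    simpa using this
  have hcont : ∀ b : ℝ, |b| = β → Continuous fun x : ℝ => W (Complex.exp (x + b * Complex.I)) := by
    intro b hb
    exact hW.continuousOn.comp_continuous (by fun_prop) (hmem b hb)
  have hbd : ∀ (k : ℂ) (b : ℝ), |b| = β → ∀ x : ℝ, ‖k • W (Complex.exp (x + b * Complex.I))‖ ≤ ‖k‖ * M := by
    intro k b hb x
    rw [norm_smul]; gcongr; exact hM _ (hmem b hb x)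
  have ab1 : |(-β)| = β := by rw [abs_neg, abs_of_pos (by linarith)]
  have ab2 : |β| = β := abs_of_pos (by linarith)
  set k : ℂ := (2 * Real.pi * Complex.I)⁻¹ with hk
  obtain ⟨K, K', C1, hK, hK', bK, bK', eK⟩ := hs_side (b := -β) (gm := -gm) hc0 (by rwa [Real.cos_neg])
    (by rw [Real.cos_neg, hcg]; exact hc2) (by rw [← neg_add, Real.cos_neg, hcbg]; exact hc2)
    (by rw [Real.sin_neg]; linarith) (fun x : ℝ => k • W (Complex.exp (x + (-β:ℝ) * Complex.I)))
    ((hcont _ ab1).const_smul k) (hbd k _ ab1)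
  obtain ⟨L, L', C2, hL, hL', bL, bL', eL⟩ := hs_side (b := β) (gm := gm) hc0 hc1
    (by rw [hcg]; exact hc2) (by rw [hcbg]; exact hc2)
    hSb.ne' (fun x : ℝ => (-k) • W (Complex.exp (x + β * Complex.I)))
    ((hcont _ ab2).const_smul (-k)) (hbd (-k) _ ab2)
  refine ⟨_, _, c, max C1 C2, K, K', L, L', hc0, (Complex.norm_exp_ofReal_mul_I (-gm)).le,
    (Complex.norm_exp_ofReal_mul_I gm).le, ?_, ?_, hK, hK', hL, hL', ?_, ?_, ?_, ?_, ?_⟩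
  · rw [Complex.exp_ofReal_mul_I_re, Real.cos_neg, hcg]; exact hc2
  · rw [Complex.exp_ofReal_mul_I_re, hcg]; exact hc2
  · intro r hr; exact (bK r hr).trans (by gcongr; exact le_max_left _ _)
  · intro r hr; exact (bK' r hr).trans (le_max_left _ _)
  · intro r hr; exact (bL r hr).trans (by gcongr; exact le_max_right _ _)
  · intro r hr; exact (bL' r hr).trans (le_max_right _ _)
  intro u hu
  rw [← eK u hu, ← eL u hu]
  have key := hs_strip (β := β) (θ := θ) (M := M) (by linarith) (by linarith) (by linarith)
    (fun ζ => W (u * Complex.exp ζ))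
    (hW.comp (by fun_prop) (fun ζ hζ => hs_mem_sector (by linarith) hu hζ))
    (fun ζ hζ => hM _ (hs_mem_sector (by linarith) hu hζ))
  have shift : ∀ b : ℝ, (∫ x : ℝ, (Complex.sinh (x + b * Complex.I))⁻¹ • W (u * Complex.exp (x + b * Complex.I)))
      = ∫ x : ℝ, (Complex.sinh ((x - Real.log u : ℝ) + b * Complex.I))⁻¹ • W (Complex.exp (x + b * Complex.I)) := by
    intro b
    rw [← integral_sub_right_eq_self _ (Real.log u)]
    congr 1; funext x; congr 2
    have hue : (u : ℂ) = Complex.exp (Real.log u : ℝ) := by rw [← Complex.ofReal_exp, Real.exp_log hu]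
    conv_lhs => rw [hue, ← Complex.exp_add]
    congr 1; push_cast; ring
  have hk0 : (2 * Real.pi * Complex.I : ℂ) ≠ 0 := by
    simp [Real.pi_ne_zero]
  rw [shift, shift] at key
  have : ∀ (k : ℂ) (b : ℝ), ∫ x : ℝ, (Complex.sinh ((x - Real.log u : ℝ) + b * Complex.I))⁻¹ • k • W (Complex.exp (x + b * Complex.I)) = k • ∫ x : ℝ, (Complex.sinh ((x - Real.log u : ℝ) + b * Complex.I))⁻¹ • W (Complex.exp (x + b * Complex.I)) := by
    intro k b
    rw [← integral_smul]; congr 1; funext x; rw [smul_comm]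
  rw [this, this, neg_smul, ← sub_eq_add_neg, ← smul_sub, key, smul_smul, hk, inv_mul_cancel₀ hk0, one_smul]
  simp


noncomputable def hsCP (μ : Measure ℝ) : ℕ → Measure ℝ
  | 0 => Measure.dirac 0
  | k + 1 => (hsCP μ k).conv μ

theorem hsCP_finite (μ : Measure ℝ) [IsFiniteMeasure μ] (k : ℕ) : IsFiniteMeasure (hsCP μ k) := by
  induction k with
  | zero => rw [hsCP]; infer_instance
  | succ k ih => rw [hsCP]; infer_instance

theorem hsCP_nonneg (μ : Measure ℝ) [IsFiniteMeasure μ] (h : ∀ᵐ u ∂μ, 0 < u) (k : ℕ) :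
    (∀ᵐ u ∂(hsCP μ k), 0 ≤ u) ∧ (∀ᵐ u ∂(hsCP μ (k + 1)), 0 < u) := by
  have step : ∀ k, (∀ᵐ u ∂(hsCP μ k), 0 ≤ u) → (∀ᵐ u ∂(hsCP μ (k + 1)), 0 < u) := by
    intro k hk
    have := hsCP_finite μ k
    rw [hsCP, Measure.conv, ae_map_iff (by fun_prop) measurableSet_Ioi]
    have h1 := Measure.quasiMeasurePreserving_fst (μ := hsCP μ k) (ν := μ) |>.ae hk
    have h2 := Measure.quasiMeasurePreserving_snd (μ := hsCP μ k) (ν := μ) |>.ae h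
    filter_upwards [h1, h2] with p hp1 hp2
    show 0 < p.1 + p.2
    linarith
  induction k with
  | zero =>
    have : ∀ᵐ u ∂(hsCP μ 0), (0:ℝ) ≤ u := by
      rw [hsCP, ae_dirac_iff measurableSet_Ici]
    exact ⟨this, step _ this⟩
  | succ k ih =>
    have : ∀ᵐ u ∂(hsCP μ (k+1)), (0:ℝ) ≤ u := ih.2.mono fun u hu => hu.le
    exact ⟨this, step _ this⟩

theorem hs_conv_pow {E : Type*} [NormedRing E] [NormedAlgebra ℂ E] [CompleteSpace E]
    {f : ℝ → E} (hf : StronglyMeasurable f) {M : ℝ} (hM : ∀ u, 0 ≤ u → ‖f u‖ ≤ M) (h0 : f 0 = 1)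
    (hmul : ∀ u v, 0 ≤ u → 0 ≤ v → f (u + v) = f u * f v) (μ : Measure ℝ) [IsFiniteMeasure μ]
    (h : ∀ᵐ u ∂μ, 0 < u) (k : ℕ) :
    Integrable f (hsCP μ k) ∧ ∫ u, f u ∂(hsCP μ k) = (∫ u, f u ∂μ) ^ k := by
  have hint : ∀ k, Integrable f (hsCP μ k) := by
    intro k
    have := hsCP_finite μ k
    exact Integrable.of_bound hf.aestronglyMeasurable M ((hsCP_nonneg μ h k).1.mono fun u hu => hM u hu)
  have hμ : Integrable f μ :=
    Integrable.of_bound hf.aestronglyMeasurable M (h.mono fun u hu => hM u hu.le)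
  refine ⟨hint k, ?_⟩
  induction k with
  | zero => rw [hsCP, integral_dirac, h0, pow_zero]
  | succ k ih =>
    have := hsCP_finite μ k
    have hi := hint (k+1)
    rw [hsCP] at hi ⊢
    rw [integral_conv hi, pow_succ, ← ih, ← integral_mul_const_of_integrable (hint k)]
    refine integral_congr_ae ?_
    filter_upwards [(hsCP_nonneg μ h k).1] with x hx
    rw [← integral_const_mul_of_integrable hμ]
    refine integral_congr_ae ?_
    filter_upwards [h] with y hy
    exact hmul x y hx hy.le

section lap
variable (μ : Measure ℝ) [IsFiniteMeasure μ]

theorem hs_int_cexp (h : ∀ᵐ u ∂μ, 0 ≤ u) {κ : ℂ} (hκ : 0 ≤ κ.re) :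
    Integrable (fun u : ℝ => Complex.exp (-(κ * u))) μ := by
  refine Integrable.of_bound (by fun_prop) 1 (h.mono fun u hu => ?_)
  rw [Complex.norm_exp]
  simp; positivity

theorem hs_int_exp (h : ∀ᵐ u ∂μ, 0 ≤ u) {r : ℝ} (hr : 0 ≤ r) :
    Integrable (fun u : ℝ => Real.exp (-(r * u))) μ := by
  refine Integrable.of_bound (by fun_prop) 1 (h.mono fun u hu => ?_)
  rw [Real.norm_of_nonneg (Real.exp_pos _).le, Real.exp_le_one_iff]
  have := mul_nonneg hr hu; linarith

theorem hs_v_le (v : ℝ) : v * Real.exp (-v) ≤ 1 - Real.exp (-v) := by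
  have h1 := Real.add_one_le_exp v
  have h2 : Real.exp v * Real.exp (-v) = 1 := by rw [← Real.exp_add]; simp
  have h3 := Real.exp_pos (-v)
  nlinarith

theorem hs_int_uexp (h : ∀ᵐ u ∂μ, 0 ≤ u) {r : ℝ} (hr : 0 < r) :
    Integrable (fun u : ℝ => u * Real.exp (-(r * u))) μ := by
  refine Integrable.of_bound (by fun_prop) (1 / r) (h.mono fun u hu => ?_)
  rw [Real.norm_of_nonneg (by positivity), le_div_iff₀ hr]
  have := hs_v_le (r * u)
  have := Real.exp_pos (-(r * u))
  linarith

theorem hs_lap_deriv (h : ∀ᵐ u ∂μ, 0 ≤ u) {r : ℝ} (hr : 0 < r) :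
    HasDerivAt (fun r => ∫ u, Real.exp (-(r * u)) ∂μ) (-(∫ u, u * Real.exp (-(r * u)) ∂μ)) r := by
  have hmem : -r ∈ interior (ProbabilityTheory.integrableExpSet (id : ℝ → ℝ) μ) := by
    rw [mem_interior]
    refine ⟨Set.Iio 0, ?_, isOpen_Iio, by simpa using hr⟩
    intro t ht
    have := hs_int_exp μ h (r := -t) (by simpa using (Set.mem_Iio.1 ht).le)
    show Integrable (fun ω => Real.exp (t * id ω)) μ
    simpa using this
  have h1 := (ProbabilityTheory.hasDerivAt_mgf hmem).comp r (hasDerivAt_neg r)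
  have e : (fun r => ∫ u, Real.exp (-(r * u)) ∂μ) = ProbabilityTheory.mgf id μ ∘ Neg.neg := by
    funext r; simp [ProbabilityTheory.mgf]
  rw [e]
  refine h1.congr_deriv ?_
  simp
end lap


noncomputable def hsq (μ : Measure ℝ) (r : ℝ) : ℝ := ∫ u, Real.exp (-(r * u)) ∂μ
noncomputable def hsd (μ : Measure ℝ) (r : ℝ) : ℝ := ∫ u, u * Real.exp (-(r * u)) ∂μ
noncomputable def hsqc (μ : Measure ℝ) (κ : ℂ) : ℂ := ∫ u : ℝ, Complex.exp (-(κ * u)) ∂μ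

section lap2
variable (μ : Measure ℝ) [IsFiniteMeasure μ]

theorem hsq_cont0 (h : ∀ᵐ u ∂μ, 0 ≤ u) : ContinuousWithinAt (hsq μ) (Set.Ici 0) 0 := by
  unfold ContinuousWithinAt hsq
  refine tendsto_integral_filter_of_dominated_convergence (fun _ => 1) ?_ ?_ (integrable_const _) ?_
  · exact .of_forall fun r => by fun_prop
  · filter_upwards [self_mem_nhdsWithin] with r hr
    filter_upwards [h] with u hu
    rw [Real.norm_of_nonneg (Real.exp_pos _).le, Real.exp_le_one_iff]
    have := mul_nonneg (Set.mem_Ici.1 hr) hu; linarith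
  · refine .of_forall fun u => ?_
    have : Continuous fun r : ℝ => Real.exp (-(r * u)) := by fun_prop
    exact this.continuousWithinAt

theorem hsq_top (h : ∀ᵐ u ∂μ, 0 < u) : Tendsto (hsq μ) atTop (𝓝 0) := by
  have : (0:ℝ) = ∫ u : ℝ, (0:ℝ) ∂μ := by simp
  rw [this]
  unfold hsq
  refine tendsto_integral_filter_of_dominated_convergence (fun _ => 1) ?_ ?_ (integrable_const _) ?_
  · exact .of_forall fun r => by fun_prop
  · filter_upwards [eventually_ge_atTop 0] with r hr
    filter_upwards [h] with u hu
    rw [Real.norm_of_nonneg (Real.exp_pos _).le, Real.exp_le_one_iff]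
    have := mul_nonneg hr hu.le; linarith
  · filter_upwards [h] with u hu
    refine Real.tendsto_exp_neg_atTop_nhds_zero.comp ?_
    exact tendsto_id.atTop_mul_const hu

theorem hsd_nonneg (h : ∀ᵐ u ∂μ, 0 ≤ u) (r : ℝ) : 0 ≤ hsd μ r :=
  integral_nonneg_of_ae (h.mono fun u hu => by simp only [Pi.zero_apply]; positivity)

theorem hsq_scale_deriv (h : ∀ᵐ u ∂μ, 0 < u) {c r : ℝ} (hc : 0 < c) (hr : 0 < r) :
    HasDerivAt (fun r => hsq μ (c * r)) (-(c * hsd μ (c * r))) r := by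
  have h1 := hs_lap_deriv μ (h.mono fun u hu => hu.le) (r := c * r) (by positivity)
  have h2 := h1.comp r ((hasDerivAt_id r).const_mul c)
  refine h2.congr_deriv ?_
  simp [hsd]; ring

theorem hsq_scale_cont (h : ∀ᵐ u ∂μ, 0 < u) {c : ℝ} (hc : 0 < c) :
    ContinuousWithinAt (fun r => hsq μ (c * r)) (Set.Ici 0) 0 := by
  have h1 := hsq_cont0 μ (h.mono fun u hu => hu.le)
  refine ContinuousWithinAt.comp (g := hsq μ) (f := fun r => c * r) (t := Set.Ici 0) (by simpa using h1) (by fun_prop) ?_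
  intro r hr; exact mul_nonneg hc.le hr

theorem hsq_zero : hsq μ 0 = μ.real Set.univ := by simp [hsq]

theorem hs_lap_int0 (h : ∀ᵐ u ∂μ, 0 < u) {c : ℝ} (hc : 0 < c) :
    IntegrableOn (fun r => hsd μ (c * r)) (Set.Ioi 0) := by
  have h0 : ∀ᵐ u ∂μ, 0 ≤ u := h.mono fun u hu => hu.le
  have := integrableOn_Ioi_deriv_of_nonneg (g := fun r => -(hsq μ (c * r)))
    (g' := fun r => c * hsd μ (c * r)) (a := 0) (l := -0)
    (hsq_scale_cont μ h hc).neg (fun r hr => by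
      exact (hsq_scale_deriv μ h hc hr).neg.congr_deriv (neg_neg _)) (fun r _ => mul_nonneg hc.le (hsd_nonneg μ h0 _))
    (((hsq_top μ h).comp (tendsto_id.const_mul_atTop hc)).neg)
  have := this.const_mul (c⁻¹)
  refine this.congr (.of_forall fun r => ?_)
  simp only; field_simp

theorem hs_lap_int (h : ∀ᵐ u ∂μ, 0 < u) {c A : ℝ} (hc : 0 < c) (hA : 0 < A) :
    IntegrableOn (fun r => hsd μ (c * r) * Real.exp (-(A * (μ.real Set.univ - hsq μ (c * r))))) (Set.Ioi 0) ∧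
    ∫ r in Set.Ioi (0:ℝ), hsd μ (c * r) * Real.exp (-(A * (μ.real Set.univ - hsq μ (c * r)))) ≤ 1 / (A * c) := by
  have h0 : ∀ᵐ u ∂μ, 0 ≤ u := h.mono fun u hu => hu.le
  set m := μ.real Set.univ with hm
  have hcont : ContinuousWithinAt (fun r => -Real.exp (-(A * (m - hsq μ (c * r))))) (Set.Ici 0) 0 := by
    have := hsq_scale_cont μ h hc
    fun_prop
  have hder : ∀ r ∈ Set.Ioi (0:ℝ), HasDerivAt (fun r => -Real.exp (-(A * (m - hsq μ (c * r)))))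
      ((A * c) * (hsd μ (c * r) * Real.exp (-(A * (m - hsq μ (c * r)))))) r := by
    intro r hr
    have := ((((hsq_scale_deriv μ h hc hr).const_sub m).const_mul A).neg.exp).neg
    refine this.congr_deriv ?_
    simp only [Pi.neg_apply]
    ring
  have hnn : ∀ r ∈ Set.Ioi (0:ℝ), 0 ≤ (A * c) * (hsd μ (c * r) * Real.exp (-(A * (m - hsq μ (c * r))))) := by
    intro r _
    have := hsd_nonneg μ h0 (c * r)
    positivity
  have hlim : Tendsto (fun r => -Real.exp (-(A * (m - hsq μ (c * r))))) atTop (𝓝 (-Real.exp (-(A * (m - 0))))) := by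
    have h1 := (hsq_top μ h).comp (tendsto_id.const_mul_atTop hc)
    exact (Real.continuous_exp.tendsto _ |>.comp ((h1.const_sub m).const_mul A).neg).neg
  have i1 := integrableOn_Ioi_deriv_of_nonneg hcont hder hnn hlim
  have i2 := integral_Ioi_of_hasDerivAt_of_nonneg hcont hder hnn hlim
  constructor
  · have := i1.const_mul ((A * c)⁻¹)
    refine this.congr (.of_forall fun r => ?_)
    simp only; field_simp
  · rw [integral_const_mul] at i2
    rw [le_div_iff₀ (by positivity), mul_comm, i2, mul_zero, hsq_zero, ← hm, sub_self]
    have := Real.exp_pos (-(A * (m - 0)))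
    simp only [mul_zero, neg_zero, Real.exp_zero]
    linarith
end lap2

theorem hs_half_fubini {E : Type*} [NormedAddCommGroup E] [NormedSpace ℂ E] [CompleteSpace E]
    {η : ℂ} {c C : ℝ} {K K' : ℝ → E} (hc : 0 < c) (hη : ‖η‖ ≤ 1) (hcη : c ≤ η.re)
    (hK : StronglyMeasurable K) (hK' : StronglyMeasurable K')
    (bK : ∀ r, 0 < r → ‖K r‖ ≤ C / r) (bK' : ∀ r, 0 < r → ‖K' r‖ ≤ C)
    (ν : Measure ℝ) [IsFiniteMeasure ν] (h : ∀ᵐ u ∂ν, 0 < u) :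
    Integrable (fun u => ∫ r in Set.Ioi (0:ℝ), (hsφ η r u • K r + ((u * Real.exp (-(r * u)) : ℝ) : ℂ) • K' r)) ν ∧
    ∫ u, (∫ r in Set.Ioi (0:ℝ), (hsφ η r u • K r + ((u * Real.exp (-(r * u)) : ℝ) : ℂ) • K' r)) ∂ν =
    ∫ r in Set.Ioi (0:ℝ), ((hsqc ν (r * η) - hsq ν r) • K r + (hsd ν r : ℂ) • K' r) := by
  have h0 : ∀ᵐ u ∂ν, 0 ≤ u := h.mono fun u hu => hu.le
  have hC : 0 ≤ C := (norm_nonneg _).trans (bK' 1 one_pos)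
  have hc1 : c ≤ 1 := hcη.trans ((Complex.re_le_norm η).trans hη)
  set f : ℝ → ℝ → E := fun u r => hsφ η r u • K r + ((u * Real.exp (-(r * u)) : ℝ) : ℂ) • K' r with hf
  have fm : StronglyMeasurable (Function.uncurry f) := by
    simp only [hf, Function.uncurry_def, hsφ]
    refine StronglyMeasurable.add (StronglyMeasurable.smul ?_ (hK.comp_measurable measurable_snd))
      (StronglyMeasurable.smul ?_ (hK'.comp_measurable measurable_snd))
    · exact Continuous.stronglyMeasurable (by fun_prop)
    · exact Continuous.stronglyMeasurable (by fun_prop)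
  have fb : ∀ u r, 0 < u → 0 < r → ‖f u r‖ ≤ (3 * C * u) * Real.exp (-(c * u) * r) := by
    intro u r hu hr
    have e1 : -(c * u) * r = -(c * r * u) := by ring
    have : -(r * u) ≤ -(c * r * u) := by have : 0 < r * u := by positivity
                                         nlinarith
    calc ‖f u r‖ ≤ ‖hsφ η r u‖ * ‖K r‖ + (u * Real.exp (-(r * u))) * ‖K' r‖ := by
          refine (norm_add_le _ _).trans ?_
          rw [norm_smul, norm_smul, Complex.norm_real, Real.norm_of_nonneg (by positivity)]
      _ ≤ (2 * (r * u) * Real.exp (-(c * r * u))) * (C / r) + (u * Real.exp (-(c * r * u))) * C := by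
          gcongr
          · exact hsφ_le hη hcη hr.le hu.le
          · exact bK r hr
          · exact bK' r hr
      _ = _ := by rw [e1]; field_simp; ring
  have ii : ∀ u, 0 < u → IntegrableOn (fun r => (3 * C * u) * Real.exp (-(c * u) * r)) (Set.Ioi 0) := by
    intro u hu
    exact (integrableOn_exp_mul_Ioi (by have : 0 < c * u := by positivity
                                        linarith) 0).const_mul _
  have fi : ∀ u, 0 < u → IntegrableOn (fun r => f u r) (Set.Ioi 0) := by
    intro u hu
    refine (ii u hu).mono' (fm.comp_measurable (by fun_prop : Measurable fun r : ℝ => (u, r))).aestronglyMeasurable ?_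
    filter_upwards [ae_restrict_mem measurableSet_Ioi] with r hr
    exact fb u r hu hr
  have fn : ∀ u, 0 < u → ∫ r in Set.Ioi (0:ℝ), ‖f u r‖ ≤ 3 * C / c := by
    intro u hu
    have hcu : 0 < c * u := by positivity
    calc _ ≤ ∫ r in Set.Ioi (0:ℝ), (3 * C * u) * Real.exp (-(c * u) * r) :=
          setIntegral_mono_on (fi u hu).norm (ii u hu) measurableSet_Ioi (fun r hr => fb u r hu hr)
      _ = _ := by
          rw [integral_const_mul, integral_exp_mul_Ioi (by linarith)]
          simp only [mul_zero, Real.exp_zero]; field_simp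
  have fint : Integrable (Function.uncurry f) (ν.prod (volume.restrict (Set.Ioi (0:ℝ)))) := by
    rw [integrable_prod_iff fm.aestronglyMeasurable]
    refine ⟨?_, ?_⟩
    · filter_upwards [h] with u hu
      exact fi u hu
    · refine Integrable.of_bound ?_ (3 * C / c) ?_
      · exact (StronglyMeasurable.integral_prod_right (f := fun u r => ‖f u r‖) fm.norm).aestronglyMeasurable
      · filter_upwards [h] with u hu
        rw [Real.norm_of_nonneg (integral_nonneg fun _ => norm_nonneg _)]
        exact fn u hu
  refine ⟨fint.integral_prod_left, ?_⟩
  rw [integral_integral_swap fint]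
  refine setIntegral_congr_fun measurableSet_Ioi ?_
  intro r hr
  have hr : 0 < r := hr
  have j1 := hs_int_cexp ν h0 (κ := r * η) (by rw [Complex.re_ofReal_mul]; have : 0 < η.re := by linarith
                                               positivity)
  have j2 := hs_int_exp ν h0 hr.le
  have j3 := hs_int_uexp ν h0 hr
  have jφ : Integrable (fun u => hsφ η r u) ν := by
    refine j1.sub ?_
    simpa using j2.ofReal (𝕜 := ℂ)
  have jv : ∫ u, hsφ η r u ∂ν = hsqc ν (r * η) - hsq ν r := by
    have j2' : Integrable (fun u : ℝ => Complex.exp (-(r * u : ℝ))) ν := by simpa using j2.ofReal (𝕜 := ℂ)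
    simp only [hsφ]
    rw [integral_sub j1 j2', hsqc, hsq, ← integral_complex_ofReal]
    simp
  simp only [hf]
  have j3' : Integrable (fun u : ℝ => ((u * Real.exp (-(r * u)) : ℝ) : ℂ)) ν := j3.ofReal
  rw [integral_add (jφ.smul_const _) (j3'.smul_const _), integral_smul_const, integral_smul_const, jv]
  congr 2
  exact integral_complex_ofReal


theorem hs_pow_sub_pow {a b : ℂ} {N : ℝ} (hN : 1 ≤ N) (ha : ‖a‖ ≤ N) (hb : ‖b‖ ≤ N) (k : ℕ) :
    ‖a ^ k - b ^ k‖ ≤ k * N ^ k * ‖a - b‖ := by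
  induction k with
  | zero => simp
  | succ k ih =>
    have e : a ^ (k+1) - b ^ (k+1) = a * (a ^ k - b ^ k) + (a - b) * b ^ k := by ring
    have hbk : ‖b‖ ^ k ≤ N ^ k := by gcongr
    have hNk : N ^ k ≤ N ^ (k+1) := pow_le_pow_right₀ hN (by omega)
    rw [e]
    calc _ ≤ ‖a‖ * ‖a ^ k - b ^ k‖ + ‖a - b‖ * ‖b‖ ^ k := by
          refine (norm_add_le _ _).trans ?_
          rw [norm_mul, norm_mul, norm_pow]
      _ ≤ N * (k * N ^ k * ‖a - b‖) + ‖a - b‖ * N ^ (k+1) := by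
          gcongr; exact hbk.trans hNk
      _ = _ := by push_cast; ring

section lap3
variable (μ : Measure ℝ) [IsFiniteMeasure μ]

theorem hsq_ofReal (r : ℝ) : (hsq μ r : ℂ) = hsqc μ r := by
  rw [hsq, hsqc, ← integral_complex_ofReal]; simp

theorem hsqc_pow (h : ∀ᵐ u ∂μ, 0 < u) {κ : ℂ} (hκ : 0 ≤ κ.re) (k : ℕ) :
    hsqc (hsCP μ k) κ = (hsqc μ κ) ^ k := by
  refine (hs_conv_pow (f := fun u : ℝ => Complex.exp (-(κ * u))) (M := 1)
    (Continuous.stronglyMeasurable (by fun_prop)) ?_ (by simp) ?_ μ h k).2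
  · intro u hu
    rw [Complex.norm_exp]; simp; positivity
  · intro u v _ _
    rw [← Complex.exp_add]; congr 1; push_cast; ring

theorem hsq_pow (h : ∀ᵐ u ∂μ, 0 < u) {r : ℝ} (hr : 0 ≤ r) (k : ℕ) :
    hsq (hsCP μ k) r = (hsq μ r) ^ k := by
  have hfin := hsCP_finite μ k
  have := hsqc_pow μ h (κ := r) (by simpa using hr) k
  rw [← hsq_ofReal, ← hsq_ofReal] at this
  exact_mod_cast this

theorem hsd_pow (h : ∀ᵐ u ∂μ, 0 < u) {r : ℝ} (hr : 0 < r) (k : ℕ) :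
    hsd (hsCP μ k) r = k * (hsq μ r) ^ (k - 1) * hsd μ r := by
  have := hsCP_finite μ k
  have h1 : HasDerivAt (hsq (hsCP μ k)) (-(hsd (hsCP μ k) r)) r := hs_lap_deriv (hsCP μ k) (hsCP_nonneg μ h k).1 hr
  have h2 : HasDerivAt (hsq μ) (-(hsd μ r)) r := hs_lap_deriv μ (h.mono fun u hu => hu.le) hr
  have h3 := h2.fun_pow k
  have h4 : HasDerivAt (hsq (hsCP μ k)) (k * hsq μ r ^ (k-1) * -(hsd μ r)) r := by
    refine h3.congr_of_eventuallyEq ?_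
    filter_upwards [lt_mem_nhds hr] with s hs
    exact hsq_pow μ h hs.le k
  have := h1.unique h4
  linarith

theorem hsqc_norm_le (h : ∀ᵐ u ∂μ, 0 < u) {κ : ℂ} (hκ : 0 ≤ κ.re) : ‖hsqc μ κ‖ ≤ μ.real Set.univ := by
  have := norm_integral_le_of_norm_le_const (μ := μ) (f := fun u : ℝ => Complex.exp (-(κ * u))) (C := 1)
    (h.mono fun u hu => by rw [Complex.norm_exp]; simp; positivity)
  simpa [hsqc] using this

theorem hsqc_sub_le (h : ∀ᵐ u ∂μ, 0 < u) {η : ℂ} {c r : ℝ} (hc : 0 < c) (hη : ‖η‖ ≤ 1) (hcη : c ≤ η.re) (hr : 0 < r) :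
    ‖hsqc μ (r * η) - hsq μ r‖ ≤ 2 * r * hsd μ (c * r) := by
  have h0 : ∀ᵐ u ∂μ, 0 ≤ u := h.mono fun u hu => hu.le
  have j1 := hs_int_cexp μ h0 (κ := r * η) (by rw [Complex.re_ofReal_mul]; have : 0 < η.re := by linarith
                                               positivity)
  have j2 := hs_int_cexp μ h0 (κ := r) (by simpa using hr.le)
  rw [hsq_ofReal, hsqc, hsqc, ← integral_sub j1 j2, hsd, ← integral_const_mul]
  refine norm_integral_le_of_norm_le ((hs_int_uexp μ h0 (r := c * r) (by positivity)).const_mul _) ?_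
  filter_upwards [h0] with u hu
  have := hsφ_le (c := c) hη hcη hr.le hu
  simp only [hsφ] at this
  push_cast at this
  refine this.trans (le_of_eq ?_)
  ring

theorem hsd_anti (h : ∀ᵐ u ∂μ, 0 < u) {r s : ℝ} (hr : 0 < r) (hrs : r ≤ s) : hsd μ s ≤ hsd μ r := by
  have h0 : ∀ᵐ u ∂μ, 0 ≤ u := h.mono fun u hu => hu.le
  refine integral_mono_ae (hs_int_uexp μ h0 (by linarith)) (hs_int_uexp μ h0 hr) ?_
  filter_upwards [h0] with u hu
  gcongr

theorem hsq_anti (h : ∀ᵐ u ∂μ, 0 < u) {r s : ℝ} (hr : 0 ≤ r) (hrs : r ≤ s) : hsq μ s ≤ hsq μ r := by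
  have h0 : ∀ᵐ u ∂μ, 0 ≤ u := h.mono fun u hu => hu.le
  refine integral_mono_ae (hs_int_exp μ h0 (by linarith)) (hs_int_exp μ h0 hr) ?_
  filter_upwards [h0] with u hu
  gcongr

theorem hsqc_re_le (h : ∀ᵐ u ∂μ, 0 < u) {η : ℂ} {c r : ℝ} (hc : 0 < c) (hcη : c ≤ η.re) (hr : 0 < r) :
    (hsqc μ (r * η)).re ≤ hsq μ (c * r) := by
  have h0 : ∀ᵐ u ∂μ, 0 ≤ u := h.mono fun u hu => hu.le
  have j1 := hs_int_cexp μ h0 (κ := r * η) (by rw [Complex.re_ofReal_mul]; have : 0 < η.re := by linarith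
                                               positivity)
  rw [hsqc, hsq]
  have : (∫ u : ℝ, Complex.exp (-(r * η * u)) ∂μ).re = ∫ u : ℝ, (Complex.exp (-(r * η * u))).re ∂μ :=
    (integral_re j1).symm
  rw [this]
  refine integral_mono_ae j1.re (hs_int_exp μ h0 (by positivity)) ?_
  filter_upwards [h0] with u hu
  refine (Complex.re_le_norm _).trans ?_
  rw [Complex.norm_exp]
  apply Real.exp_le_exp.2
  simp
  have : 0 ≤ r * u := by positivity
  nlinarith

theorem hsd_le_p (h : ∀ᵐ u ∂μ, 0 < u) {r : ℝ} (hr : 0 < r) : r * hsd μ r ≤ μ.real Set.univ - hsq μ r := by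
  have h0 : ∀ᵐ u ∂μ, 0 ≤ u := h.mono fun u hu => hu.le
  have : μ.real Set.univ - hsq μ r = ∫ u, (1 - Real.exp (-(r * u))) ∂μ := by
    rw [integral_sub (integrable_const _) (hs_int_exp μ h0 hr.le)]; simp [hsq]
  rw [this, hsd, ← integral_const_mul]
  refine integral_mono ((hs_int_uexp μ h0 hr).const_mul _) ((integrable_const _).sub (hs_int_exp μ h0 hr.le)) ?_
  intro u
  simp only
  rw [← mul_assoc]; exact hs_v_le _

theorem hsqc_meas (η : ℂ) : StronglyMeasurable fun r : ℝ => hsqc μ (r * η) := by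
  refine StronglyMeasurable.integral_prod_right (f := fun (r u : ℝ) => Complex.exp (-(r * η * u))) ?_
  exact Continuous.stronglyMeasurable (by fun_prop)

theorem hsq_meas : StronglyMeasurable (hsq μ) := by
  refine StronglyMeasurable.integral_prod_right (f := fun (r u : ℝ) => Real.exp (-(r * u))) ?_
  exact Continuous.stronglyMeasurable (by fun_prop)

theorem hsd_meas : StronglyMeasurable (hsd μ) := by
  refine StronglyMeasurable.integral_prod_right (f := fun (r u : ℝ) => u * Real.exp (-(r * u))) ?_
  exact Continuous.stronglyMeasurable (by fun_prop)
end lap3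

theorem hs_hasSum_exp (x : ℂ) : HasSum (fun k : ℕ => ((k.factorial : ℂ))⁻¹ * x ^ k) (Complex.exp x) := by
  have := NormedSpace.exp_series_hasSum_exp' (𝕂 := ℂ) x
  rw [← Complex.exp_eq_exp_ℂ] at this
  simpa using this

theorem hs_hasSum_exp' (z q : ℂ) : HasSum (fun k : ℕ => ((k.factorial : ℂ))⁻¹ * z ^ k * (k * q ^ (k - 1))) (z * Complex.exp (z * q)) := by
  rw [← hasSum_nat_add_iff' 1]
  simp only [Finset.range_one, Finset.sum_singleton, Nat.factorial_zero, Nat.cast_zero, zero_mul, mul_zero, sub_zero]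
  refine ((hs_hasSum_exp (z * q)).mul_left z).congr_fun ?_
  intro k
  rw [Nat.factorial_succ]
  have : ((k:ℂ) + 1) ≠ 0 := by exact_mod_cast Nat.succ_ne_zero k
  have h2 : (k.factorial : ℂ) ≠ 0 := by exact_mod_cast k.factorial_ne_zero
  simp only [Nat.add_sub_cancel]; push_cast
  field_simp
  ring


theorem hs_half_sum {E : Type*} [NormedAddCommGroup E] [NormedSpace ℂ E] [CompleteSpace E]
    {η : ℂ} {c C : ℝ} {K K' : ℝ → E} (hc : 0 < c) (hη : ‖η‖ ≤ 1) (hcη : c ≤ η.re)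
    (hK : StronglyMeasurable K) (hK' : StronglyMeasurable K')
    (bK : ∀ r, 0 < r → ‖K r‖ ≤ C / r) (bK' : ∀ r, 0 < r → ‖K' r‖ ≤ C)
    (μ : Measure ℝ) [IsFiniteMeasure μ] (h : ∀ᵐ u ∂μ, 0 < u) {z : ℂ} (hz : |z.im| ≤ c / 4 * z.re) :
    ∃ Y : E, HasSum (fun k : ℕ => (((k.factorial : ℂ))⁻¹ * z ^ k) •
      (if k = 0 then (0:E) else ∫ u, (∫ r in Set.Ioi (0:ℝ), (hsφ η r u • K r + ((u * Real.exp (-(r * u)) : ℝ) : ℂ) • K' r)) ∂(hsCP μ k))) Y ∧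
      ‖Complex.exp (-(z * (μ.real Set.univ : ℝ))) • Y‖ ≤ 12 * C / c := by
  have h0 : ∀ᵐ u ∂μ, 0 ≤ u := h.mono fun u hu => hu.le
  have hC : 0 ≤ C := (norm_nonneg _).trans (bK' 1 one_pos)
  have hc1 : c ≤ 1 := hcη.trans ((Complex.re_le_norm η).trans hη)
  have hηre : 0 < η.re := by linarith
  have hκ : ∀ r : ℝ, 0 < r → 0 ≤ ((r:ℂ) * η).re := fun r hr => by
    rw [Complex.re_ofReal_mul]; positivity
  set m := μ.real Set.univ with hm
  have hm0 : 0 ≤ m := measureReal_nonneg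
  set Φ : ℕ → ℝ → E := fun k r => (hsqc μ (r * η) ^ k - (hsq μ r : ℂ) ^ k) • K r +
    ((k : ℂ) * (hsq μ r : ℂ) ^ (k-1) * (hsd μ r : ℂ)) • K' r with hΦ
  have hV : ∀ k : ℕ, (if k = 0 then (0:E) else ∫ u, (∫ r in Set.Ioi (0:ℝ), (hsφ η r u • K r + ((u * Real.exp (-(r * u)) : ℝ) : ℂ) • K' r)) ∂(hsCP μ k)) = ∫ r in Set.Ioi (0:ℝ), Φ k r := by
    intro k
    rcases Nat.eq_zero_or_pos k with rfl | hk
    · simp [hΦ]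
    · rw [if_neg hk.ne']
      obtain ⟨j, rfl⟩ : ∃ j, k = j + 1 := ⟨k - 1, by omega⟩
      have := hsCP_finite μ (j+1)
      rw [(hs_half_fubini hc hη hcη hK hK' bK bK' (hsCP μ (j+1)) (hsCP_nonneg μ h j).2).2]
      refine setIntegral_congr_fun measurableSet_Ioi ?_
      intro r hr
      have hr : 0 < r := hr
      simp only [hΦ]
      rw [hsqc_pow μ h (hκ r hr), hsq_pow μ h hr.le, hsd_pow μ h hr]
      push_cast
      rfl
  have hΦm : ∀ k, StronglyMeasurable (Φ k) := by
    intro k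
    have q1 := hsqc_meas μ η
    have q2 : StronglyMeasurable fun r => (hsq μ r : ℂ) := Complex.continuous_ofReal.comp_stronglyMeasurable (hsq_meas μ)
    have q3 : StronglyMeasurable fun r => (hsd μ r : ℂ) := Complex.continuous_ofReal.comp_stronglyMeasurable (hsd_meas μ)
    exact (((q1.pow k).sub (q2.pow k)).smul hK).add (((q2.pow (k-1)).const_mul _ |>.mul q3).smul hK')
  set N := m + 1 with hN
  have hN1 : 1 ≤ N := by linarith
  have qn : ∀ r : ℝ, 0 < r → ‖(hsq μ r : ℂ)‖ ≤ N := by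
    intro r hr
    rw [hsq_ofReal]
    exact (hsqc_norm_le μ h (by simpa using hr.le)).trans (by linarith)
  have hΦb : ∀ k r, 0 < r → ‖Φ k r‖ ≤ (k * N ^ k) * (3 * C * hsd μ (c * r)) := by
    intro k r hr
    have d0 := hsd_nonneg μ h0 (c * r)
    have d1 := hsd_nonneg μ h0 r
    have d2 : hsd μ r ≤ hsd μ (c * r) := hsd_anti μ h (by positivity) (by nlinarith)
    have a1 : ‖hsqc μ (r * η) ^ k - (hsq μ r : ℂ) ^ k‖ ≤ k * N ^ k * (2 * r * hsd μ (c * r)) := by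
      refine (hs_pow_sub_pow hN1 ((hsqc_norm_le μ h (hκ r hr)).trans (by linarith)) (qn r hr) k).trans ?_
      gcongr
      exact hsqc_sub_le μ h hc hη hcη hr
    have a2 : ‖((k : ℂ) * (hsq μ r : ℂ) ^ (k-1) * (hsd μ r : ℂ))‖ ≤ k * N ^ k * hsd μ (c * r) := by
      rw [norm_mul, norm_mul, norm_pow, Complex.norm_natCast, Complex.norm_real (hsd μ r), Real.norm_of_nonneg d1]
      gcongr
      calc ‖(hsq μ r : ℂ)‖ ^ (k-1) ≤ N ^ (k-1) := by gcongr; exact qn r hr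
        _ ≤ N ^ k := pow_le_pow_right₀ hN1 (by omega)
    calc ‖Φ k r‖ ≤ (k * N ^ k * (2 * r * hsd μ (c * r))) * (C / r) + (k * N ^ k * hsd μ (c * r)) * C := by
          refine (norm_add_le _ _).trans ?_
          rw [norm_smul, norm_smul]
          gcongr
          · exact bK r hr
          · exact bK' r hr
      _ = _ := by field_simp; ring
  have id0 := hs_lap_int0 μ h hc
  set F : ℕ → ℝ → E := fun k r => (((k.factorial : ℂ))⁻¹ * z ^ k) • Φ k r with hF
  have hFb : ∀ k r, 0 < r → ‖F k r‖ ≤ ((2 * ‖z‖ * N) ^ k / k.factorial) * (3 * C * hsd μ (c * r)) := by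
    intro k r hr
    have d0 := hsd_nonneg μ h0 (c * r)
    simp only [hF]
    rw [norm_smul, norm_mul, norm_inv, norm_pow, Complex.norm_natCast]
    have hk2 : (k:ℝ) ≤ 2 ^ k := by exact_mod_cast (Nat.lt_two_pow_self (n := k)).le
    calc _ ≤ ((k.factorial : ℝ)⁻¹ * ‖z‖ ^ k) * ((2 ^ k * N ^ k) * (3 * C * hsd μ (c * r))) := by
          gcongr
          refine (hΦb k r hr).trans ?_
          gcongr
      _ = _ := by rw [mul_pow, mul_pow]; field_simp
  have hFi : ∀ k, Integrable (F k) (volume.restrict (Set.Ioi 0)) := by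
    intro k
    refine Integrable.mono' ((id0.const_mul (3 * C)).const_mul ((2 * ‖z‖ * N) ^ k / k.factorial)) ((hΦm k).const_smul _).aestronglyMeasurable ?_
    filter_upwards [ae_restrict_mem measurableSet_Ioi] with r hr
    exact hFb k r hr
  have hFs : Summable fun k => ∫ r in Set.Ioi (0:ℝ), ‖F k r‖ := by
    refine Summable.of_nonneg_of_le (fun k => integral_nonneg fun _ => norm_nonneg _) (fun k => ?_)
      ((Real.summable_pow_div_factorial (2 * ‖z‖ * N)).mul_right (∫ r in Set.Ioi (0:ℝ), 3 * C * hsd μ (c * r)))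
    rw [← integral_const_mul]
    exact setIntegral_mono_on (hFi k).norm ((id0.const_mul (3 * C)).const_mul _) measurableSet_Ioi (fun r hr => hFb k r hr)
  have hsum := hasSum_integral_of_summable_integral_norm hFi hFs
  refine ⟨∫ r in Set.Ioi (0:ℝ), ∑' k, F k r, ?_, ?_⟩
  · refine hsum.congr_fun ?_
    intro k
    rw [hV, ← integral_smul]
  have hpt : ∀ r, ∑' k, F k r = (Complex.exp (z * hsqc μ (r * η)) - Complex.exp (z * hsq μ r)) • K r +
      (z * Complex.exp (z * hsq μ r) * hsd μ r) • K' r := by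
    intro r
    refine HasSum.tsum_eq ?_
    have s1 := ((hs_hasSum_exp (z * hsqc μ (r * η))).sub (hs_hasSum_exp (z * hsq μ r))).smul_const (K r)
    have s2 := ((hs_hasSum_exp' z (hsq μ r)).mul_right (hsd μ r : ℂ)).smul_const (K' r)
    refine (s1.add s2).congr_fun ?_
    intro k
    simp only [hF, hΦ, smul_add, smul_smul]
    congr 2 <;> ring
  rw [← integral_smul]
  simp only [hpt]
  have ha0 : 0 ≤ z.re := by
    have := abs_nonneg z.im
    by_contra hcon
    push Not at hcon
    nlinarith
  rcases ha0.eq_or_lt with ha | ha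
  · have hz0 : z = 0 := by
      apply Complex.ext
      · simp [← ha]
      · have : |z.im| ≤ 0 := by rw [← ha] at hz; simpa using hz
        simpa using this
    simp only [hz0]
    simp
    positivity
  have hzn : ‖z‖ ≤ 2 * z.re := by
    refine (Complex.norm_le_abs_re_add_abs_im z).trans ?_
    rw [abs_of_pos ha]
    nlinarith
  obtain ⟨li, lb⟩ := hs_lap_int μ h hc (A := z.re / 2) (by positivity)
  have e12 : 12 * C / c = (6 * z.re * C) * (1 / (z.re / 2 * c)) := by field_simp; ring
  rw [e12]
  refine (norm_integral_le_of_norm_le (li.const_mul (6 * z.re * C)) ?_).trans ?_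
  · filter_upwards [ae_restrict_mem measurableSet_Ioi] with r hr
    have hr : 0 < r := hr
    have d0 := hsd_nonneg μ h0 (c * r)
    have d1 := hsd_nonneg μ h0 r
    have d2 : hsd μ r ≤ hsd μ (c * r) := hsd_anti μ h (by positivity) (by nlinarith)
    have q2 : hsq μ r ≤ hsq μ (c * r) := hsq_anti μ h (by positivity) (by nlinarith)
    have q3 := hsqc_re_le μ h hc hcη hr
    have q4 := hsqc_sub_le μ h hc hη hcη hr
    have q5 := hsd_le_p μ h (r := c * r) (by positivity)
    rw [← hm] at q5
    have r1 : (z * hsqc μ (r * η) - z * m).re ≤ -(z.re / 2 * (m - hsq μ (c * r))) := by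
      have i1 : |(hsqc μ (r * η)).im| ≤ 2 * r * hsd μ (c * r) := by
        refine le_trans ?_ q4
        have := Complex.abs_im_le_norm (hsqc μ (r * η) - hsq μ r)
        simpa using this
      have i2 : -(z.im * (hsqc μ (r * η)).im) ≤ (c / 4 * z.re) * (2 * r * hsd μ (c * r)) := by
        refine (neg_le_abs _).trans ?_
        rw [abs_mul]; gcongr
      have i3 : (c / 4 * z.re) * (2 * r * hsd μ (c * r)) ≤ z.re / 2 * (m - hsq μ (c * r)) := by
        have : (c / 4 * z.re) * (2 * r * hsd μ (c * r)) = z.re / 2 * (c * r * hsd μ (c * r)) := by ring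
        rw [this]; gcongr
      have i4 : z.re * (hsqc μ (r * η)).re ≤ z.re * hsq μ (c * r) := by gcongr
      simp only [Complex.sub_re, Complex.mul_re, Complex.ofReal_re, Complex.ofReal_im]
      nlinarith
    have r2 : (z * hsq μ r - z * m).re ≤ -(z.re / 2 * (m - hsq μ (c * r))) := by
      simp only [Complex.sub_re, Complex.mul_re, Complex.ofReal_re, Complex.ofReal_im]
      have : 0 ≤ m - hsq μ (c * r) := le_trans (by positivity) q5
      nlinarith
    have n1 : ‖Complex.exp (-(z * m)) * (Complex.exp (z * hsqc μ (r * η)) - Complex.exp (z * hsq μ r))‖ ≤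
        Real.exp (-(z.re / 2 * (m - hsq μ (c * r)))) * ((2 * z.re) * (2 * r * hsd μ (c * r))) := by
      have : Complex.exp (-(z * m)) * (Complex.exp (z * hsqc μ (r * η)) - Complex.exp (z * hsq μ r)) =
          Complex.exp (z * hsqc μ (r * η) - z * m) - Complex.exp (z * hsq μ r - z * m) := by
        rw [mul_sub, ← Complex.exp_add, ← Complex.exp_add]; congr 2 <;> ring
      rw [this]
      refine (hs_exp_sub_le r1 r2).trans ?_
      have : z * hsqc μ (r * η) - z * m - (z * hsq μ r - z * m) = z * (hsqc μ (r * η) - hsq μ r) := by ring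
      rw [this, norm_mul]
      gcongr
    have n2 : ‖Complex.exp (-(z * m)) * (z * Complex.exp (z * hsq μ r) * hsd μ r)‖ ≤
        Real.exp (-(z.re / 2 * (m - hsq μ (c * r)))) * ((2 * z.re) * hsd μ (c * r)) := by
      have : Complex.exp (-(z * m)) * (z * Complex.exp (z * hsq μ r) * hsd μ r) =
          Complex.exp (z * hsq μ r - z * m) * (z * hsd μ r) := by
        rw [sub_eq_add_neg, Complex.exp_add]; ring
      rw [this, norm_mul, norm_mul, Complex.norm_exp, Complex.norm_real, Real.norm_of_nonneg d1]
      gcongr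
    rw [smul_add, smul_smul, smul_smul]
    refine (norm_add_le _ _).trans ?_
    rw [norm_smul, norm_smul]
    calc _ ≤ (Real.exp (-(z.re / 2 * (m - hsq μ (c * r)))) * ((2 * z.re) * (2 * r * hsd μ (c * r)))) * (C / r) +
          (Real.exp (-(z.re / 2 * (m - hsq μ (c * r)))) * ((2 * z.re) * hsd μ (c * r))) * C := by
          gcongr
          · exact bK r hr
          · exact bK' r hr
      _ = _ := by field_simp; ring
  · rw [integral_const_mul]
    gcongr


theorem hs_exp_scalar {E : Type*} [NormedRing E] [NormedAlgebra ℂ E] [CompleteSpace E]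
    (w : ℂ) (G : E) : NormedSpace.exp (G + w • (1:E)) = Complex.exp w • NormedSpace.exp G := by
  letI : NormedAlgebra ℚ E := NormedAlgebra.restrictScalars ℚ ℂ E
  have h : Commute G (w • (1:E)) := (Commute.one_right G).smul_right w
  rw [NormedSpace.exp_add_of_commute h, ← Algebra.algebraMap_eq_smul_one,
    ← NormedSpace.algebraMap_exp_comm, ← Complex.exp_eq_exp_ℂ, Algebra.algebraMap_eq_smul_one]
  simp

theorem hs_key {E : Type*} [NormedRing E] [NormedAlgebra ℂ E] [CompleteSpace E] {θ M : ℝ}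
    (hθ0 : 0 < θ) (hθ : θ ≤ Real.pi / 2) (W : ℂ → E) (hW : DifferentiableOn ℂ W (Sector θ))
    (hM : ∀ z ∈ Sector θ, ‖W z‖ ≤ M)
    (hmul : ∀ u v : ℝ, 0 < u → 0 < v → W ((u + v : ℝ) : ℂ) = W u * W v) :
    ∃ C ε : ℝ, 0 < ε ∧ 0 ≤ C ∧ ∀ (μ : Measure ℝ) [IsFiniteMeasure μ], (∀ᵐ u ∂μ, 0 < u) →
      ∀ z : ℂ, |z.im| ≤ ε * z.re → ‖NormedSpace.exp (z • ∫ u : ℝ, (W u - 1) ∂μ)‖ ≤ C := by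
  have hpos : ∀ u : ℝ, 0 < u → (u : ℂ) ∈ Sector θ := fun u hu => ⟨by exact_mod_cast hu.ne', by
    rw [Complex.arg_ofReal_of_nonneg hu.le]; simpa using hθ0⟩
  obtain ⟨η₁, η₂, c, C, K, K', L, L', hc, n1, n2, c1, c2, mK, mK', mL, mL', bK, bK', bL, bL', hrep⟩ :=
    hs_repr hθ0 hθ W hW hM
  have hC : 0 ≤ C := (norm_nonneg _).trans (bK' 1 one_pos)
  refine ⟨‖(1:E)‖ + 24 * C / c, c / 4, by positivity, by positivity, ?_⟩
  intro μ _ h z hz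
  set f : ℝ → E := fun u => if 0 < u then W u else 1 with hf
  have fm : StronglyMeasurable f := by
    have hco : ContinuousOn (fun u : ℝ => W u) (Set.Ioi 0) :=
      hW.continuousOn.comp Complex.continuous_ofReal.continuousOn (fun u hu => hpos u hu)
    refine stronglyMeasurable_of_restrict_of_restrict_compl (s := Set.Ioi 0) measurableSet_Ioi ?_ ?_
    · refine (continuousOn_iff_continuous_domRestrict.1 (hco.congr ?_)).stronglyMeasurable
      intro u hu
      simp only [hf, if_pos (show 0 < u from hu)]
    · refine (continuousOn_iff_continuous_domRestrict.1 ((continuousOn_const (c := (1:E))).congr ?_)).stronglyMeasurable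
      intro u hu
      simp only [hf, if_neg (show ¬ 0 < u from hu)]
  have fb : ∀ u, 0 ≤ u → ‖f u‖ ≤ max M ‖(1:E)‖ := by
    intro u hu
    simp only [hf]
    split_ifs with h1
    · exact (hM _ (hpos u h1)).trans (le_max_left _ _)
    · exact le_max_right _ _
  have f0 : f 0 = 1 := by simp [hf]
  have fmul : ∀ u v, 0 ≤ u → 0 ≤ v → f (u + v) = f u * f v := by
    intro u v hu hv
    rcases hu.eq_or_lt with rfl | hu
    · simp [f0]
    rcases hv.eq_or_lt with rfl | hv
    · simp [f0]
    simp only [hf, if_pos hu, if_pos hv, if_pos (add_pos hu hv)]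
    exact hmul u v hu hv
  have hcp := hs_conv_pow fm fb f0 fmul μ h
  set G := ∫ u, f u ∂μ with hG
  set m := μ.real Set.univ with hm
  have hfi : Integrable f μ := Integrable.of_bound fm.aestronglyMeasurable _ (h.mono fun u hu => fb u hu.le)
  have hB : ∫ u : ℝ, (W u - 1) ∂μ = G - (m:ℂ) • (1:E) := by
    have : ∫ u : ℝ, (W u - 1) ∂μ = ∫ u : ℝ, (f u - 1) ∂μ := by
      refine integral_congr_ae (h.mono fun u hu => ?_)
      simp [hf, hu]
    rw [this, integral_sub hfi (integrable_const _), integral_const]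
    congr 1
  obtain ⟨Y1, s1, b1⟩ := hs_half_sum hc n1 c1 mK mK' bK bK' μ h hz
  obtain ⟨Y2, s2, b2⟩ := hs_half_sum hc n2 c2 mL mL' bL bL' μ h hz
  have hexp : NormedSpace.exp (z • G) = 1 + Y1 + Y2 := by
    have s0 : HasSum (fun k : ℕ => if k = 0 then (1:E) else 0) 1 := hasSum_ite_eq 0 1
    have s3 := (s0.add s1).add s2
    refine (NormedSpace.exp_series_hasSum_exp' (𝕂 := ℂ) (z • G)).unique (s3.congr_fun ?_)
    intro k
    rcases k with _ | k
    · simp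
    · simp only [Nat.add_eq_zero_iff, one_ne_zero, and_false, if_false, zero_add]
      rw [← smul_add, smul_pow, ← (hcp (k+1)).2, smul_smul]
      congr 1
      have := hsCP_finite μ (k+1)
      have hp := (hsCP_nonneg μ h k).2
      rw [← integral_add (hs_half_fubini hc n1 c1 mK mK' bK bK' (hsCP μ (k+1)) hp).1
        (hs_half_fubini hc n2 c2 mL mL' bL bL' (hsCP μ (k+1)) hp).1]
      refine integral_congr_ae (hp.mono fun u hu => ?_)
      simp only [hf, if_pos hu]
      exact hrep u hu
  have hsplit : z • ∫ u : ℝ, (W u - 1) ∂μ = z • G + (-(z * m)) • (1:E) := by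
    rw [hB, smul_sub, smul_smul, neg_smul, sub_eq_add_neg]
  rw [hsplit, hs_exp_scalar, hexp, smul_add, smul_add]
  have ha0 : 0 ≤ z.re := by
    have := abs_nonneg z.im
    by_contra hcon
    push Not at hcon
    nlinarith
  have e0 : ‖Complex.exp (-(z * m)) • (1:E)‖ ≤ ‖(1:E)‖ := by
    rw [norm_smul, Complex.norm_exp]
    refine mul_le_of_le_one_left (norm_nonneg _) ?_
    rw [Real.exp_le_one_iff]
    have : 0 ≤ m := measureReal_nonneg
    simp; positivity
  refine (norm_add_le _ _).trans ((add_le_add_left (norm_add_le _ _) _).trans ?_)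
  have : 24 * C / c = 12 * C / c + 12 * C / c := by ring
  rw [this]; linarith


theorem hs_exp_add {E : Type*} [NormedRing E] [NormedAlgebra ℂ E] [CompleteSpace E]
    {a b : E} (h : Commute a b) : NormedSpace.exp (a + b) = NormedSpace.exp a * NormedSpace.exp b := by
  let _ : NormedAlgebra ℚ E := NormedAlgebra.restrictScalars ℚ ℂ E
  exact NormedSpace.exp_add_of_commute h

theorem hs_exp_comm {E : Type*} [NormedRing E] [NormedAlgebra ℂ E] [CompleteSpace E]
    {a b : E} (h : Commute a b) : Commute (NormedSpace.exp a) b := by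
  let _ : NormedAlgebra ℚ E := NormedAlgebra.restrictScalars ℚ ℂ E
  exact h.exp_left

theorem hs_deriv_exp {X : Type*} [NormedAddCommGroup X] [NormedSpace ℂ X] [CompleteSpace X]
    (N : X →L[ℂ] X) (x : X) (t : ℝ) :
    HasDerivAt (fun τ : ℝ => NormedSpace.exp ((τ:ℂ) • N) x) (NormedSpace.exp ((t:ℂ) • N) (N x)) t := by
  have h := (hasDerivAt_exp_smul_const (𝕂 := ℂ) N (t:ℂ)).scomp t Complex.ofRealCLM.hasDerivAt
  simp only [Complex.ofRealCLM_apply, Complex.ofReal_one, one_smul] at h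
  exact ((ContinuousLinearMap.apply ℂ X x).restrictScalars ℝ).hasFDerivAt.comp_hasDerivAt t h

theorem hs_mv {X : Type*} [NormedAddCommGroup X] [NormedSpace ℂ X] [CompleteSpace X]
    {A B : X →L[ℂ] X} (hAB : Commute A B) {z : ℂ} {D : ℝ}
    (hA : ∀ τ : ℝ, 0 ≤ τ → τ ≤ 1 → ‖NormedSpace.exp (((τ:ℂ) * z) • A)‖ ≤ D)
    (hB : ∀ τ : ℝ, 0 ≤ τ → τ ≤ 1 → ‖NormedSpace.exp (((τ:ℂ) * z) • B)‖ ≤ D) (x : X) :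
    ‖NormedSpace.exp (z • A) x - NormedSpace.exp (z • B) x‖ ≤ D ^ 2 * ‖z‖ * ‖A x - B x‖ := by
  set N := z • (A - B) with hN
  have hD : 0 ≤ D := (norm_nonneg _).trans (hA 0 le_rfl zero_le_one)
  have hNB : Commute N B := (hAB.sub_left (Commute.refl B)).smul_left z
  have key : ∀ τ : ℝ, NormedSpace.exp ((τ:ℂ) • N) * NormedSpace.exp (z • B) =
      NormedSpace.exp (((τ:ℂ) * z) • A) * NormedSpace.exp ((((1 - τ : ℝ):ℂ) * z) • B) := by
    intro τ
    rw [← hs_exp_add ((hNB.smul_right z).smul_left _), ← hs_exp_add ((hAB.smul_right _).smul_left _)]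
    congr 1
    rw [hN]
    push_cast
    module
  have hd : ∀ t : ℝ, HasDerivAt (fun τ : ℝ => NormedSpace.exp ((τ:ℂ) • N) (NormedSpace.exp (z • B) x))
      (NormedSpace.exp ((t:ℂ) • N) (N (NormedSpace.exp (z • B) x))) t := fun t => hs_deriv_exp N _ t
  have := norm_image_sub_le_of_norm_deriv_le_segment_01' (C := D ^ 2 * ‖z‖ * ‖A x - B x‖) (fun t _ => (hd t).hasDerivWithinAt) ?_
  · have e1 : NormedSpace.exp (((1:ℝ):ℂ) • N) (NormedSpace.exp (z • B) x) = NormedSpace.exp (z • A) x := by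
      have := congrArg (fun F : X →L[ℂ] X => F x) (key 1)
      simpa using this
    have e0 : NormedSpace.exp (((0:ℝ):ℂ) • N) (NormedSpace.exp (z • B) x) = NormedSpace.exp (z • B) x := by
      simp
    rwa [e1, e0] at this
  · intro t ht
    have c1 : N (NormedSpace.exp (z • B) x) = NormedSpace.exp (z • B) (N x) := by
      have := (hs_exp_comm (hNB.symm.smul_left z)).eq
      exact (congrArg (fun F : X →L[ℂ] X => F x) this).symm
    rw [c1]
    have := congrArg (fun F : X →L[ℂ] X => F (N x)) (key t)
    simp only [mul_apply_eq_comp] at this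
    rw [this]
    have e : N x = z • (A x - B x) := by simp [hN]
    calc _ ≤ D * (D * ‖N x‖) := by
          refine (ContinuousLinearMap.le_opNorm _ _).trans ?_
          gcongr
          · exact hA t ht.1 ht.2.le
          · refine (ContinuousLinearMap.le_opNorm _ _).trans ?_
            gcongr
            exact hB (1 - t) (by linarith [ht.2]) (by linarith [ht.1])
      _ = _ := by rw [e, norm_smul]; ring

theorem hs_mv0 {X : Type*} [NormedAddCommGroup X] [NormedSpace ℂ X] [CompleteSpace X]
    {A : X →L[ℂ] X} {z : ℂ} {D : ℝ} (h1 : 1 ≤ D)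
    (hA : ∀ τ : ℝ, 0 ≤ τ → τ ≤ 1 → ‖NormedSpace.exp (((τ:ℂ) * z) • A)‖ ≤ D) (x : X) :
    ‖NormedSpace.exp (z • A) x - x‖ ≤ D ^ 2 * ‖z‖ * ‖A x‖ := by
  have := hs_mv (Commute.zero_right A) hA (fun τ _ _ => by
    simp only [smul_zero, NormedSpace.exp_zero]
    exact ContinuousLinearMap.norm_id_le.trans h1) x
  simpa using this

theorem hs_second {X : Type*} [NormedAddCommGroup X] [NormedSpace ℂ X] [CompleteSpace X]
    {N : X →L[ℂ] X} {D : ℝ} (h1 : 1 ≤ D)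
    (hA : ∀ τ : ℝ, 0 ≤ τ → τ ≤ 1 → ‖NormedSpace.exp ((τ:ℂ) • N)‖ ≤ D) (x : X) :
    ‖NormedSpace.exp N x - x - N x‖ ≤ D ^ 2 * ‖N (N x)‖ := by
  have hd : ∀ t : ℝ, HasDerivAt (fun τ : ℝ => NormedSpace.exp ((τ:ℂ) • N) x - x - τ • N x)
      (NormedSpace.exp ((t:ℂ) • N) (N x) - N x) t := by
    intro t
    have := ((hs_deriv_exp N x t).sub_const x).fun_sub ((hasDerivAt_id t).smul_const (N x))
    simpa using this
  have := norm_image_sub_le_of_norm_deriv_le_segment_01' (C := D ^ 2 * ‖N (N x)‖) (fun t _ => (hd t).hasDerivWithinAt) ?_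
  · simpa using this
  · intro t ht
    have := hs_mv0 (A := N) (z := (t:ℂ)) h1 (fun τ a b => by
      rw [← Complex.ofReal_mul]
      exact hA _ (mul_nonneg a ht.1) (mul_le_one₀ b ht.1 ht.2.le)) (N x)
    refine this.trans ?_
    rw [Complex.norm_real, Real.norm_of_nonneg ht.1]
    have h2 := ht.2.le
    calc _ ≤ D ^ 2 * 1 * ‖N (N x)‖ := by gcongr
      _ = _ := by ring

theorem hs_telescope {X : Type*} [NormedAddCommGroup X] [NormedSpace ℂ X]
    {P Q : X →L[ℂ] X} (h : Commute P Q) {a b : ℝ} (m : ℕ) (hP : ∀ i ≤ m, ‖P ^ i‖ ≤ a) (hQ : ∀ i ≤ m, ‖Q ^ i‖ ≤ b) (x : X) :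
    ‖(P ^ m) x - (Q ^ m) x‖ ≤ m * (a * b * ‖P x - Q x‖) := by
  have e : (P ^ m) x - (Q ^ m) x = ∑ i ∈ Finset.range m, (P ^ i) ((Q ^ (m - 1 - i)) (P x - Q x)) := by
    have := congrArg (fun F : X →L[ℂ] X => F x) (h.geom_sum₂_mul m)
    simp at this ⊢
    exact this.symm
  have ha : 0 ≤ a := (norm_nonneg _).trans (hP 0 (Nat.zero_le _))
  rw [e]
  refine (norm_sum_le _ _).trans ((Finset.sum_le_sum (g := fun _ => a * b * ‖P x - Q x‖) ?_).trans (by simp))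
  intro i hi
  have hi := Finset.mem_range.1 hi
  refine (ContinuousLinearMap.le_opNorm _ _).trans ?_
  rw [mul_assoc]
  gcongr
  · exact hP i hi.le
  · refine (ContinuousLinearMap.le_opNorm _ _).trans ?_
    gcongr
    exact hQ _ (by omega)


theorem hs_orbit_cont {X : Type*} [NormedAddCommGroup X] [NormedSpace ℂ X]
    {g : ℝ → X →L[ℂ] X} (hg : IsC0Semigroup g) {M : ℝ} (hb : ∀ t, 0 ≤ t → ‖g t‖ ≤ M) (x : X) :
    Continuous fun s : ℝ => g (max s 0) x := by
  obtain ⟨g0, gadd, gc⟩ := hg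
  have hM : 0 ≤ M := (norm_nonneg _).trans (hb 0 le_rfl)
  have key1 : ∀ s t : ℝ, 0 ≤ s → s ≤ t → ‖g t x - g s x‖ ≤ M * ‖g (t - s) x - x‖ := by
    intro s t hs hst
    have : g t = g s ∘L g (t - s) := by rw [← gadd s (t-s) hs (by linarith)]; simp
    rw [this, ContinuousLinearMap.comp_apply, ← map_sub]
    refine (ContinuousLinearMap.le_opNorm _ _).trans ?_
    gcongr
    exact hb s hs
  have key : ∀ s t : ℝ, 0 ≤ s → 0 ≤ t → ‖g s x - g t x‖ ≤ M * ‖g |s - t| x - x‖ := by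
    intro s t hs ht
    rcases le_total s t with h | h
    · rw [norm_sub_rev, abs_of_nonpos (by linarith), neg_sub]; exact key1 s t hs h
    · rw [abs_of_nonneg (by linarith)]; exact key1 t s ht h
  rw [continuous_iff_continuousAt]
  intro t
  rw [ContinuousAt, tendsto_iff_norm_sub_tendsto_zero]
  refine squeeze_zero (fun _ => norm_nonneg _) (fun s => key _ _ (le_max_right s 0) (le_max_right t 0)) ?_
  have h1 : Tendsto (fun s : ℝ => |max s 0 - max t 0|) (𝓝 t) (𝓝[≥] 0) := by
    refine tendsto_nhdsWithin_iff.2 ⟨?_, Eventually.of_forall fun s => Set.mem_Ici.2 (abs_nonneg _)⟩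
    have : Continuous fun s : ℝ => |max s 0 - max t 0| := by fun_prop
    simpa using this.tendsto t
  have h2 := ((gc x).comp h1).sub_const x |>.norm |>.const_mul M
  simpa using h2

theorem hs_dense {X : Type*} [NormedAddCommGroup X] [NormedSpace ℂ X] [CompleteSpace X]
    {g : ℝ → X →L[ℂ] X} (hg : IsC0Semigroup g) {M : ℝ} (hb : ∀ t, 0 ≤ t → ‖g t‖ ≤ M) (x : X)
    {e : ℝ} (he : 0 < e) :
    ∃ y w : X, ‖x - y‖ < e ∧ Tendsto (fun h : ℝ => (((h:ℂ)⁻¹) • (g h - 1)) y) (𝓝[>] 0) (𝓝 w) := by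
  have hcont := hs_orbit_cont hg hb x
  obtain ⟨g0, gadd, gc⟩ := hg
  set G : ℝ → X := fun s => g (max s 0) x with hG
  set F : ℝ → X := fun t => ∫ s in (0:ℝ)..t, G s with hF
  have hFd : ∀ t, HasDerivAt F (G t) t := fun t =>
    intervalIntegral.integral_hasDerivAt_right (hcont.intervalIntegrable _ _)
      hcont.stronglyMeasurable.stronglyMeasurableAtFilter hcont.continuousAt
  have hF0 : F 0 = 0 := by simp [hF]
  have hG0 : G 0 = x := by simp [hG, g0]
  have sl : ∀ t, Tendsto (fun h : ℝ => h⁻¹ • (F (t + h) - F t)) (𝓝[>] 0) (𝓝 (G t)) := fun t =>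
    (hasDerivAt_iff_tendsto_slope_zero.1 (hFd t)).mono_left (nhdsWithin_mono _ (fun a ha => (ne_of_gt ha)))
  have s0 := sl 0
  simp only [zero_add, hF0, sub_zero, hG0] at s0
  have hev := (Metric.tendsto_nhds.1 s0 e he).and (eventually_mem_nhdsWithin)
  obtain ⟨t, ht1, ht⟩ := hev.exists
  have ht : 0 < t := ht
  refine ⟨t⁻¹ • F t, t⁻¹ • (G t - x), by rw [← dist_eq_norm, dist_comm]; exact ht1, ?_⟩
  have key : ∀ h : ℝ, 0 < h → (((h:ℂ)⁻¹) • (g h - 1)) (t⁻¹ • F t) =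
      t⁻¹ • (h⁻¹ • (F (t + h) - F t) - h⁻¹ • F h) := by
    intro h hh
    have e1 : g h (F t) = F (t + h) - F h := by
      have i1 : g h (F t) = ∫ s in (0:ℝ)..t, g h (G s) :=
        ((g h).intervalIntegral_comp_comm (hcont.intervalIntegrable _ _)).symm
      have i2 : ∫ s in (0:ℝ)..t, g h (G s) = ∫ s in (0:ℝ)..t, G (s + h) := by
        refine intervalIntegral.integral_congr ?_
        intro s hs
        rw [Set.uIcc_of_le ht.le] at hs
        simp only [hG, max_eq_left hs.1, max_eq_left (add_nonneg hs.1 hh.le)]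
        rw [add_comm s h, gadd h s hh.le hs.1]; rfl
      rw [i1, i2, intervalIntegral.integral_comp_add_right, zero_add, eq_sub_iff_add_eq, add_comm]
      exact intervalIntegral.integral_add_adjacent_intervals (hcont.intervalIntegrable _ _) (hcont.intervalIntegrable _ _)
    rw [← Complex.ofReal_inv, Complex.coe_smul]
    simp only [smul_apply, sub_apply, one_apply_eq_self]
    have e2 : g h (t⁻¹ • F t) = t⁻¹ • g h (F t) := by
      rw [← Complex.coe_smul, map_smul, Complex.coe_smul]
    rw [e2, e1, ← smul_sub, smul_comm, ← smul_sub]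
    congr 2
    abel
  refine Tendsto.congr' ?_ (((sl t).sub s0).const_smul t⁻¹)
  filter_upwards [self_mem_nhdsWithin] with h hh
  exact (key h hh).symm


theorem hs_strong_holo {X : Type*} [NormedAddCommGroup X] [NormedSpace ℂ X] [CompleteSpace X]
    {S : ℂ → X →L[ℂ] X} {U : Set ℂ} (hU : IsOpen U)
    (hd : ∀ x, DifferentiableOn ℂ (fun z => S z x) U)
    (hloc : ∀ z ∈ U, ∃ r > 0, ∃ D : ℝ, Metric.closedBall z r ⊆ U ∧ ∀ w ∈ Metric.closedBall z r, ‖S w‖ ≤ D) :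
    DifferentiableOn ℂ S U := by
  intro z hz
  obtain ⟨r, hr, D, hsub, hD⟩ := hloc z hz
  have hD0 : 0 ≤ D := (norm_nonneg _).trans (hD z (Metric.mem_closedBall_self hr.le))
  have hr2 : 0 < r / 2 := by positivity
  have sub2 : ∀ w ∈ Metric.closedBall z (r/2), Metric.closedBall w (r/2) ⊆ Metric.closedBall z r := by
    intro w hw
    refine Metric.closedBall_subset_closedBall' ?_
    have := Metric.mem_closedBall.1 hw
    linarith
  have hdat : ∀ x, ∀ w ∈ Metric.closedBall z r, DifferentiableAt ℂ (fun z => S z x) w :=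
    fun x w hw => (hd x).differentiableAt (hU.mem_nhds (hsub hw))
  have dcc : ∀ x, ∀ w ∈ Metric.closedBall z (r/2), DiffContOnCl ℂ (fun z => S z x) (Metric.ball w (r/2)) := by
    intro x w hw
    refine DifferentiableOn.diffContOnCl ?_
    rw [closure_ball _ hr2.ne']
    intro v hv
    exact (hdat x v (sub2 w hw hv)).differentiableWithinAt
  have hder : ∀ x, ∀ w ∈ Metric.closedBall z (r/2), ‖deriv (fun z => S z x) w‖ ≤ D * ‖x‖ / (r/2) := by
    intro x w hw
    refine Complex.norm_deriv_le_of_forall_mem_sphere_norm_le hr2 (dcc x w hw) ?_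
    intro v hv
    refine (ContinuousLinearMap.le_opNorm _ _).trans ?_
    gcongr
    exact hD v (sub2 w hw (Metric.sphere_subset_closedBall hv))
  have hc2 : Metric.closedBall z (r/2) ⊆ Metric.closedBall z r := Metric.closedBall_subset_closedBall (by linarith)
  have hlip : ∀ v ∈ Metric.closedBall z (r/2), ∀ w ∈ Metric.closedBall z (r/2), ‖S v - S w‖ ≤ D / (r/2) * ‖v - w‖ := by
    intro v hv w hw
    refine ContinuousLinearMap.opNorm_le_bound _ (by positivity) ?_
    intro x
    have := Convex.norm_image_sub_le_of_norm_deriv_le (f := fun z => S z x)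
      (fun w hw => hdat x w (hc2 hw)) (hder x) (convex_closedBall z (r/2)) hw hv
    rw [sub_apply]
    refine this.trans (le_of_eq ?_)
    ring
  have hcont : ContinuousOn S (Metric.closedBall z (r/2)) := by
    have hL : LipschitzOnWith (D / (r/2)).toNNReal S (Metric.closedBall z (r/2)) := by
      refine LipschitzOnWith.of_dist_le_mul ?_
      intro v hv w hw
      rw [dist_eq_norm, dist_eq_norm, Real.coe_toNNReal _ (by positivity)]
      exact hlip v hv w hw
    exact hL.continuousOn
  set R : NNReal := ⟨r/2, hr2.le⟩ with hR
  have hRr : (R:ℝ) = r/2 := rfl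
  have hci : CircleIntegrable S z R := by
    refine ContinuousOn.circleIntegrable hr2.le (hcont.mono Metric.sphere_subset_closedBall)
  have hps := (hasFPowerSeriesOn_cauchy_integral hci (by exact_mod_cast hr2)).analyticAt.differentiableAt
  have heq : (fun w => (2 * ↑Real.pi * Complex.I)⁻¹ • ∮ (v : ℂ) in C(z, R), (v - w)⁻¹ • S v) =ᶠ[𝓝 z] S := by
    filter_upwards [Metric.ball_mem_nhds z hr2] with w hw
    ext x
    have hC := (dcc x z (Metric.mem_closedBall_self hr2.le)).two_pi_i_inv_smul_circleIntegral_sub_inv_smul hw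
    rw [← hC, smul_apply]
    congr 1
    simp only [circleIntegral, hRr]
    have hint : IntervalIntegrable (fun θ => deriv (circleMap z (r/2)) θ • ((circleMap z (r/2) θ - w)⁻¹ • S (circleMap z (r/2) θ))) volume 0 (2 * Real.pi) := by
      have : CircleIntegrable (fun v => (v - w)⁻¹ • S v) z (r/2) := by
        refine ContinuousOn.circleIntegrable hr2.le (ContinuousOn.fun_smul ?_ (hcont.mono Metric.sphere_subset_closedBall))
        refine ContinuousOn.inv₀ (by fun_prop) ?_
        intro v hv h0
        rw [sub_eq_zero.1 h0] at hv
        have h1 := Metric.mem_sphere.1 hv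
        have h2 := Metric.mem_ball.1 hw
        linarith
      exact this.out
    have := (ContinuousLinearMap.apply ℂ X x).intervalIntegral_comp_comm hint
    simpa using this.symm
  exact (hps.congr_of_eventuallyEq heq.symm).differentiableWithinAt


theorem hs_sector_sub {ε : ℝ} {z : ℂ} (hz : z ∈ Sector (Real.arctan ε)) : |z.im| < ε * z.re := by
  obtain ⟨h0, h1⟩ := hz
  have h2 : |Complex.arg z| < Real.pi / 2 := h1.trans (Real.arctan_lt_pi_div_two ε)
  have hre : 0 < z.re := by
    rcases Complex.abs_arg_lt_pi_div_two_iff.1 h2 with h | h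
    · exact h
    · exact absurd h h0
  have h3 : |Complex.arg z| < Real.arctan ε := h1
  have hl := abs_lt.1 h3
  have hl2 := abs_lt.1 h2
  have t1 : Real.tan z.arg < ε := by
    have := Real.tan_lt_tan_of_lt_of_lt_pi_div_two hl2.1 (Real.arctan_lt_pi_div_two ε) hl.2
    rwa [Real.tan_arctan] at this
  have t2 : -ε < Real.tan z.arg := by
    have := Real.tan_lt_tan_of_lt_of_lt_pi_div_two (x := -Real.arctan ε) (by linarith [Real.arctan_lt_pi_div_two ε]) hl2.2 hl.1
    rwa [Real.tan_neg, Real.tan_arctan] at this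
  rw [Complex.tan_arg] at t1 t2
  rw [abs_lt]
  constructor
  · rw [lt_div_iff₀ hre] at t2; linarith
  · rwa [div_lt_iff₀ hre] at t1

theorem hs_uc {X : Type*} [NormedAddCommGroup X] [NormedSpace ℂ X] [CompleteSpace X]
    {A : ℝ → X →L[ℂ] X} (hAc : ∀ h k, 0 < h → 0 < k → Commute (A h) (A k))
    (hdense : ∀ x : X, ∀ e > 0, ∃ y w : X, ‖x - y‖ < e ∧ Tendsto (fun h => A h y) (𝓝[>] 0) (𝓝 w))
    {K : Set ℂ} (hK : ∀ z ∈ K, ∀ τ : ℝ, 0 ≤ τ → (τ:ℂ) * z ∈ K)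
    {D : ℝ → ℝ} (hD1 : ∀ R, 1 ≤ D R)
    (hE : ∀ h, 0 < h → ∀ z ∈ K, ∀ R, ‖z‖ ≤ R → ‖NormedSpace.exp (z • A h)‖ ≤ D R)
    (x : X) (R : ℝ) (hR : 0 ≤ R) {e : ℝ} (he : 0 < e) :
    ∃ δ > 0, ∀ h k, 0 < h → h < δ → 0 < k → k < δ → ∀ z ∈ K, ‖z‖ ≤ R →
      ‖NormedSpace.exp (z • A h) x - NormedSpace.exp (z • A k) x‖ ≤ e := by
  have hD := hD1 R
  obtain ⟨y, w, hy, hw⟩ := hdense x (e / (4 * D R)) (by positivity)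
  set e' := e / (4 * D R ^ 2 * (R + 1)) with he'
  have e'p : 0 < e' := by positivity
  obtain ⟨δ, hδ, hδ2⟩ := (Metric.nhdsWithin_basis_ball.tendsto_iff Metric.nhds_basis_ball).1 hw e' e'p
  refine ⟨δ, hδ, ?_⟩
  intro h k hh hhδ hk hkδ z hz hzR
  have m1 : ‖A h y - w‖ < e' := by
    have := hδ2 h ⟨by simpa [abs_of_pos hh] using hhδ, hh⟩
    simpa [dist_eq_norm] using this
  have m2 : ‖A k y - w‖ < e' := by
    have := hδ2 k ⟨by simpa [abs_of_pos hk] using hkδ, hk⟩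
    simpa [dist_eq_norm] using this
  have m3 : ‖A h y - A k y‖ ≤ 2 * e' := by
    have : A h y - A k y = (A h y - w) - (A k y - w) := by abel
    rw [this]; refine (norm_sub_le _ _).trans (by linarith)
  have hb : ∀ h, 0 < h → ∀ τ : ℝ, 0 ≤ τ → τ ≤ 1 → ‖NormedSpace.exp (((τ:ℂ) * z) • A h)‖ ≤ D R := by
    intro h hh τ h0 h1
    refine hE h hh _ (hK z hz τ h0) R ?_
    rw [norm_mul, Complex.norm_real, Real.norm_of_nonneg h0]
    exact (mul_le_of_le_one_left (norm_nonneg _) h1).trans hzR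
  have mv := hs_mv (hAc h k hh hk) (hb h hh) (hb k hk) y
  have b1 : ‖NormedSpace.exp (z • A h) (x - y)‖ ≤ D R * ‖x - y‖ :=
    (ContinuousLinearMap.le_opNorm _ _).trans (by gcongr; exact hE h hh z hz R hzR)
  have b2 : ‖NormedSpace.exp (z • A k) (x - y)‖ ≤ D R * ‖x - y‖ :=
    (ContinuousLinearMap.le_opNorm _ _).trans (by gcongr; exact hE k hk z hz R hzR)
  have b3 : D R * ‖x - y‖ ≤ e / 4 := by
    calc D R * ‖x - y‖ ≤ D R * (e / (4 * D R)) := by gcongr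
      _ = e / 4 := by field_simp
  have b4 : D R ^ 2 * ‖z‖ * ‖A h y - A k y‖ ≤ e / 2 := by
    calc _ ≤ D R ^ 2 * (R + 1) * (2 * e') := by gcongr; linarith
      _ = e / 2 := by rw [he']; field_simp; norm_num
  have dec : NormedSpace.exp (z • A h) x - NormedSpace.exp (z • A k) x =
      NormedSpace.exp (z • A h) (x - y) - NormedSpace.exp (z • A k) (x - y) +
      (NormedSpace.exp (z • A h) y - NormedSpace.exp (z • A k) y) := by
    simp only [map_sub]; abel
  rw [dec]
  refine (norm_add_le _ _).trans ?_
  have := norm_sub_le (NormedSpace.exp (z • A h) (x - y)) (NormedSpace.exp (z • A k) (x - y))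
  linarith

theorem hs_exists_limit {X : Type*} [NormedAddCommGroup X] [NormedSpace ℂ X] [CompleteSpace X]
    {E : ℝ → ℂ → X →L[ℂ] X} {K : Set ℂ} {D : ℝ → ℝ}
    (hE : ∀ h, 0 < h → ∀ z ∈ K, ∀ R, ‖z‖ ≤ R → ‖E h z‖ ≤ D R)
    (huc : ∀ (x : X) (R : ℝ), 0 ≤ R → ∀ e > 0, ∃ δ > 0, ∀ h k, 0 < h → h < δ → 0 < k → k < δ → ∀ z ∈ K, ‖z‖ ≤ R →
      ‖E h z x - E k z x‖ ≤ e) :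
    ∃ S : ℂ → X →L[ℂ] X, (∀ z ∈ K, ∀ R, ‖z‖ ≤ R → ‖S z‖ ≤ D R) ∧
      ∀ (x : X) (R : ℝ), 0 ≤ R → ∀ e > 0, ∃ δ > 0, ∀ h, 0 < h → h < δ → ∀ z ∈ K, ‖z‖ ≤ R →
      ‖E h z x - S z x‖ ≤ e := by
  classical
  set hm : ℕ → ℝ := fun m => 1 / ((m:ℝ) + 1) with hhm
  have hm0 : ∀ m, 0 < hm m := fun m => by simp only [hhm]; positivity
  have hmt : Tendsto hm atTop (𝓝 0) := tendsto_one_div_add_atTop_nhds_zero_nat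
  have hex : ∀ z ∈ K, ∃ S : X →L[ℂ] X, ∀ x, Tendsto (fun m => E (hm m) z x) atTop (𝓝 (S x)) := by
    intro z hz
    have : ∀ x, ∃ y, Tendsto (fun m => E (hm m) z x) atTop (𝓝 y) := by
      intro x
      refine cauchySeq_tendsto_of_complete ?_
      rw [Metric.cauchySeq_iff]
      intro e he
      obtain ⟨δ, hδ, H⟩ := huc x ‖z‖ (norm_nonneg _) (e/2) (by positivity)
      obtain ⟨N, hN⟩ := eventually_atTop.1 (hmt.eventually (gt_mem_nhds hδ))
      refine ⟨N, fun a ha b hb => ?_⟩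
      rw [dist_eq_norm]
      refine (H _ _ (hm0 a) (hN a ha) (hm0 b) (hN b hb) z hz le_rfl).trans_lt (by linarith)
    choose f hf using this
    exact ⟨continuousLinearMapOfTendsto (fun m => E (hm m) z) (tendsto_pi_nhds.2 hf), fun x => hf x⟩
  choose! S hS using hex
  refine ⟨S, ?_, ?_⟩
  · intro z hz R hR
    have hD : 0 ≤ D R := (norm_nonneg _).trans (hE 1 one_pos z hz R hR)
    refine ContinuousLinearMap.opNorm_le_bound _ hD ?_
    intro x
    refine le_of_tendsto (hS z hz x).norm (Eventually.of_forall fun m => ?_)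
    refine (ContinuousLinearMap.le_opNorm _ _).trans ?_
    gcongr
    exact hE _ (hm0 m) z hz R hR
  · intro x R hR e he
    obtain ⟨δ, hδ, H⟩ := huc x R hR e he
    refine ⟨δ, hδ, fun h h0 h1 z hz hzR => ?_⟩
    refine le_of_tendsto ((hS z hz x).const_sub (E h z x)).norm ?_
    filter_upwards [hmt.eventually (gt_mem_nhds hδ)] with m hmm
    exact H h _ h0 h1 (hm0 m) hmm z hz hzR


theorem hs_main_limit {X : Type*} [NormedAddCommGroup X] [NormedSpace ℂ X] [CompleteSpace X]
    {g : ℝ → X →L[ℂ] X} (hg : IsC0Semigroup g) {M : ℝ} (hb : ∀ t, 0 ≤ t → ‖g t‖ ≤ M)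
    {C C' ε : ℝ} (hC : 0 ≤ C) (hC' : 0 ≤ C') (hε : 0 < ε)
    (hE0 : ∀ h : ℝ, 0 < h → ∀ z : ℂ, |z.im| ≤ ε * z.re →
      ‖NormedSpace.exp (z • ((h:ℂ)⁻¹ • (g h - 1)))‖ ≤ C * Real.exp (C' * ‖z‖)) :
    IsHolomorphicSemigroup g := by
  have hdense := hs_dense hg hb
  obtain ⟨g0, gadd, gc⟩ := hg
  have hM0 : 0 ≤ M := (norm_nonneg _).trans (hb 0 le_rfl)
  set A : ℝ → X →L[ℂ] X := fun h => (h:ℂ)⁻¹ • (g h - 1) with hA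
  set K : Set ℂ := {z | |z.im| ≤ ε * z.re} with hK
  set D : ℝ → ℝ := fun R => max 1 (C * Real.exp (C' * R)) with hD
  have hD1 : ∀ R, 1 ≤ D R := fun R => le_max_left _ _
  have hKτ : ∀ z ∈ K, ∀ τ : ℝ, 0 ≤ τ → (τ:ℂ) * z ∈ K := by
    intro z hz τ hτ
    have hz : |z.im| ≤ ε * z.re := hz
    show |((τ:ℂ) * z).im| ≤ ε * ((τ:ℂ) * z).re
    rw [Complex.im_ofReal_mul, Complex.re_ofReal_mul, abs_mul, abs_of_nonneg hτ]
    nlinarith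
  have hKadd : ∀ z ∈ K, ∀ w ∈ K, z + w ∈ K := by
    intro z hz w hw
    have hz : |z.im| ≤ ε * z.re := hz
    have hw : |w.im| ≤ ε * w.re := hw
    show |(z + w).im| ≤ ε * (z + w).re
    rw [Complex.add_im, Complex.add_re]
    have := abs_add_le z.im w.im
    linarith
  have hKr : ∀ t : ℝ, 0 ≤ t → (t:ℂ) ∈ K := by
    intro t ht
    show |(t:ℂ).im| ≤ ε * (t:ℂ).re
    simp; positivity
  have hgc : ∀ s t, 0 ≤ s → 0 ≤ t → Commute (g s) (g t) := by
    intro s t hs ht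
    show g s ∘L g t = g t ∘L g s
    rw [← gadd s t hs ht, ← gadd t s ht hs, add_comm]
  have hAc : ∀ h k, 0 < h → 0 < k → Commute (A h) (A k) := by
    intro h k hh hk
    refine Commute.smul_left (Commute.smul_right ?_ _) _
    exact ((hgc h k hh.le hk.le).sub_right (Commute.one_right _)).sub_left (Commute.one_left _)
  have hE : ∀ h, 0 < h → ∀ z ∈ K, ∀ R, ‖z‖ ≤ R → ‖NormedSpace.exp (z • A h)‖ ≤ D R := by
    intro h hh z hz R hR
    refine (hE0 h hh z hz).trans (le_trans ?_ (le_max_right _ _))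
    gcongr
  have huc : ∀ (x : X) (R : ℝ), 0 ≤ R → ∀ e > 0, ∃ δ > 0, ∀ h k, 0 < h → h < δ → 0 < k → k < δ → ∀ z ∈ K, ‖z‖ ≤ R →
      ‖NormedSpace.exp (z • A h) x - NormedSpace.exp (z • A k) x‖ ≤ e := fun x R hR e he =>
    hs_uc hAc (fun x e he => hdense x he) hKτ hD1 hE x R hR he
  obtain ⟨S, hSb, hSu⟩ := hs_exists_limit (E := fun h z => NormedSpace.exp (z • A h)) hE huc
  have hSt : ∀ z ∈ K, ∀ x, Tendsto (fun h => NormedSpace.exp (z • A h) x) (𝓝[>] 0) (𝓝 (S z x)) := by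
    intro z hz x
    rw [Metric.tendsto_nhds]
    intro e he
    obtain ⟨δ, hδ, H⟩ := hSu x ‖z‖ (norm_nonneg _) (e/2) (by positivity)
    filter_upwards [Ioo_mem_nhdsGT hδ] with h hh
    rw [dist_eq_norm]
    exact (H h hh.1 hh.2 z hz le_rfl).trans_lt (by linarith)
  have hsub : ∀ z ∈ Sector (Real.arctan ε), z ∈ K := fun z hz => (hs_sector_sub hz).le
  refine ⟨Real.arctan ε, S, Real.arctan_pos.2 hε, ?_, ?_, ?_, ?_⟩
  · -- S t = g t
    intro t ht
    have key : ∀ y w : X, Tendsto (fun h : ℝ => A h y) (𝓝[>] 0) (𝓝 w) → S t y = g t y := by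
      intro y w hw
      set hm : ℕ → ℝ := fun m => t / ((m:ℝ) + 1) with hhm
      have hm0 : ∀ m, 0 < hm m := fun m => by simp only [hhm]; positivity
      have hmt : Tendsto hm atTop (𝓝[>] 0) := by
        refine tendsto_nhdsWithin_iff.2 ⟨?_, Eventually.of_forall hm0⟩
        have := (tendsto_one_div_add_atTop_nhds_zero_nat (𝕜 := ℝ)).const_mul t
        simpa [hhm, div_eq_mul_inv] using this
      have l1 := (hSt t (hKr t ht.le) y).comp hmt
      set DD := D (t + 1)
      have hDD : 1 ≤ DD := hD1 _
      have est : ∀ m : ℕ, ‖NormedSpace.exp ((t:ℂ) • A (hm m)) y - g t y‖ ≤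
          DD ^ 3 * M * t * ‖(g (hm m) - 1) (A (hm m) y)‖ := by
        intro m
        set h := hm m with hh
        have h0 : 0 < h := hm0 m
        have hmh : ((m + 1 : ℕ):ℝ) * h = t := by
          simp only [hh, hhm]; push_cast; field_simp
        have hle : h ≤ t := by
          rw [← hmh]; push_cast
          have : (0:ℝ) ≤ m := Nat.cast_nonneg m
          nlinarith
        set N := g h - 1 with hN
        have hNA : N = (h:ℂ) • A h := by
          simp only [hA, smul_smul]
          rw [mul_inv_cancel₀ (by exact_mod_cast h0.ne'), one_smul]
        have gpow : ∀ i : ℕ, g h ^ i = g (i * h) := by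
          intro i
          induction i with
          | zero => simp [g0]
          | succ i ih =>
            rw [pow_succ, ih]; push_cast
            rw [add_mul, one_mul, gadd _ _ (by positivity) h0.le]; rfl
        have epow : ∀ i : ℕ, NormedSpace.exp N ^ i = NormedSpace.exp (((i * h : ℝ):ℂ) • A h) := by
          intro i
          induction i with
          | zero => simp
          | succ i ih =>
            rw [pow_succ, ih, hNA, ← hs_exp_add ((Commute.refl (A h)).smul_left _ |>.smul_right _), ← add_smul]
            congr 2
            push_cast; ring
        have P1 : ∀ i ≤ m + 1, ‖NormedSpace.exp N ^ i‖ ≤ DD := by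
          intro i hi
          rw [epow]
          refine hE h h0 _ (hKr _ (by positivity)) _ ?_
          rw [Complex.norm_real, Real.norm_of_nonneg (by positivity)]
          have : (i:ℝ) * h ≤ ((m + 1 : ℕ):ℝ) * h := by gcongr
          linarith
        have Q1 : ∀ i ≤ m + 1, ‖g h ^ i‖ ≤ M := by
          intro i _
          rw [gpow]; exact hb _ (by positivity)
        have hcm : Commute (NormedSpace.exp N) (g h) :=
          hs_exp_comm ((Commute.refl (g h)).sub_left (Commute.one_left _))
        have tel := hs_telescope hcm (m + 1) P1 Q1 y
        have sec := hs_second (N := N) hDD (fun τ a b => by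
          rw [hNA, smul_smul, ← Complex.ofReal_mul]
          refine hE h h0 _ (hKr _ (by positivity)) _ ?_
          rw [Complex.norm_real, Real.norm_of_nonneg (by positivity)]
          nlinarith) y
        rw [epow, hmh, gpow, hmh] at tel
        refine tel.trans ?_
        have e1 : NormedSpace.exp N y - g h y = NormedSpace.exp N y - y - N y := by
          simp [hN]
        have e2 : ‖N (N y)‖ = h * ‖N (A h y)‖ := by
          have : N y = (h:ℂ) • A h y := by
            conv_lhs => rw [hNA]
            rfl
          rw [this, map_smul, norm_smul, Complex.norm_real, Real.norm_of_nonneg h0.le]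
        rw [e1]
        rw [e2] at sec
        calc ((m + 1 : ℕ):ℝ) * (DD * M * ‖NormedSpace.exp N y - y - N y‖)
            ≤ ((m + 1 : ℕ):ℝ) * (DD * M * (DD ^ 2 * (h * ‖N (A h y)‖))) := by gcongr
          _ = DD ^ 3 * M * (((m + 1 : ℕ):ℝ) * h) * ‖N (A h y)‖ := by ring
          _ = _ := by rw [hmh]
      have l2 : Tendsto (fun h : ℝ => (g h - 1) (A h y)) (𝓝[>] 0) (𝓝 0) := by
        have a1 : Tendsto (fun h : ℝ => g h w - w) (𝓝[>] 0) (𝓝 0) := by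
          have := ((gc w).mono_left (nhdsWithin_mono _ Set.Ioi_subset_Ici_self)).sub_const w
          simpa using this
        have a2 : Tendsto (fun h : ℝ => (g h - 1) (A h y - w)) (𝓝[>] 0) (𝓝 0) := by
          have hz : Tendsto (fun h : ℝ => (M + 1) * ‖A h y - w‖) (𝓝[>] 0) (𝓝 0) := by
            have := (hw.sub_const w).norm.const_mul (M + 1)
            simpa using this
          refine squeeze_zero_norm' ?_ hz
          filter_upwards [self_mem_nhdsWithin] with h hh
          refine (ContinuousLinearMap.le_opNorm _ _).trans ?_
          gcongr
          refine (norm_sub_le _ _).trans ?_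
          gcongr
          · exact hb h (le_of_lt hh)
          · exact ContinuousLinearMap.norm_id_le
        have := a2.add a1
        rw [add_zero] at this
        refine this.congr fun h => ?_
        simp only [map_sub, sub_apply, one_apply_eq_self]; abel
      have l3 : Tendsto (fun m : ℕ => NormedSpace.exp ((t:ℂ) • A (hm m)) y) atTop (𝓝 (g t y)) := by
        rw [tendsto_iff_norm_sub_tendsto_zero]
        refine squeeze_zero (fun _ => norm_nonneg _) est ?_
        have := ((l2.comp hmt).norm.const_mul (DD ^ 3 * M * t))
        simpa using this
      exact tendsto_nhds_unique l1 l3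
    ext x
    refine eq_of_forall_dist_le ?_
    intro e he
    set q := ‖S t‖ + ‖g t‖ + 1 with hq
    have hq0 : 0 < q := by positivity
    obtain ⟨y, w, hy, hw⟩ := hdense x (e := e / q) (by positivity)
    have hk := key y w hw
    have : S t x - g t x = S t (x - y) - g t (x - y) := by simp only [map_sub, hk]; abel
    rw [dist_eq_norm, this]
    calc _ ≤ ‖S t‖ * ‖x - y‖ + ‖g t‖ * ‖x - y‖ :=
          (norm_sub_le _ _).trans (add_le_add (ContinuousLinearMap.le_opNorm _ _) (ContinuousLinearMap.le_opNorm _ _))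
      _ ≤ q * ‖x - y‖ := by rw [hq]; nlinarith [norm_nonneg (x - y)]
      _ ≤ q * (e / q) := by gcongr
      _ = e := by field_simp
  · intro z w hz hw
    ext x
    have hzK := hsub z hz
    have hwK := hsub w hw
    refine tendsto_nhds_unique (hSt _ (hKadd z hzK w hwK) x) ?_
    have a1 : Tendsto (fun h => NormedSpace.exp (z • A h) (NormedSpace.exp (w • A h) x - S w x)) (𝓝[>] 0) (𝓝 0) := by
      have hz0 : Tendsto (fun h : ℝ => D ‖z‖ * ‖NormedSpace.exp (w • A h) x - S w x‖) (𝓝[>] 0) (𝓝 0) := by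
        have := ((hSt w hwK x).sub_const (S w x)).norm.const_mul (D ‖z‖)
        simpa using this
      refine squeeze_zero_norm' ?_ hz0
      filter_upwards [self_mem_nhdsWithin] with h hh
      refine (ContinuousLinearMap.le_opNorm _ _).trans ?_
      gcongr
      exact hE h hh z hzK _ le_rfl
    have a2 := a1.add (hSt z hzK (S w x))
    rw [zero_add] at a2
    refine a2.congr fun h => ?_
    rw [add_smul, hs_exp_add ((Commute.refl (A h)).smul_left _ |>.smul_right _), map_sub]
    simp
  · have hUo : IsOpen {z : ℂ | |z.im| < ε * z.re} := isOpen_lt (by fun_prop) (by fun_prop)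
    have hUK : {z : ℂ | |z.im| < ε * z.re} ⊆ K := fun z hz => le_of_lt (α := ℝ) hz
    refine DifferentiableOn.mono (hs_strong_holo hUo ?_ ?_) (fun z hz => hs_sector_sub hz)
    · intro x
      refine TendstoLocallyUniformlyOn.differentiableOn (φ := 𝓝[>] (0:ℝ)) (F := fun h z => NormedSpace.exp (z • A h) x) ?_ ?_ hUo
      · rw [Metric.tendstoLocallyUniformlyOn_iff]
        intro e he z hz
        obtain ⟨δ, hδ, H⟩ := hSu x (‖z‖ + 1) (by positivity) (e/2) (by positivity)
        refine ⟨Metric.ball z 1 ∩ {z : ℂ | |z.im| < ε * z.re}, inter_mem (mem_nhdsWithin_of_mem_nhds (Metric.ball_mem_nhds z one_pos)) self_mem_nhdsWithin, ?_⟩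
        filter_upwards [Ioo_mem_nhdsGT hδ] with h hh y hy
        rw [dist_comm, dist_eq_norm]
        refine (H h hh.1 hh.2 y (hUK hy.2) ?_).trans_lt (by linarith)
        have := Metric.mem_ball.1 hy.1
        rw [dist_eq_norm] at this
        have := norm_sub_norm_le y z
        linarith
      · refine Eventually.of_forall fun h => ?_
        intro z _
        have := (hasDerivAt_exp_smul_const (𝕂 := ℂ) (A h) z)
        have h2 := (ContinuousLinearMap.apply ℂ X x).hasFDerivAt.comp_hasDerivAt z this
        exact h2.differentiableAt.differentiableWithinAt
    · intro z hz
      obtain ⟨r, hr, hrs⟩ := Metric.nhds_basis_closedBall.mem_iff.1 (hUo.mem_nhds hz)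
      refine ⟨r, hr, D (‖z‖ + r), hrs, fun w hw => hSb w (hUK (hrs hw)) _ ?_⟩
      have := Metric.mem_closedBall.1 hw
      rw [dist_eq_norm] at this
      have := norm_sub_norm_le w z
      linarith
  · intro x
    rw [Metric.tendsto_nhds]
    intro e he
    set DD := D 1
    have hDD : 1 ≤ DD := hD1 1
    obtain ⟨y, w, hy, hw⟩ := hdense x (e := e / (4 * DD)) (by positivity)
    set δ := min 1 (e / (4 * DD ^ 2 * (‖w‖ + 1))) with hδ
    have hδ0 : 0 < δ := by rw [hδ]; positivity
    filter_upwards [mem_nhdsWithin_of_mem_nhds (Metric.ball_mem_nhds (0:ℂ) hδ0), self_mem_nhdsWithin] with z hz hzs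
    have hzK := hsub z hzs
    have hzδ : ‖z‖ < δ := by simpa using hz
    have hz1 : ‖z‖ ≤ 1 := hzδ.le.trans (min_le_left _ _)
    have hz2 : ‖z‖ ≤ e / (4 * DD ^ 2 * (‖w‖ + 1)) := hzδ.le.trans (min_le_right _ _)
    have b1 : ‖S z y - y‖ ≤ e / 4 := by
      have lim : ‖S z y - y‖ ≤ DD ^ 2 * ‖z‖ * ‖w‖ := by
        refine le_of_tendsto_of_tendsto ((hSt z hzK y).sub_const y).norm (hw.norm.const_mul (DD ^ 2 * ‖z‖)) ?_
        filter_upwards [self_mem_nhdsWithin] with h hh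
        refine hs_mv0 hDD (fun τ a b => ?_) y
        refine hE h hh _ (hKτ z hzK τ a) _ ?_
        rw [norm_mul, Complex.norm_real, Real.norm_of_nonneg a]
        nlinarith [norm_nonneg z]
      refine lim.trans ?_
      calc DD ^ 2 * ‖z‖ * ‖w‖ ≤ DD ^ 2 * (e / (4 * DD ^ 2 * (‖w‖ + 1))) * (‖w‖ + 1) := by gcongr; linarith
        _ = e / 4 := by field_simp
    have b2 : ‖S z (x - y)‖ ≤ e / 4 := by
      calc ‖S z (x - y)‖ ≤ DD * (e / (4 * DD)) := by
            refine (ContinuousLinearMap.le_opNorm _ _).trans ?_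
            gcongr
            exact hSb z hzK 1 hz1
        _ = e / 4 := by field_simp
    have b3 : ‖x - y‖ ≤ e / 4 := by
      refine hy.le.trans ?_
      gcongr
      linarith
    have dec : S z x - x = S z (x - y) + (S z y - y) - (x - y) := by simp only [map_sub]; abel
    rw [dist_eq_norm, dec]
    refine (norm_sub_le _ _).trans_lt ?_
    have := norm_add_le (S z (x - y)) (S z y - y)
    linarith


theorem hs_bs {X : Type*} [NormedAddCommGroup X] [NormedSpace ℂ X] [CompleteSpace X] {α : Type*}
    {F : α → X →L[ℂ] X} {l : Filter α} [l.IsCountablyGenerated]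
    (h : ∀ x, ∃ y, Tendsto (fun a => F a x) l (𝓝 y)) : ∃ C : ℝ, ∀ᶠ a in l, ‖F a‖ ≤ C := by
  by_contra hcon
  push Not at hcon
  obtain ⟨s, hs⟩ := l.exists_antitone_basis
  have : ∀ n : ℕ, ∃ a, a ∈ s n ∧ (n:ℝ) < ‖F a‖ := by
    intro n
    have h1 := (hcon n).and_eventually (hs.1.mem_of_mem (i := n) trivial)
    obtain ⟨a, h2, h3⟩ := h1.exists
    exact ⟨a, h3, h2⟩
  choose a ha1 ha2 using this
  have hat : Tendsto a atTop l := hs.tendsto ha1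
  obtain ⟨C, hC⟩ := banach_steinhaus (g := fun n => F (a n)) (by
    intro x
    obtain ⟨y, hy⟩ := h x
    obtain ⟨C, hC⟩ := (hy.comp hat).norm.bddAbove_range
    exact ⟨C, fun n => hC ⟨n, rfl⟩⟩)
  obtain ⟨n, hn⟩ := exists_nat_gt C
  have := hC n
  have := ha2 n
  linarith

theorem hs_sector_smul {θ : ℝ} {z : ℂ} (hz : z ∈ Sector θ) {r : ℝ} (hr : 0 < r) : (r:ℂ) * z ∈ Sector θ := by
  refine ⟨mul_ne_zero (by exact_mod_cast hr.ne') hz.1, ?_⟩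
  rw [Complex.arg_real_mul _ hr]; exact hz.2

theorem hs_first {X : Type*} [NormedAddCommGroup X] [NormedSpace ℂ X] [CompleteSpace X]
    {T : ℝ → X →L[ℂ] X} (hT : IsHolomorphicSemigroup T) :
    ∃ (θ δ M : ℝ) (W : ℂ → X →L[ℂ] X), 0 < θ ∧ θ ≤ Real.pi / 2 ∧ 1 ≤ δ ∧
      DifferentiableOn ℂ W (Sector θ) ∧ (∀ z ∈ Sector θ, ‖W z‖ ≤ M) ∧
      ∀ u : ℝ, 0 < u → W u = ((Real.exp (-(δ * u)) : ℝ) : ℂ) • T u := by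
  obtain ⟨θ, S, hθ, hST, hSadd, hSd, hSc⟩ := hT
  obtain ⟨M0, hM0⟩ := hs_bs (F := S) (l := 𝓝[Sector θ] 0) (fun x => ⟨x, hSc x⟩)
  obtain ⟨r, hr, hball⟩ := Metric.mem_nhdsWithin_iff.1 hM0
  set M1 := max 1 M0 with hM1
  have hM11 : 1 ≤ M1 := le_max_left _ _
  have hsmall : ∀ z ∈ Sector θ, ‖z‖ < r → ‖S z‖ ≤ M1 := fun z hz hzr =>
    (show ‖S z‖ ≤ M0 from hball ⟨by simpa using hzr, hz⟩).trans (le_max_right _ _)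
  have hpow : ∀ z ∈ Sector θ, ∀ N : ℕ, S (((N + 1 : ℕ):ℝ) * z) = S z ^ (N + 1) := by
    intro z hz N
    induction N with
    | zero => simp
    | succ N ih =>
      rw [pow_succ, ← ih]
      have : ((((N + 1 + 1 : ℕ):ℝ)):ℂ) * z = ((((N + 1 : ℕ):ℝ)):ℂ) * z + z := by push_cast; ring
      rw [this, hSadd _ _ (hs_sector_smul hz (by positivity)) hz]; rfl
  set a := Real.log M1 / r with ha
  have ha0 : 0 ≤ a := div_nonneg (Real.log_nonneg hM11) hr.le
  have hexp : ∀ z ∈ Sector θ, ‖S z‖ ≤ M1 * Real.exp (a * ‖z‖) := by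
    intro z hz
    set N := ⌊‖z‖ / r⌋₊ with hN
    have h1 : (N:ℝ) ≤ ‖z‖ / r := Nat.floor_le (by positivity)
    have h2 : ‖z‖ / r < (N:ℝ) + 1 := Nat.lt_floor_add_one _
    have hN1 : (0:ℝ) < ((N + 1 : ℕ):ℝ) := by positivity
    set w := ((((N + 1 : ℕ):ℝ)⁻¹ : ℝ) : ℂ) * z with hw
    have hws : w ∈ Sector θ := hs_sector_smul hz (by positivity)
    have hwn : ‖w‖ < r := by
      rw [hw, norm_mul, Complex.norm_real, Real.norm_of_nonneg (by positivity), inv_mul_lt_iff₀ hN1]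
      rw [div_lt_iff₀ hr] at h2
      push_cast; linarith
    have hzw : z = ((((N + 1 : ℕ):ℝ)):ℂ) * w := by
      rw [hw, ← mul_assoc, ← Complex.ofReal_mul, mul_inv_cancel₀ hN1.ne']; simp
    rw [hzw, hpow w hws N, ← hzw]
    calc ‖S w ^ (N + 1)‖ ≤ ‖S w‖ ^ (N + 1) := norm_pow_le' _ (Nat.succ_pos _)
      _ ≤ M1 ^ (N + 1) := by gcongr; exact hsmall w hws hwn
      _ = M1 * M1 ^ N := by ring
      _ ≤ M1 * Real.exp (a * ‖z‖) := by
        gcongr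
        rw [← Real.exp_log (show 0 < M1 by linarith), ← Real.exp_nat_mul]
        apply Real.exp_le_exp.2
        rw [ha]
        calc (N:ℝ) * Real.log M1 ≤ (‖z‖ / r) * Real.log M1 := by
              gcongr; exact Real.log_nonneg hM11
          _ = _ := by ring
  set δ := max 1 (2 * a) with hδ
  have hsub : Sector (min θ (Real.pi / 3)) ⊆ Sector θ := fun z hz => ⟨hz.1, hz.2.trans_le (min_le_left _ _)⟩
  have hpi := Real.pi_pos
  refine ⟨min θ (Real.pi / 3), δ, M1, fun z => Complex.exp (-(δ * z)) • S z, by positivity,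
    (min_le_right _ _).trans (by linarith), le_max_left _ _, ?_, ?_, ?_⟩
  · refine DifferentiableOn.fun_smul ?_ (hSd.mono hsub)
    exact Differentiable.differentiableOn (by fun_prop)
  · intro z hz
    have hre : ‖z‖ / 2 ≤ z.re := by
      rw [← Complex.norm_mul_cos_arg z, ← Real.cos_abs]
      have h3 : |z.arg| ≤ Real.pi / 3 := (hz.2.trans_le (min_le_right _ _)).le
      have := Real.cos_le_cos_of_nonneg_of_le_pi (abs_nonneg z.arg) (by linarith) h3
      rw [Real.cos_pi_div_three] at this
      nlinarith [norm_nonneg z]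
    rw [norm_smul, Complex.norm_exp]
    have e1 : (-((δ:ℂ) * z)).re = -(δ * z.re) := by simp
    rw [e1]
    have : δ * z.re ≥ a * ‖z‖ := by
      calc δ * z.re ≥ (2 * a) * (‖z‖ / 2) := by
            gcongr
            exact le_max_right _ _
        _ = _ := by ring
    calc Real.exp (-(δ * z.re)) * ‖S z‖ ≤ Real.exp (-(a * ‖z‖)) * (M1 * Real.exp (a * ‖z‖)) := by
          gcongr
          exact hexp z (hsub hz)
      _ = M1 * (Real.exp (-(a * ‖z‖)) * Real.exp (a * ‖z‖)) := by ring
      _ = M1 := by rw [← Real.exp_add]; simp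
  · intro u hu
    simp only
    rw [hST u hu]
    push_cast
    rfl

theorem hs_bddgen {X : Type*} [NormedAddCommGroup X] [NormedSpace ℂ X] [CompleteSpace X]
    {T : ℝ → X →L[ℂ] X} (hT : IsC0Semigroup T) {M : ℝ} (hb : ∀ t, 0 ≤ t → ‖T t‖ ≤ M)
    (hB : ∃ B : X →L[ℂ] X, ∀ x : X, InGenDomain T x (B x)) :
    ∃ C : ℝ, 0 ≤ C ∧ ∀ t, 0 ≤ t → ‖T t - 1‖ ≤ C * (1 - Real.exp (-t)) := by
  obtain ⟨B, hB⟩ := hB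
  have hM0 : 0 ≤ M := (norm_nonneg _).trans (hb 0 le_rfl)
  obtain ⟨C0, hC0⟩ := hs_bs (F := fun t : ℝ => ((t⁻¹ : ℝ):ℂ) • (T t - 1)) (l := 𝓝[>] 0) (fun x => ⟨B x, by
    refine (hB x).congr fun t => ?_
    rw [smul_apply, sub_apply, one_apply_eq_self, Complex.coe_smul]⟩)
  obtain ⟨r0, hr0, hball⟩ := Metric.mem_nhdsWithin_iff.1 hC0
  set r := min 1 (r0/2) with hr
  have hrp : 0 < r := by rw [hr]; have : 0 < r0 := hr0; positivity
  have hr1 : r ≤ 1 := min_le_left _ _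
  have hrr : r < r0 := (min_le_right _ _).trans_lt (by have : 0 < r0 := hr0; linarith)
  have her : 0 < 1 - Real.exp (-r) := by
    have : Real.exp (-r) < 1 := Real.exp_lt_one_iff.2 (by linarith)
    linarith
  set C := max 0 (max (C0 * Real.exp 1) ((M + 1) / (1 - Real.exp (-r)))) with hC
  have hCn : 0 ≤ C := le_max_left _ _
  have hCa : C0 * Real.exp 1 ≤ C := (le_max_left _ _).trans (le_max_right _ _)
  have hCb : (M + 1) / (1 - Real.exp (-r)) ≤ C := (le_max_right _ _).trans (le_max_right _ _)
  refine ⟨C, hCn, fun t ht => ?_⟩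
  rcases ht.eq_or_lt with rfl | ht
  · simp [hT.1]
  rcases le_total t r with htr | htr
  · have h1 : ‖((t⁻¹ : ℝ):ℂ) • (T t - 1)‖ ≤ C0 := hball ⟨by simpa [abs_of_pos ht] using htr.trans_lt hrr, ht⟩
    rw [norm_smul, Complex.norm_real, Real.norm_of_nonneg (by positivity), inv_mul_le_iff₀ ht] at h1
    have hC0n : 0 ≤ C0 := by
      by_contra hneg
      push Not at hneg
      have := norm_nonneg (T t - 1)
      nlinarith
    have h2 := hs_v_le t
    have h3 : Real.exp (-1) ≤ Real.exp (-t) := Real.exp_le_exp.2 (by linarith)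
    have h4 : Real.exp 1 * Real.exp (-1) = 1 := by rw [← Real.exp_add]; simp
    calc ‖T t - 1‖ ≤ t * C0 := h1
      _ = (C0 * Real.exp 1) * (t * Real.exp (-1)) := by linear_combination (-(C0 * t)) * h4
      _ ≤ C * (1 - Real.exp (-t)) := by
        gcongr
        exact le_trans (by gcongr) h2
  · have h1 : ‖T t - 1‖ ≤ M + 1 := (norm_sub_le _ _).trans (add_le_add (hb t ht.le) ContinuousLinearMap.norm_id_le)
    have h2 : Real.exp (-t) ≤ Real.exp (-r) := Real.exp_le_exp.2 (by linarith)
    calc ‖T t - 1‖ ≤ M + 1 := h1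
      _ = (M + 1) / (1 - Real.exp (-r)) * (1 - Real.exp (-r)) := by field_simp
      _ ≤ C * (1 - Real.exp (-t)) := by gcongr

theorem hs_norm_cont {X : Type*} [NormedAddCommGroup X] [NormedSpace ℂ X]
    {g : ℝ → X →L[ℂ] X} (hg : IsC0Semigroup g) {M C : ℝ} (hb : ∀ t, 0 ≤ t → ‖g t‖ ≤ M)
    (hC : ∀ t, 0 ≤ t → ‖g t - 1‖ ≤ C * (1 - Real.exp (-t))) :
    Continuous fun s : ℝ => g (max s 0) := by
  obtain ⟨g0, gadd, gc⟩ := hg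
  have hM : 0 ≤ M := (norm_nonneg _).trans (hb 0 le_rfl)
  have key1 : ∀ s t : ℝ, 0 ≤ s → s ≤ t → ‖g t - g s‖ ≤ M * (C * (1 - Real.exp (-(t - s)))) := by
    intro s t hs hst
    have : g t - g s = g s * (g (t - s) - 1) := by
      rw [mul_sub, mul_one]
      congr 1
      have : g t = g s ∘L g (t - s) := by rw [← gadd s (t-s) hs (by linarith)]; simp
      exact this
    rw [this]
    refine (norm_mul_le _ _).trans ?_
    gcongr
    · exact hb s hs
    · exact hC _ (by linarith)
  have key : ∀ s t : ℝ, 0 ≤ s → 0 ≤ t → ‖g s - g t‖ ≤ M * (C * (1 - Real.exp (-|s - t|))) := by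
    intro s t hs ht
    rcases le_total s t with h | h
    · rw [norm_sub_rev, abs_of_nonpos (by linarith), neg_sub s t]; exact key1 s t hs h
    · rw [abs_of_nonneg (by linarith)]; exact key1 t s ht h
  rw [continuous_iff_continuousAt]
  intro t
  rw [ContinuousAt, tendsto_iff_norm_sub_tendsto_zero]
  refine squeeze_zero (fun _ => norm_nonneg _) (fun s => key _ _ (le_max_right s 0) (le_max_right t 0)) ?_
  have : Continuous fun s : ℝ => M * (C * (1 - Real.exp (-|max s 0 - max t 0|))) := by fun_prop
  simpa using this.tendsto t


theorem hs_norm_exp_le {X : Type*} [NormedAddCommGroup X] [NormedSpace ℂ X] [CompleteSpace X]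
    (N : X →L[ℂ] X) : ‖NormedSpace.exp N‖ ≤ Real.exp ‖N‖ := by
  have h := NormedSpace.exp_series_hasSum_exp' (𝕂 := ℂ) N
  have h2 : HasSum (fun k : ℕ => ‖N‖ ^ k / k.factorial) (Real.exp ‖N‖) := by
    rw [Real.exp_eq_exp_ℝ]
    exact NormedSpace.expSeries_div_hasSum_exp ‖N‖
  refine h.norm_le_of_bounded h2 ?_
  intro k
  rw [norm_smul, norm_inv, Complex.norm_natCast, div_eq_inv_mul]
  gcongr
  rcases k with _ | k
  · rw [pow_zero, pow_zero]; exact ContinuousLinearMap.norm_id_le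
  · exact norm_pow_le' _ (Nat.succ_pos _)

theorem hs_Tprod_succ {X : Type*} [NormedAddCommGroup X] [NormedSpace ℂ X] {n : ℕ}
    (T : Fin (n + 1) → ℝ → X →L[ℂ] X) (u : Fin (n + 1) → ℝ) :
    Tprod T u = T 0 (u 0) * Tprod (fun j => T j.succ) (fun j => u j.succ) := by
  simp [Tprod, List.ofFn_succ]

theorem hs_Tprod_bound {X : Type*} [NormedAddCommGroup X] [NormedSpace ℂ X] {n : ℕ}
    (T : Fin n → ℝ → X →L[ℂ] X) {M : Fin n → ℝ} (hM : ∀ j t, 0 ≤ t → ‖T j t‖ ≤ M j) :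
    ∃ P : ℝ, 0 ≤ P ∧ ∀ u : Fin n → ℝ, (∀ j, 0 ≤ u j) → ‖Tprod T u‖ ≤ P := by
  induction n with
  | zero => exact ⟨1, zero_le_one, fun u _ => by
      simp only [Tprod, List.ofFn_zero, List.prod_nil]; exact ContinuousLinearMap.norm_id_le⟩
  | succ n ih =>
    obtain ⟨P, hP, hPb⟩ := ih (fun j => T j.succ) (M := fun j => M j.succ) (fun j t ht => hM _ t ht)
    have h0 : 0 ≤ M 0 := (norm_nonneg _).trans (hM 0 0 le_rfl)
    refine ⟨M 0 * P, by positivity, fun u hu => ?_⟩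
    rw [hs_Tprod_succ]
    refine (norm_mul_le _ _).trans ?_
    gcongr
    · exact hM 0 _ (hu 0)
    · exact hPb _ fun j => hu _

theorem hs_Tprod_sub_one {X : Type*} [NormedAddCommGroup X] [NormedSpace ℂ X] {n : ℕ}
    (T : Fin n → ℝ → X →L[ℂ] X) {M : Fin n → ℝ} (hM : ∀ j t, 0 ≤ t → ‖T j t‖ ≤ M j)
    (hC : ∀ j, ∃ C : ℝ, 0 ≤ C ∧ ∀ t, 0 ≤ t → ‖T j t - 1‖ ≤ C * (1 - Real.exp (-t))) :
    ∃ P : ℝ, 0 ≤ P ∧ ∀ u : Fin n → ℝ, (∀ j, 0 ≤ u j) →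
      ‖Tprod T u - 1‖ ≤ P * (1 - Real.exp (-∑ j, u j)) := by
  induction n with
  | zero => exact ⟨0, le_rfl, fun u _ => by simp [Tprod]⟩
  | succ n ih =>
    obtain ⟨P, hP, hPb⟩ := ih (fun j => T j.succ) (M := fun j => M j.succ) (fun j t ht => hM _ t ht) (fun j => hC _)
    obtain ⟨C, hC0, hCb⟩ := hC 0
    have h0 : 0 ≤ M 0 := (norm_nonneg _).trans (hM 0 0 le_rfl)
    refine ⟨M 0 * P + C, by positivity, fun u hu => ?_⟩
    rw [hs_Tprod_succ, Fin.sum_univ_succ]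
    set Q := Tprod (fun j => T j.succ) (fun j => u j.succ) with hQ
    set s := ∑ j : Fin n, u j.succ with hs
    have hs0 : 0 ≤ s := Finset.sum_nonneg fun j _ => hu _
    have e : T 0 (u 0) * Q - 1 = T 0 (u 0) * (Q - 1) + (T 0 (u 0) - 1) := by rw [mul_sub, mul_one]; abel
    have e1 : Real.exp (-(u 0 + s)) ≤ Real.exp (-s) := Real.exp_le_exp.2 (by linarith [hu 0])
    have e2 : Real.exp (-(u 0 + s)) ≤ Real.exp (-u 0) := Real.exp_le_exp.2 (by linarith [hu 0])
    have e3 : Real.exp (-s) ≤ 1 := Real.exp_le_one_iff.2 (by linarith)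
    have hq : ‖Q - 1‖ ≤ P * (1 - Real.exp (-s)) := hPb _ fun j => hu _
    rw [e]
    calc _ ≤ M 0 * (P * (1 - Real.exp (-s))) + C * (1 - Real.exp (-u 0)) := by
          refine (norm_add_le _ _).trans (add_le_add ((norm_mul_le _ _).trans ?_) (hCb _ (hu 0)))
          gcongr
          exact hM 0 _ (hu 0)
      _ ≤ M 0 * (P * (1 - Real.exp (-(u 0 + s)))) + C * (1 - Real.exp (-(u 0 + s))) := by gcongr
      _ = _ := by ring

theorem hs_Tprod_sub_W {X : Type*} [NormedAddCommGroup X] [NormedSpace ℂ X] {n : ℕ}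
    (T : Fin (n + 1) → ℝ → X →L[ℂ] X) {M : Fin (n + 1) → ℝ} (hM : ∀ j t, 0 ≤ t → ‖T j t‖ ≤ M j)
    (hC : ∀ j : Fin (n + 1), j ≠ 0 → ∃ C : ℝ, 0 ≤ C ∧ ∀ t, 0 ≤ t → ‖T j t - 1‖ ≤ C * (1 - Real.exp (-t)))
    {δ : ℝ} (hδ : 1 ≤ δ) :
    ∃ P : ℝ, 0 ≤ P ∧ ∀ u : Fin (n + 1) → ℝ, (∀ j, 0 ≤ u j) →
      ‖Tprod T u - ((Real.exp (-(δ * u 0)) : ℝ) : ℂ) • T 0 (u 0)‖ ≤ P * (1 - Real.exp (-∑ j, u j)) := by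
  obtain ⟨P, hP, hPb⟩ := hs_Tprod_sub_one (fun j : Fin n => T j.succ) (M := fun j => M j.succ)
    (fun j t ht => hM _ t ht) (fun j => hC _ (Fin.succ_ne_zero j))
  have h0 : 0 ≤ M 0 := (norm_nonneg _).trans (hM 0 0 le_rfl)
  refine ⟨M 0 * P + δ * M 0, by positivity, fun u hu => ?_⟩
  rw [hs_Tprod_succ, Fin.sum_univ_succ]
  set Q := Tprod (fun j => T j.succ) (fun j => u j.succ) with hQ
  set s := ∑ j : Fin n, u j.succ with hs
  have hs0 : 0 ≤ s := Finset.sum_nonneg fun j _ => hu _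
  set q := Real.exp (-(δ * u 0)) with hq'
  have e : T 0 (u 0) * Q - (q:ℂ) • T 0 (u 0) = T 0 (u 0) * (Q - 1) + ((1 - q : ℝ):ℂ) • T 0 (u 0) := by
    rw [mul_sub, mul_one]; push_cast; rw [sub_smul, one_smul]; abel
  have e1 : Real.exp (-(u 0 + s)) ≤ Real.exp (-s) := Real.exp_le_exp.2 (by linarith [hu 0])
  have e2 : Real.exp (-(u 0 + s)) ≤ Real.exp (-u 0) := Real.exp_le_exp.2 (by linarith [hu 0])
  have e3 : Real.exp (-s) ≤ 1 := Real.exp_le_one_iff.2 (by linarith)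
  have hq : ‖Q - 1‖ ≤ P * (1 - Real.exp (-s)) := hPb _ fun j => hu _
  have hq1 : q ≤ 1 := Real.exp_le_one_iff.2 (by have := hu 0; have := mul_nonneg (by linarith : 0 ≤ δ) this; linarith)
  have hq2 : 1 - q ≤ δ * (1 - Real.exp (-u 0)) := by
    have := one_add_mul_self_le_rpow_one_add (s := Real.exp (-u 0) - 1) (by linarith [Real.exp_pos (-u 0)]) hδ
    rw [add_sub_cancel, ← Real.exp_mul] at this
    have e : -u 0 * δ = -(δ * u 0) := by ring
    rw [e] at this
    linarith
  rw [e]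
  calc _ ≤ M 0 * (P * (1 - Real.exp (-s))) + δ * (1 - Real.exp (-u 0)) * M 0 := by
        refine (norm_add_le _ _).trans (add_le_add ((norm_mul_le _ _).trans ?_) ?_)
        · gcongr
          exact hM 0 _ (hu 0)
        · rw [norm_smul, Complex.norm_real, Real.norm_of_nonneg (by linarith)]
          gcongr
          · linarith
          · exact hM 0 _ (hu 0)
    _ ≤ M 0 * (P * (1 - Real.exp (-(u 0 + s)))) + δ * (1 - Real.exp (-(u 0 + s))) * M 0 := by gcongr
    _ = _ := by ring

theorem hs_Tprod_meas {X : Type*} [NormedAddCommGroup X] [NormedSpace ℂ X] {n : ℕ}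
    (T : Fin n → ℝ → X →L[ℂ] X) (hT : ∀ j, StronglyMeasurable (T j)) : StronglyMeasurable (Tprod T) := by
  have := List.stronglyMeasurable_fun_prod (List.ofFn fun j : Fin n => fun u : Fin n → ℝ => T j (u j)) (by
    intro f hf
    rw [List.mem_ofFn] at hf
    obtain ⟨j, rfl⟩ := hf
    exact (hT j).comp_measurable (measurable_pi_apply j))
  simp only [List.map_ofFn] at this
  exact this

theorem hs_Tprod_comm {X : Type*} [NormedAddCommGroup X] [NormedSpace ℂ X] {n : ℕ}
    (T : Fin n → ℝ → X →L[ℂ] X) (u : Fin n → ℝ) (B : X →L[ℂ] X) (h : ∀ j, Commute B (T j (u j))) :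
    Commute B (Tprod T u) := by
  refine Commute.list_prod_right _ _ ?_
  intro x hx
  rw [List.mem_ofFn] at hx
  obtain ⟨j, rfl⟩ := hx
  exact h j

/-- total mass estimates for the subordinating measures -/
theorem hs_sub_mass {n : ℕ} {ψ : (Fin n → ℝ) → ℝ} (hψ : ∀ s ∈ negOrthant n, ψ s ≤ 0)
    {ν : ℝ → Measure (Fin n → ℝ)} (hν : IsSubordinator n ψ ν) {h : ℝ} (hh : 0 ≤ h) :
    IsFiniteMeasure (ν h) ∧ (∀ᵐ u ∂(ν h), ∀ j, 0 ≤ u j) ∧ (ν h).real Set.univ ≤ 1 ∧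
    Integrable (fun u : Fin n → ℝ => 1 - Real.exp (-∑ j, u j)) (ν h) ∧
    ∫ u, (1 - Real.exp (-∑ j, u j)) ∂(ν h) ≤ h * (-ψ (fun _ => -1)) ∧
    1 - (ν h).real Set.univ ≤ h * (-ψ (fun _ => -1)) := by
  obtain ⟨hfin, hae, hlap⟩ := hν h hh
  have hae : ∀ᵐ u ∂(ν h), ∀ j, 0 ≤ u j := hae
  have hexpi : ∀ c : ℝ, 0 ≤ c → Integrable (fun u : Fin n → ℝ => Real.exp (-(c * ∑ j, u j))) (ν h) := by
    intro c hc
    refine Integrable.of_bound (by fun_prop) 1 (hae.mono fun u hu => ?_)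
    rw [Real.norm_of_nonneg (Real.exp_pos _).le, Real.exp_le_one_iff]
    have : 0 ≤ ∑ j, u j := Finset.sum_nonneg fun j _ => hu j
    have := mul_nonneg hc this
    linarith
  have hl : ∀ c : ℝ, 0 < c → ∫ u : Fin n → ℝ, Real.exp (-(c * ∑ j, u j)) ∂(ν h) = Real.exp (h * ψ (fun _ => -c)) := by
    intro c hc
    have hm : (fun _ : Fin n => -c) ∈ negOrthant n := fun j => by simpa using hc
    rw [← hlap _ hm]
    congr 1
    ext u
    congr 1
    rw [Finset.mul_sum, ← Finset.sum_neg_distrib]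
    refine Finset.sum_congr rfl fun j _ => by ring
  have hmass : (ν h).real Set.univ ≤ 1 := by
    have ht : Tendsto (fun k : ℕ => ∫ u : Fin n → ℝ, Real.exp (-((1 / ((k:ℝ) + 1)) * ∑ j, u j)) ∂(ν h)) atTop
        (𝓝 (∫ u : Fin n → ℝ, (1:ℝ) ∂(ν h))) := by
      refine tendsto_integral_of_dominated_convergence (fun _ => 1) (fun k => by fun_prop) (integrable_const _) ?_ ?_
      · intro k
        refine hae.mono fun u hu => ?_
        rw [Real.norm_of_nonneg (Real.exp_pos _).le, Real.exp_le_one_iff]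
        have : 0 ≤ ∑ j, u j := Finset.sum_nonneg fun j _ => hu j
        have : 0 ≤ (1 / ((k:ℝ) + 1)) * ∑ j, u j := by positivity
        linarith
      · refine Eventually.of_forall fun u => ?_
        have h1 := (tendsto_one_div_add_atTop_nhds_zero_nat (𝕜 := ℝ)).mul_const (∑ j, u j)
        have h2 := (Real.continuous_exp.tendsto _).comp h1.neg
        simpa [Function.comp_def] using h2
    have : ∫ u : Fin n → ℝ, (1:ℝ) ∂(ν h) = (ν h).real Set.univ := by simp
    rw [← this]
    refine le_of_tendsto ht (Eventually.of_forall fun k => ?_)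
    have hp : (0:ℝ) < 1 / ((k:ℝ) + 1) := by positivity
    rw [hl _ hp, Real.exp_le_one_iff]
    exact mul_nonpos_of_nonneg_of_nonpos hh (hψ _ fun j => by simpa using hp)
  have h1 := hl 1 one_pos
  have i1 := hexpi 1 zero_le_one
  simp only [one_mul] at h1 i1
  have hq : 1 - Real.exp (h * ψ (fun _ => -1)) ≤ h * (-ψ (fun _ => -1)) := by
    have := Real.add_one_le_exp (h * ψ (fun _ => -1))
    linarith
  have hint : ∫ u, (1 - Real.exp (-∑ j, u j)) ∂(ν h) = (ν h).real Set.univ - Real.exp (h * ψ (fun _ => -1)) := by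
    rw [integral_sub (integrable_const _) i1, h1]; simp
  have hnn : 0 ≤ ∫ u, (1 - Real.exp (-∑ j, u j)) ∂(ν h) := by
    refine integral_nonneg_of_ae (hae.mono fun u hu => ?_)
    have : 0 ≤ ∑ j, u j := Finset.sum_nonneg fun j _ => hu j
    have : Real.exp (-∑ j, u j) ≤ 1 := Real.exp_le_one_iff.2 (by linarith)
    simpa using this
  refine ⟨hfin, hae, hmass, (integrable_const _).sub i1, ?_, ?_⟩
  · rw [hint]; linarith
  · linarith


theorem hs_push {E : Type*} [NormedRing E] [NormedAlgebra ℂ E] [CompleteSpace E] {n : ℕ}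
    (ν : Measure (Fin (n + 1) → ℝ)) [IsFiniteMeasure ν] (hae : ∀ᵐ u ∂ν, ∀ j, 0 ≤ u j)
    (W : ℂ → E) (f : ℝ → E) (hf : StronglyMeasurable f) (hfW : ∀ u : ℝ, 0 < u → f u = W u) (f0 : f 0 = 1)
    {h : ℝ} (hh : 0 < h) :
    ∃ μ : Measure ℝ, IsFiniteMeasure μ ∧ (∀ᵐ u ∂μ, 0 < u) ∧
      ∫ u : ℝ, (W u - 1) ∂μ = (h : ℂ)⁻¹ • ∫ u, (f (u 0) - 1) ∂ν := by
  have hm : Measurable fun u : Fin (n + 1) → ℝ => u 0 := measurable_pi_apply 0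
  set μ0 := ν.map (fun u => u 0) with hμ0
  have : IsFiniteMeasure μ0 := Measure.isFiniteMeasure_map _ _
  have h0 : ∀ᵐ u ∂μ0, 0 ≤ u := by
    rw [hμ0, ae_map_iff hm.aemeasurable measurableSet_Ici]
    exact hae.mono fun u hu => hu 0
  refine ⟨ENNReal.ofReal h⁻¹ • μ0.restrict (Set.Ioi 0), ?_, ?_, ?_⟩
  · exact Measure.smul_finite _ ENNReal.ofReal_ne_top
  · refine Measure.ae_smul_measure ?_ _
    exact ae_restrict_mem measurableSet_Ioi
  · rw [integral_smul_measure, ENNReal.toReal_ofReal (by positivity)]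
    have e1 : ∫ u in Set.Ioi 0, (W u - 1) ∂μ0 = ∫ u in Set.Ioi 0, (f u - 1) ∂μ0 := by
      refine setIntegral_congr_fun measurableSet_Ioi fun u hu => ?_
      simp only [hfW u hu]
    have e2 : ∫ u in Set.Ioi 0, (f u - 1) ∂μ0 = ∫ u, (f u - 1) ∂μ0 := by
      rw [← integral_indicator measurableSet_Ioi]
      refine integral_congr_ae (h0.mono fun u hu => ?_)
      rcases hu.eq_or_lt with rfl | hu
      · simp [f0]
      · simp [hu]
    have e3 : ∫ u, (f u - 1) ∂μ0 = ∫ u, (f (u 0) - 1) ∂ν :=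
      integral_map hm.aemeasurable (hf.sub stronglyMeasurable_const).aestronglyMeasurable
    rw [e1, e2, e3, ← Complex.ofReal_inv, Complex.coe_smul]

theorem hs_final {X : Type*} [NormedAddCommGroup X] [NormedSpace ℂ X] [CompleteSpace X]
    {n : ℕ} (T : Fin (n + 1) → ℝ → X →L[ℂ] X) (M : Fin (n + 1) → ℝ)
    (hT : ∀ j, IsC0Semigroup (T j)) (hM : ∀ j t, 0 ≤ t → ‖T j t‖ ≤ M j)
    (hcomm : ∀ i j s t, 0 ≤ s → 0 ≤ t → T i s ∘L T j t = T j t ∘L T i s)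
    (hT₁ : IsHolomorphicSemigroup (T 0))
    (hbdd : ∀ j : Fin (n + 1), j ≠ 0 →
      ∃ B : X →L[ℂ] X, ∀ x : X, InGenDomain (T j) x (B x))
    (ψ : (Fin (n + 1) → ℝ) → ℝ) (hψ : MemTn (n + 1) ψ)
    (ν : ℝ → MeasureTheory.Measure (Fin (n + 1) → ℝ)) (hν : IsSubordinator (n + 1) ψ ν)
    (g : ℝ → X →L[ℂ] X) (hgsem : IsC0Semigroup g)
    (hg : ∀ t, 0 ≤ t → ∀ x : X, g t x = ∫ u, Tprod T u x ∂(ν t)) :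
    IsHolomorphicSemigroup g := by
  obtain ⟨θ, δ, MW, W, hθ0, hθ, hδ, hW, hMW, hWT⟩ := hs_first hT₁
  have hCj : ∀ j : Fin (n + 1), j ≠ 0 → ∃ C : ℝ, 0 ≤ C ∧ ∀ t, 0 ≤ t → ‖T j t - 1‖ ≤ C * (1 - Real.exp (-t)) :=
    fun j hj => hs_bddgen (hT j) (hM j) (hbdd j hj)
  have hmul : ∀ u v : ℝ, 0 < u → 0 < v → W ((u + v : ℝ) : ℂ) = W u * W v := by
    intro u v hu hv
    rw [hWT _ (add_pos hu hv), hWT u hu, hWT v hv, (hT 0).2.1 u v hu.le hv.le, smul_mul_smul_comm,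
      ← Complex.ofReal_mul, ← Real.exp_add]
    congr 3
    ring_nf
  obtain ⟨C, ε, hε, hC, hkey⟩ := hs_key hθ0 hθ W hW hMW hmul
  obtain ⟨P, hP, hPb⟩ := hs_Tprod_sub_W T hM hCj hδ
  obtain ⟨P0, hP0, hP0b⟩ := hs_Tprod_bound T hM
  have hpos : ∀ u : ℝ, 0 < u → (u : ℂ) ∈ Sector θ := fun u hu => ⟨by exact_mod_cast hu.ne', by
    rw [Complex.arg_ofReal_of_nonneg hu.le]; simpa using hθ0⟩
  have hco : ContinuousOn (fun u : ℝ => W u) (Set.Ioi 0) :=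
      hW.continuousOn.comp Complex.continuous_ofReal.continuousOn (fun u hu => hpos u hu)
  set f : ℝ → X →L[ℂ] X := fun u => if 0 < u then W u else 1 with hf
  have fm : StronglyMeasurable f := by
    refine stronglyMeasurable_of_restrict_of_restrict_compl (s := Set.Ioi 0) measurableSet_Ioi ?_ ?_
    · refine (continuousOn_iff_continuous_domRestrict.1 (hco.congr ?_)).stronglyMeasurable
      intro u hu
      simp only [hf, if_pos (show 0 < u from hu)]
    · refine (continuousOn_iff_continuous_domRestrict.1 ((continuousOn_const (c := (1:X →L[ℂ] X))).congr ?_)).stronglyMeasurable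
      intro u hu
      simp only [hf, if_neg (show ¬ 0 < u from hu)]
  have fb : ∀ u, ‖f u‖ ≤ max MW ‖(1:X →L[ℂ] X)‖ := by
    intro u
    simp only [hf]
    split_ifs with h1
    · exact (hMW _ (hpos u h1)).trans (le_max_left _ _)
    · exact le_max_right _ _
  have f0 : f 0 = 1 := by simp [hf]
  have fT : ∀ u : ℝ, 0 ≤ u → f u = ((Real.exp (-(δ * u)) : ℝ) : ℂ) • T 0 u := by
    intro u hu
    rcases hu.eq_or_lt with rfl | hu
    · rw [f0, (hT 0).1]; simp
    · simp only [hf, if_pos hu]; exact hWT u hu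
  set Tp : Fin (n + 1) → ℝ → X →L[ℂ] X := fun j s => T j (max s 0) with hTp
  have Tpm : ∀ j, StronglyMeasurable (Tp j) := by
    intro j
    by_cases hj : j = 0
    · subst hj
      have e : Tp 0 = fun s : ℝ => ((Real.exp (δ * max s 0) : ℝ) : ℂ) • f s := by
        funext s
        by_cases hs : 0 < s
        · rw [fT s hs.le, max_eq_left hs.le, smul_smul, ← Complex.ofReal_mul, ← Real.exp_add]
          simp [hTp, max_eq_left hs.le]
        · push Not at hs
          simp [hTp, max_eq_right hs, (hT 0).1, hf, not_lt.2 hs]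
      rw [e]
      have hcs : StronglyMeasurable fun s : ℝ => ((Real.exp (δ * max s 0) : ℝ) : ℂ) :=
        (by fun_prop : Continuous fun s : ℝ => ((Real.exp (δ * max s 0) : ℝ) : ℂ)).stronglyMeasurable
      exact hcs.smul fm
    · obtain ⟨Cj, hC0, hCb⟩ := hCj j hj
      exact (hs_norm_cont (hT j) (hM j) hCb).stronglyMeasurable
  have Fm := hs_Tprod_meas Tp Tpm
  have Feq : ∀ u : Fin (n + 1) → ℝ, (∀ j, 0 ≤ u j) → Tprod Tp u = Tprod T u := by
    intro u hu
    simp only [Tprod, hTp, max_eq_left (hu _)]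
  have hint : ∀ t, 0 ≤ t → Integrable (Tprod Tp) (ν t) ∧ g t = ∫ u, Tprod Tp u ∂(ν t) := by
    intro t ht
    obtain ⟨hfin, hae, -, -, -, -⟩ := hs_sub_mass hψ.2.1 hν ht
    have hi : Integrable (Tprod Tp) (ν t) := by
      refine Integrable.of_bound Fm.aestronglyMeasurable P0 (hae.mono fun u hu => ?_)
      rw [Feq u hu]; exact hP0b u hu
    refine ⟨hi, ?_⟩
    ext x
    rw [hg t ht, ContinuousLinearMap.integral_apply hi]
    exact integral_congr_ae (hae.mono fun u hu => by simp only [Feq u hu])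
  have hgb : ∀ t, 0 ≤ t → ‖g t‖ ≤ P0 := by
    intro t ht
    obtain ⟨hfin, hae, hm1, -, -, -⟩ := hs_sub_mass hψ.2.1 hν ht
    rw [(hint t ht).2]
    refine (norm_integral_le_of_norm_le_const (hae.mono fun u hu => ?_)).trans
      (mul_le_of_le_one_right hP0 hm1)
    rw [Feq u hu]; exact hP0b u hu
  set b := -ψ (fun _ => -1) with hb
  have hb0 : 0 ≤ b := by
    have := hψ.2.1 (fun _ => -1) (fun j => by norm_num)
    linarith
  refine hs_main_limit hgsem hgb hC (C' := (P + 1) * b) (by positivity) hε ?_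
  intro h hh z hz
  obtain ⟨hfin, hae, hm1, hei, heb, hm2⟩ := hs_sub_mass hψ.2.1 hν hh.le
  obtain ⟨hFi, hgF⟩ := hint h hh.le
  obtain ⟨μ, hμ, hμ0, hB⟩ := hs_push (ν h) hae W f fm (fun u hu => by simp [hf, hu]) f0 hh
  have hk := hkey μ hμ0 z hz
  rw [hB] at hk
  have hfi : Integrable (fun u : Fin (n + 1) → ℝ => f (u 0)) (ν h) :=
    Integrable.of_bound (fm.comp_measurable (measurable_pi_apply 0)).aestronglyMeasurable _
      (Eventually.of_forall fun u => fb _)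
  set m := (ν h).real Set.univ with hm
  set Φ := ∫ u, f (u 0) ∂(ν h) with hΦ
  have hB' : ∫ u, (f (u 0) - 1) ∂(ν h) = Φ - (m:ℂ) • (1 : X →L[ℂ] X) := by
    rw [integral_sub hfi (integrable_const _), integral_const]
    congr 1
  set B := (h : ℂ)⁻¹ • ∫ u, (f (u 0) - 1) ∂(ν h) with hBdef
  set A := (h : ℂ)⁻¹ • (g h - 1) with hA
  -- commutation
  have hc1 : ∀ s : ℝ, 0 ≤ s → Commute (f s) (g h) := by
    intro s hs
    rw [hgF]
    show _ * _ = _ * _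
    rw [← integral_const_mul_of_integrable hFi, ← integral_mul_const_of_integrable hFi]
    refine integral_congr_ae (hae.mono fun u hu => ?_)
    have : Commute (f s) (Tprod Tp u) := by
      rw [Feq u hu, fT s hs]
      refine Commute.smul_left (hs_Tprod_comm T u _ fun j => ?_) _
      exact hcomm 0 j s (u j) hs (hu j)
    exact this
  have hc2 : Commute Φ (g h) := by
    show _ * _ = _ * _
    rw [hΦ, ← integral_const_mul_of_integrable hfi, ← integral_mul_const_of_integrable hfi]
    exact integral_congr_ae (hae.mono fun u hu => hc1 _ (hu 0))
  have hc3 : Commute B A := by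
    rw [hBdef, hA, hB']
    refine Commute.smul_left (Commute.smul_right ?_ _) _
    refine Commute.sub_right (Commute.sub_left hc2 ?_) (Commute.one_right _)
    exact (Commute.one_left _).smul_left _
  have hc4 : Commute B (A - B) := hc3.sub_right (Commute.refl _)
  have hK : ‖A - B‖ ≤ (P + 1) * b := by
    have e : A - B = (h : ℂ)⁻¹ • ((∫ u, (Tprod Tp u - f (u 0)) ∂(ν h)) - ((1 - m : ℝ) : ℂ) • (1 : X →L[ℂ] X)) := by
      rw [hA, hBdef, ← smul_sub, hB', integral_sub hFi hfi, ← hgF]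
      congr 1
      push_cast
      rw [sub_smul, one_smul]
      abel
    have n1 : ‖∫ u, (Tprod Tp u - f (u 0)) ∂(ν h)‖ ≤ P * (h * b) := by
      refine (norm_integral_le_of_norm_le (hei.const_mul P) (hae.mono fun u hu => ?_)).trans ?_
      · rw [Feq u hu, fT _ (hu 0)]; exact hPb u hu
      · rw [integral_const_mul]; gcongr
    have n2 : ‖((1 - m : ℝ) : ℂ) • (1 : X →L[ℂ] X)‖ ≤ h * b := by
      rw [norm_smul, Complex.norm_real, Real.norm_of_nonneg (by linarith)]
      refine (mul_le_of_le_one_right (by linarith) ContinuousLinearMap.norm_id_le).trans hm2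
    rw [e, norm_smul, norm_inv, Complex.norm_real, Real.norm_of_nonneg hh.le, inv_mul_le_iff₀ hh]
    refine (norm_sub_le _ _).trans ((add_le_add n1 n2).trans (le_of_eq (by ring)))
  have hz' : z • A = z • B + z • (A - B) := by rw [← smul_add]; congr 1; abel
  rw [hz', hs_exp_add ((hc4.smul_left z).smul_right z)]
  refine (norm_mul_le _ _).trans ?_
  gcongr
  refine (hs_norm_exp_le _).trans ?_
  rw [Real.exp_le_exp, norm_smul, mul_comm]
  gcongr


/-- Let `X` be a uniformly convex complex Banach space, `T₁` a holomorphic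
(uniformly bounded) `C₀`-semigroup on `X`, and let `A₂,…,Aₙ` be bounded pairwise commuting
operators (commuting with `A₁`) generating uniformly bounded semigroups. Then for every
`ψ ∈ 𝒯ₙ` the operator `ψ(A)` generates a holomorphic semigroup. -/
theorem holomorphic_of_first_holomorphic_rest_bounded
    {X : Type*} [NormedAddCommGroup X] [NormedSpace ℂ X] [CompleteSpace X]
    [UniformConvexSpace X]
    {n : ℕ} (T : Fin (n + 1) → ℝ → X →L[ℂ] X) (M : Fin (n + 1) → ℝ)
    (hT : ∀ j, IsC0Semigroup (T j)) (hM : ∀ j t, 0 ≤ t → ‖T j t‖ ≤ M j)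
    (hcomm : ∀ i j s t, 0 ≤ s → 0 ≤ t → T i s ∘L T j t = T j t ∘L T i s)
    (hT₁ : IsHolomorphicSemigroup (T 0))
    (hbdd : ∀ j : Fin (n + 1), j ≠ 0 →
      ∃ B : X →L[ℂ] X, ∀ x : X, InGenDomain (T j) x (B x))
    (ψ : (Fin (n + 1) → ℝ) → ℝ) (hψ : MemTn (n + 1) ψ)
    (ν : ℝ → MeasureTheory.Measure (Fin (n + 1) → ℝ)) (hν : IsSubordinator (n + 1) ψ ν)
    (g : ℝ → X →L[ℂ] X) (hgsem : IsC0Semigroup g)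
    (hg : ∀ t, 0 ≤ t → ∀ x : X, g t x = ∫ u, Tprod T u x ∂(ν t)) :
    IsHolomorphicSemigroup g := by
  exact hs_final T M hT hM hcomm hT₁ hbdd ψ hψ ν hν g hgsem hg
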